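/- arXiv:1407.7453 — 5 statements merged into one kernel-verified Lean document; each statement's English description precedes it below -/
import Mathlib

section
/- Let b be a connected graph over (X,m), ρ an intrinsic metric satisfying conditions (D) and (J), p ∈ (1,∞) and x ∈ X. If f is a harmonic function with limsup_{r→∞} (1/(r² log r)) ∑_{y∈B_r(x)} |f(y)|^p m(y) < ∞, then f is constant. -/
/-!
STATEMENT 13: Under conditions (D) and (J), a harmonic function `f` with
`limsup_{r→∞} (1/(r² log r)) ∑_{y ∈ B_r(x)} |f y|^p m(y) < ∞` is constant.
The growth condition is encoded as: there is `C` such that eventually (in `r`)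
`∑_{y ∈ B_r(x)} |f y|^p m(y) ≤ C · r² log r` (sums computed in `[0,∞]`).
-/

open scoped ENNReal

namespace Stmt13

/-- The formal Laplacian (with `c ≡ 0`). -/
noncomputable def lap {X : Type*} (m : X → ℝ) (b : X → X → ℝ)
    (f : X → ℝ) (x : X) : ℝ :=
  (1 / m x) * (∑' y, b x y * (f x - f y))

/-- The weighted vertex degree `Deg(x) = (1/m x) ∑_y b x y`. -/
noncomputable def Deg {X : Type*} (m : X → ℝ) (b : X → X → ℝ) (x : X) : ℝ :=
  (1 / m x) * ∑' y, b x y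

/-- The odd power `t ↦ sign t * |t| ^ q`. -/
noncomputable def signPow (q t : ℝ) : ℝ := SignType.sign t * |t| ^ q

lemma signPow_neg (q t : ℝ) : signPow q (-t) = -signPow q t := by
  simp [signPow, Left.sign_neg]

lemma signPow_of_pos (q : ℝ) {t : ℝ} (ht : 0 < t) : signPow q t = t ^ q := by
  simp [signPow, sign_pos ht, abs_of_pos ht]

lemma abs_signPow_le (q t : ℝ) : |signPow q t| ≤ |t| ^ q := by
  have h : 0 ≤ |t| ^ q := by positivity
  rcases lt_trichotomy t 0 with ht | ht | ht
  · simp [signPow, sign_neg ht, abs_of_nonneg h]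
  · subst ht; simpa [signPow] using h
  · simp [signPow, sign_pos ht, abs_of_nonneg h]

lemma signPow_mul_of_pos (q t : ℝ) {v : ℝ} (hv : 0 < v) :
    signPow q (t * v) = signPow q t * v ^ q := by
  simp [signPow, sign_mul, sign_pos hv, abs_mul, abs_of_pos hv,
    Real.mul_rpow (abs_nonneg t) hv.le, mul_assoc]

lemma mul_one_sub_le_one_sub_signPow {q t : ℝ} (hq : 0 < q) (ht : |t| ≤ 1) :
    min 1 q / 2 * (1 - t) ≤ 1 - signPow q t := by
  obtain ⟨h1, h2⟩ := abs_le.mp ht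
  have hm : min 1 q ≤ 1 := min_le_left _ _
  have hm' : min 1 q ≤ q := min_le_right _ _
  have hm0 : 0 < min 1 q := lt_min one_pos hq
  rcases lt_trichotomy t 0 with h | h | h
  · have : signPow q t ≤ 0 := by
      simp only [signPow, sign_neg h, SignType.coe_neg_one, neg_mul, one_mul,
        Left.neg_nonpos_iff]
      positivity
    nlinarith
  · subst h; simp [signPow]; linarith
  · rw [signPow_of_pos q h]
    rcases le_total 1 q with hq1 | hq1
    · have : t ^ q ≤ t ^ (1 : ℝ) := Real.rpow_le_rpow_of_exponent_ge h h2 hq1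
      rw [Real.rpow_one] at this
      nlinarith
    · have := rpow_one_add_le_one_add_mul_self (s := t - 1) (by linarith) hq.le hq1
      rw [show 1 + (t - 1) = t by ring] at this
      nlinarith

lemma mul_sub_mul_rpow_le_signPow_sub {q u v : ℝ} (hq : 0 < q) (hv : 0 < v) (huv : |u| ≤ v) :
    min 1 q / 2 * (v - u) * v ^ q ≤ v * (signPow q v - signPow q u) := by
  have ht : |u / v| ≤ 1 := by
    rw [abs_div, abs_of_pos hv]; exact (div_le_one hv).mpr huv
  have key := mul_one_sub_le_one_sub_signPow hq ht
  have hu : u = u / v * v := by field_simp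
  have hvq : 0 < v ^ q := by positivity
  have h2 : signPow q u = signPow q (u / v) * v ^ q := by
    rw [← signPow_mul_of_pos q _ hv, ← hu]
  rw [signPow_of_pos q hv, h2]
  have := mul_le_mul_of_nonneg_right key (mul_pos hv hvq).le
  calc _ = min 1 q / 2 * (1 - u / v) * (v * v ^ q) := by field_simp
    _ ≤ _ := this
    _ = _ := by ring

lemma abs_mul_signPow_le {p : ℝ} (hp : 1 < p) (u v : ℝ) :
    |u * signPow (p - 1) v| ≤ |u| ^ p + |v| ^ p := by
  have hmul (a : ℝ) (ha : 0 ≤ a) : a * a ^ (p - 1) = a ^ p := by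
    rw [mul_comm, ← Real.rpow_add_one' ha (by linarith)]; ring_nf
  have hq : 0 ≤ p - 1 := by linarith
  have hu : 0 ≤ |u| ^ p := by positivity
  have hv : 0 ≤ |v| ^ p := by positivity
  rw [abs_mul]
  calc |u| * |signPow (p - 1) v| ≤ |u| * |v| ^ (p - 1) := by
        gcongr; exact abs_signPow_le _ _
    _ ≤ _ := by
      rcases le_total |u| |v| with h | h
      · calc |u| * |v| ^ (p - 1) ≤ |v| * |v| ^ (p - 1) := by gcongr
          _ = |v| ^ p := hmul _ (abs_nonneg v)
          _ ≤ _ := by linarith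
      · calc |u| * |v| ^ (p - 1) ≤ |u| * |u| ^ (p - 1) := by gcongr
          _ = |u| ^ p := hmul _ (abs_nonneg u)
          _ ≤ _ := by linarith

/-- Strict monotonicity of the odd power together with the pointwise bound that drives the
Caccioppoli inequality. -/
lemma signPow_pointwise {p : ℝ} (hp : 1 < p) (u v : ℝ) :
    min 1 (p - 1) * ((u - v) * (signPow (p - 1) u + signPow (p - 1) v)) ^ 2 ≤
      8 * ((u - v) * (signPow (p - 1) u - signPow (p - 1) v)) * (|u| ^ p + |v| ^ p) ∧
    0 ≤ (u - v) * (signPow (p - 1) u - signPow (p - 1) v) ∧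
    ((u - v) * (signPow (p - 1) u - signPow (p - 1) v) = 0 → u = v) := by
  wlog huv : |u| ≤ |v| generalizing u v
  · have h := this v u (le_of_not_ge huv)
    refine ⟨?_, ?_, fun h0 ↦ (h.2.2 ?_).symm⟩
    · calc _ = min 1 (p - 1) * ((v - u) * (signPow (p - 1) v + signPow (p - 1) u)) ^ 2 := by ring
        _ ≤ _ := h.1
        _ = _ := by ring
    · linarith [h.2.1]
    · linarith
  wlog hv : 0 ≤ v generalizing u v
  · have h := this (-u) (-v) (by simpa using huv) (by linarith)
    simp only [signPow_neg, abs_neg] at h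
    refine ⟨?_, ?_, fun h0 ↦ neg_injective (h.2.2 ?_)⟩
    · calc _ = min 1 (p - 1) *
            ((-u - -v) * (-signPow (p - 1) u + -signPow (p - 1) v)) ^ 2 := by ring
        _ ≤ _ := h.1
        _ = _ := by ring
    · linarith [h.2.1]
    · linarith
  rcases hv.eq_or_lt with rfl | hv
  · have : u = 0 := by simpa using huv
    subst this; simp
  rw [abs_of_pos hv] at huv ⊢
  have hq : 0 < p - 1 := by linarith
  have key := mul_sub_mul_rpow_le_signPow_sub hq hv huv
  have hm0 : 0 < min 1 (p - 1) := lt_min one_pos hq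
  set c := min 1 (p - 1)
  have hVp : v ^ p = v * v ^ (p - 1) := by
    rw [mul_comm, ← Real.rpow_add_one' hv.le (by linarith)]; ring_nf
  have hV : 0 < v ^ (p - 1) := by positivity
  have hgu : |signPow (p - 1) u| ≤ v ^ (p - 1) :=
    (abs_signPow_le _ _).trans (Real.rpow_le_rpow (abs_nonneg u) huv hq.le)
  have hgv : signPow (p - 1) v = v ^ (p - 1) := signPow_of_pos _ hv
  have hU : 0 ≤ |u| ^ p := by positivity
  rw [hgv] at key ⊢
  rw [hVp]
  set V := v ^ (p - 1)
  set G := signPow (p - 1) u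
  have huv' : 0 ≤ v - u := by linarith [(abs_le.mp huv).2]
  obtain ⟨hG1, hG2⟩ := abs_le.mp hgu
  have hGV : 0 ≤ V - G := by linarith
  refine ⟨?_, ?_, ?_⟩
  · have h1 : (G + V) ^ 2 ≤ 4 * V ^ 2 := by nlinarith
    have h2 : (v - u) * (c / 2 * (v - u) * V) ≤ (v - u) * (v * (V - G)) :=
      mul_le_mul_of_nonneg_left key huv'
    calc c * ((u - v) * (G + V)) ^ 2 = c * (v - u) ^ 2 * (G + V) ^ 2 := by ring
      _ ≤ c * (v - u) ^ 2 * (4 * V ^ 2) := by gcongr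
      _ = 8 * V * ((v - u) * (c / 2 * (v - u) * V)) := by ring
      _ ≤ 8 * V * ((v - u) * (v * (V - G))) := by gcongr
      _ = 8 * ((v - u) * (V - G)) * (0 + v * V) := by ring
      _ ≤ 8 * ((v - u) * (V - G)) * (|u| ^ p + v * V) := by gcongr
      _ = _ := by ring
  · nlinarith
  · intro h0
    by_contra hne
    have hlt : 0 < v - u := lt_of_le_of_ne huv' (fun h ↦ hne (by linarith))
    have h3 : 0 < c / 2 * (v - u) * V := by positivity
    have h4 : 0 < V - G := by
      by_contra hcon
      nlinarith
    nlinarith [mul_pos hlt h4]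

lemma summable_and_tsum_le_of_tsum_ofReal_le {ι : Type*} {f : ι → ℝ} {c : ℝ}
    (hf : ∀ i, 0 ≤ f i) (hc : 0 ≤ c)
    (h : ∑' i, ENNReal.ofReal (f i) ≤ ENNReal.ofReal c) : Summable f ∧ ∑' i, f i ≤ c := by
  have hs : Summable f := by
    have := ENNReal.summable_toReal (ne_top_of_le_ne_top ENNReal.ofReal_ne_top h)
    simpa [ENNReal.toReal_ofReal, hf] using this
  refine ⟨hs, ?_⟩
  rwa [← ENNReal.ofReal_tsum_of_nonneg hf hs, ENNReal.ofReal_le_ofReal_iff hc] at h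

lemma summable_mul_kernel_and_tsum_le {X : Type*} {k : X → X → ℝ} {a n : X → ℝ}
    (hk : ∀ x y, 0 ≤ k x y) (ha : ∀ x, 0 ≤ a x) (hks : ∀ x, Summable (k x))
    (hkn : ∀ x, ∑' y, k x y ≤ n x) (han : Summable fun x ↦ a x * n x) :
    Summable (fun z : X × X ↦ a z.1 * k z.1 z.2) ∧
      ∑' z : X × X, a z.1 * k z.1 z.2 ≤ ∑' x, a x * n x := by
  have hle (x : X) : ∑' y, a x * k x y ≤ a x * n x := by
    rw [tsum_mul_left]; exact mul_le_mul_of_nonneg_left (hkn x) (ha x)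
  have hs1 : Summable fun x ↦ ∑' y, a x * k x y :=
    Summable.of_nonneg_of_le (fun x ↦ tsum_nonneg fun y ↦ mul_nonneg (ha x) (hk x y)) hle han
  have h0 : 0 ≤ fun z : X × X ↦ a z.1 * k z.1 z.2 := fun z ↦ mul_nonneg (ha z.1) (hk z.1 z.2)
  have hs : Summable (fun z : X × X ↦ a z.1 * k z.1 z.2) := by
    rw [summable_prod_of_nonneg h0]
    exact ⟨fun x ↦ (hks x).mul_left (a x), hs1⟩
  refine ⟨hs, ?_⟩
  rw [hs.tsum_prod]
  exact Summable.tsum_le_tsum hle hs1 han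

lemma hasSum_green {X : Type*} {b : X → X → ℝ} (hb : ∀ x y, b x y = b y x) {f g : X → ℝ}
    (hf : ∀ x, ∑' y, b x y * (f x - f y) = 0)
    (hs : Summable fun z : X × X ↦ g z.1 * (b z.1 z.2 * (f z.1 - f z.2))) :
    HasSum (fun z : X × X ↦ b z.1 z.2 * (f z.1 - f z.2) * (g z.1 - g z.2)) 0 := by
  have hrow (x : X) : ∑' y, g x * (b x y * (f x - f y)) = 0 := by
    rw [tsum_mul_left, hf x, mul_zero]
  have h0 : HasSum (fun z : X × X ↦ g z.1 * (b z.1 z.2 * (f z.1 - f z.2))) 0 := by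
    have h := hs.hasSum
    rwa [hs.tsum_prod, tsum_congr hrow, tsum_zero] at h
  have h1 : HasSum (fun z : X × X ↦ g z.2 * (b z.2 z.1 * (f z.2 - f z.1))) 0 :=
    (Equiv.prodComm X X).hasSum_iff.mpr h0
  have h2 := h0.add h1
  rw [add_zero] at h2
  convert h2 using 2 with z
  rw [hb z.2 z.1]
  ring

set_option maxHeartbeats 1000000 in
/-- A Caccioppoli-type inequality. Here `h` plays the role of `|f| ^ p` and `g` that of
`sign f * |f| ^ (p - 1)`. -/
lemma caccioppoli {X : Type*} {b : X → X → ℝ} (hb : ∀ x y, b x y = b y x)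
    (hb0 : ∀ x y, 0 ≤ b x y) {f g h : X → ℝ} {C : ℝ} (hC : 0 ≤ C)
    (hf : ∀ x, ∑' y, b x y * (f x - f y) = 0) (hh : ∀ x, 0 ≤ h x)
    (hfg0 : ∀ x y, 0 ≤ (f x - f y) * (g x - g y))
    (hfg : ∀ x y, ((f x - f y) * (g x + g y)) ^ 2 ≤
      C * ((f x - f y) * (g x - g y)) * (h x + h y))
    (hfgh : ∀ x y, |f x * g y| ≤ h x + h y)
    {η : X → ℝ} (hη0 : ∀ x, 0 ≤ η x) (hη1 : ∀ x, η x ≤ 1) {B : Set X}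
    (hB : ∀ x y, b x y ≠ 0 → η x ≠ 0 → x ∈ B ∧ y ∈ B)
    (hs : Summable fun z : X × X ↦ B.indicator h z.1 * b z.1 z.2)
    {k : X → X → ℝ} (hk : ∀ x y, k x y = k y x)
    (hηk : ∀ x y, b x y * (η x - η y) ^ 2 ≤ k x y)
    (hks : Summable fun z : X × X ↦ B.indicator h z.1 * k z.1 z.2) :
    Summable (fun z : X × X ↦ b z.1 z.2 * ((f z.1 - f z.2) * (g z.1 - g z.2)) *
      (η z.1 ^ 2 + η z.2 ^ 2)) ∧
    ∀ ε > 0, ∀ e' : X × X → ℝ, Summable e' →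
      (∀ z, e' z ≤ b z.1 z.2 * ((f z.1 - f z.2) * (g z.1 - g z.2)) * (η z.1 ^ 2 + η z.2 ^ 2)) →
      (∀ z, η z.1 ≠ η z.2 → e' z ≤ 0) →
      ∑' z : X × X, b z.1 z.2 * ((f z.1 - f z.2) * (g z.1 - g z.2)) * (η z.1 ^ 2 + η z.2 ^ 2) ≤
        ε * (∑' z : X × X, b z.1 z.2 * ((f z.1 - f z.2) * (g z.1 - g z.2)) *
          (η z.1 ^ 2 + η z.2 ^ 2) - ∑' z, e' z) +
        C / ε * ∑' z : X × X, B.indicator h z.1 * k z.1 z.2 := by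
  have hI (x : X) : 0 ≤ B.indicator h x := Set.indicator_nonneg (fun x _ ↦ hh x) x
  have hk0 (x y : X) : 0 ≤ k x y := (mul_nonneg (hb0 x y) (sq_nonneg _)).trans (hηk x y)
  have hs' : Summable fun z : X × X ↦ B.indicator h z.2 * b z.1 z.2 := by
    have h1 : Summable fun z : X × X ↦ B.indicator h z.2 * b z.2 z.1 :=
      (Equiv.prodComm X X).summable_iff.mpr hs
    exact h1.congr fun z ↦ by rw [hb z.2 z.1]
  have hks' : HasSum (fun z : X × X ↦ B.indicator h z.2 * k z.1 z.2)
      (∑' z : X × X, B.indicator h z.1 * k z.1 z.2) := by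
    have h1 : HasSum (fun z : X × X ↦ B.indicator h z.2 * k z.2 z.1)
      (∑' z : X × X, B.indicator h z.1 * k z.1 z.2) :=
      (Equiv.prodComm X X).hasSum_iff.mpr hks.hasSum
    convert h1 using 3 with z
    rw [hk z.2 z.1]
  have hdom (z : X × X) : b z.1 z.2 * (h z.1 + h z.2) * η z.1 ^ 2 ≤
      B.indicator h z.1 * b z.1 z.2 + B.indicator h z.2 * b z.1 z.2 := by
    have h1 := hη0 z.1
    have h2 := hη1 z.1
    have h3 := mul_nonneg (hI z.1) (hb0 z.1 z.2)
    have h4 := mul_nonneg (hI z.2) (hb0 z.1 z.2)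
    by_cases hz : b z.1 z.2 = 0
    · simp [hz]
    by_cases hz' : η z.1 = 0
    · rw [hz']; linarith
    obtain ⟨hx, hy⟩ := hB _ _ hz hz'
    rw [Set.indicator_of_mem hx, Set.indicator_of_mem hy]
    have h5 : 0 ≤ b z.1 z.2 * (h z.1 + h z.2) :=
      mul_nonneg (hb0 _ _) (add_nonneg (hh _) (hh _))
    have h6 : η z.1 ^ 2 ≤ 1 := by nlinarith
    nlinarith [mul_nonneg h5 (sub_nonneg.mpr h6)]
  have hsdom := hs.add hs'
  have hη2 (x : X) : 0 ≤ η x ^ 2 := sq_nonneg _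
  have hsG : Summable fun z : X × X ↦
      (g z.1 * η z.1 ^ 2) * (b z.1 z.2 * (f z.1 - f z.2)) := by
    refine Summable.of_norm_bounded (hsdom.mul_left 3) fun z ↦ ?_
    rw [Real.norm_eq_abs]
    have h1 : |(f z.1 - f z.2) * g z.1| ≤ 3 * (h z.1 + h z.2) := by
      have h11 := abs_le.mp (hfgh z.1 z.1)
      have h21 := abs_le.mp (hfgh z.2 z.1)
      have := hh z.1
      have := hh z.2
      rw [abs_le]
      constructor <;> nlinarith
    calc _ = b z.1 z.2 * η z.1 ^ 2 * |(f z.1 - f z.2) * g z.1| := by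
          nth_rw 1 [← abs_of_nonneg (mul_nonneg (hb0 z.1 z.2) (hη2 z.1))]
          rw [← abs_mul]
          congr 1
          ring
      _ ≤ b z.1 z.2 * η z.1 ^ 2 * (3 * (h z.1 + h z.2)) :=
          mul_le_mul_of_nonneg_left h1 (mul_nonneg (hb0 _ _) (hη2 _))
      _ = 3 * (b z.1 z.2 * (h z.1 + h z.2) * η z.1 ^ 2) := by ring
      _ ≤ _ := mul_le_mul_of_nonneg_left (hdom z) (by norm_num)
  have hG := hasSum_green hb (g := fun x ↦ g x * η x ^ 2) hf hsG
  have he0 (z : X × X) : 0 ≤ b z.1 z.2 * ((f z.1 - f z.2) * (g z.1 - g z.2)) :=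
    mul_nonneg (hb0 _ _) (hfg0 _ _)
  have hs1 : Summable fun z : X × X ↦
      b z.1 z.2 * ((f z.1 - f z.2) * (g z.1 - g z.2)) * η z.1 ^ 2 := by
    refine Summable.of_nonneg_of_le (fun z ↦ mul_nonneg (he0 z) (hη2 _)) (fun z ↦ ?_)
      (hsdom.mul_left 4)
    have h1 : (f z.1 - f z.2) * (g z.1 - g z.2) ≤ 4 * (h z.1 + h z.2) := by
      have h11 := abs_le.mp (hfgh z.1 z.1)
      have h21 := abs_le.mp (hfgh z.2 z.1)
      have h12 := abs_le.mp (hfgh z.1 z.2)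
      have h22 := abs_le.mp (hfgh z.2 z.2)
      have := hh z.1
      have := hh z.2
      nlinarith
    calc _ = b z.1 z.2 * η z.1 ^ 2 * ((f z.1 - f z.2) * (g z.1 - g z.2)) := by ring
      _ ≤ b z.1 z.2 * η z.1 ^ 2 * (4 * (h z.1 + h z.2)) :=
          mul_le_mul_of_nonneg_left h1 (mul_nonneg (hb0 _ _) (hη2 _))
      _ = 4 * (b z.1 z.2 * (h z.1 + h z.2) * η z.1 ^ 2) := by ring
      _ ≤ _ := mul_le_mul_of_nonneg_left (hdom z) (by norm_num)
  have hs2 : Summable fun z : X × X ↦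
      b z.2 z.1 * ((f z.2 - f z.1) * (g z.2 - g z.1)) * η z.2 ^ 2 :=
    (Equiv.prodComm X X).summable_iff.mpr hs1
  have hsE : Summable fun z : X × X ↦
      b z.1 z.2 * ((f z.1 - f z.2) * (g z.1 - g z.2)) * (η z.1 ^ 2 + η z.2 ^ 2) := by
    refine (hs1.add hs2).congr fun z ↦ ?_
    rw [hb z.2 z.1]
    ring
  refine ⟨hsE, fun ε hε e' he' hle hle0 ↦ ?_⟩
  have hsum := (hG.mul_left 2).add (((hsE.hasSum.sub he'.hasSum).mul_left ε).add
    ((hks.hasSum.add hks').mul_left (C / (2 * ε))))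
  refine (hasSum_le (fun z ↦ ?_) hsE.hasSum hsum).trans_eq (by field_simp; ring)
  have hlez := hle z
  have hle0z := hle0 z
  set E := b z.1 z.2 * ((f z.1 - f z.2) * (g z.1 - g z.2)) with hE
  set T := b z.1 z.2 * ((f z.1 - f z.2) * (g z.1 + g z.2)) * (η z.1 ^ 2 - η z.2 ^ 2) with hT
  have hY0 : 0 ≤ B.indicator h z.1 * k z.1 z.2 + B.indicator h z.2 * k z.1 z.2 :=
    add_nonneg (mul_nonneg (hI _) (hk0 _ _)) (mul_nonneg (hI _) (hk0 _ _))
  set Y := B.indicator h z.1 * k z.1 z.2 + B.indicator h z.2 * k z.1 z.2 with hY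
  have hETG : E * (η z.1 ^ 2 + η z.2 ^ 2) =
      2 * (b z.1 z.2 * (f z.1 - f z.2) * (g z.1 * η z.1 ^ 2 - g z.2 * η z.2 ^ 2)) - T := by
    rw [hE, hT]; ring
  suffices hmain : -T ≤ ε * (E * (η z.1 ^ 2 + η z.2 ^ 2) - e' z) + C / (2 * ε) * Y by
    linarith
  by_cases hT0 : T = 0
  · rw [hT0, neg_zero]
    have : 0 ≤ E * (η z.1 ^ 2 + η z.2 ^ 2) - e' z := by linarith
    positivity
  have hbz : b z.1 z.2 ≠ 0 := fun h0 ↦ hT0 (by rw [hT, h0]; ring)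
  have hηz : η z.1 ≠ η z.2 := fun h0 ↦ hT0 (by rw [hT, h0]; ring)
  have hmem : z.1 ∈ B ∧ z.2 ∈ B := by
    by_cases h1 : η z.1 = 0
    · exact (hB z.2 z.1 (by rwa [hb]) (fun h2 ↦ hηz (h1.trans h2.symm))).symm
    · exact hB z.1 z.2 hbz h1
  have hYle : b z.1 z.2 * (h z.1 + h z.2) * (η z.1 - η z.2) ^ 2 ≤ Y := by
    rw [hY, Set.indicator_of_mem hmem.1, Set.indicator_of_mem hmem.2]
    nlinarith [mul_le_mul_of_nonneg_left (hηk z.1 z.2) (add_nonneg (hh z.1) (hh z.2))]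
  have hW : (η z.1 + η z.2) ^ 2 ≤ 2 * (η z.1 ^ 2 + η z.2 ^ 2) := by
    nlinarith [sq_nonneg (η z.1 - η z.2)]
  have hE0 : 0 ≤ E := he0 z
  set W := η z.1 ^ 2 + η z.2 ^ 2
  have hW0 : 0 ≤ W := add_nonneg (hη2 _) (hη2 _)
  have hT2 : T ^ 2 ≤ 2 * C * (E * W) * Y := by
    have hYY : 0 ≤ b z.1 z.2 * (h z.1 + h z.2) * (η z.1 - η z.2) ^ 2 :=
      mul_nonneg (mul_nonneg (hb0 _ _) (add_nonneg (hh _) (hh _))) (sq_nonneg _)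
    calc T ^ 2 = b z.1 z.2 ^ 2 * (η z.1 - η z.2) ^ 2 * (η z.1 + η z.2) ^ 2 *
          ((f z.1 - f z.2) * (g z.1 + g z.2)) ^ 2 := by rw [hT]; ring
      _ ≤ b z.1 z.2 ^ 2 * (η z.1 - η z.2) ^ 2 * (η z.1 + η z.2) ^ 2 *
          (C * ((f z.1 - f z.2) * (g z.1 - g z.2)) * (h z.1 + h z.2)) := by
        gcongr; exact hfg _ _
      _ = C * E * (b z.1 z.2 * (h z.1 + h z.2) * (η z.1 - η z.2) ^ 2) *
          (η z.1 + η z.2) ^ 2 := by rw [hE]; ring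
      _ ≤ C * E * (b z.1 z.2 * (h z.1 + h z.2) * (η z.1 - η z.2) ^ 2) * (2 * W) := by
        gcongr
      _ ≤ C * E * Y * (2 * W) := by gcongr
      _ = _ := by ring
  have hfin : -T ≤ ε * (E * W) + C / (2 * ε) * Y := by
    have hEW : 0 ≤ E * W := mul_nonneg hE0 hW0
    refine (neg_le_abs T).trans (abs_le_of_sq_le_sq ?_ (by positivity))
    have h1 : (ε * (E * W)) * (C / (2 * ε) * Y) = C * (E * W) * Y / 2 := by field_simp
    nlinarith [sq_nonneg (ε * (E * W) - C / (2 * ε) * Y)]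
  have := hle0z hηz
  nlinarith

lemma eq_zero_of_sq_le_mul_sub {Q : ℕ → ℝ} {K : ℝ} {n₀ : ℕ} (hK : 0 < K) (hQ : ∀ n, 0 ≤ Q n)
    (h : ∀ n ≥ n₀, Q (n + 1) ^ 2 ≤ K * (n + 1) * (Q (n + 1) - Q n)) :
    ∀ n ≥ n₀, Q n = 0 := by
  have hmono : ∀ n ≥ n₀, Q n ≤ Q (n + 1) := by
    intro n hn
    have := h n hn
    by_contra hcon
    have : K * (n + 1) * (Q (n + 1) - Q n) < 0 :=
      mul_neg_of_pos_of_neg (by positivity) (by linarith)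
    nlinarith [sq_nonneg (Q (n + 1))]
  intro n₁ hn₁
  by_contra hne
  have hpos : 0 < Q n₁ := lt_of_le_of_ne (hQ n₁) (Ne.symm hne)
  have hposn (i : ℕ) : 0 < Q (n₁ + i) := by
    induction i with
    | zero => simpa
    | succ i ih => exact ih.trans_le (hmono _ (by omega))
  have hstep (i : ℕ) :
      1 / (K * ((n₁ + i : ℕ) + 1)) ≤ (Q (n₁ + i))⁻¹ - (Q (n₁ + (i + 1)))⁻¹ := by
    have h1 := h (n₁ + i) (by omega)
    have h2 := hmono (n₁ + i) (by omega)
    have p1 := hposn i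
    have p2 := hposn (i + 1)
    rw [← add_assoc] at p2 ⊢
    rw [inv_sub_inv p1.ne' p2.ne', div_le_div_iff₀ (by positivity) (by positivity)]
    nlinarith
  have hbound (N : ℕ) :
      ∑ i ∈ Finset.range N, 1 / (K * ((n₁ + i : ℕ) + 1)) ≤ (Q n₁)⁻¹ := by
    calc _ ≤ ∑ i ∈ Finset.range N, ((Q (n₁ + i))⁻¹ - (Q (n₁ + (i + 1)))⁻¹) :=
          Finset.sum_le_sum fun i _ ↦ hstep i
      _ = (Q n₁)⁻¹ - (Q (n₁ + N))⁻¹ := Finset.sum_range_sub' (fun i ↦ (Q (n₁ + i))⁻¹) N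
      _ ≤ _ := by have := inv_pos.mpr (hposn N); linarith
  have hsum : Summable fun i : ℕ ↦ 1 / (K * ((n₁ + i : ℕ) + 1)) :=
    summable_of_sum_range_le (fun i ↦ by positivity) hbound
  have hsum2 := hsum.mul_left K
  refine Real.not_summable_one_div_natCast ((summable_nat_add_iff (n₁ + 1)).mp ?_)
  refine hsum2.congr fun i ↦ ?_
  push_cast
  field_simp
  ring

/-- The cutoff function equal to `1` for `t ≤ R / 2` and to `0` for `R - s ≤ t`. -/
noncomputable def cutoff (s R t : ℝ) : ℝ := max 0 (min 1 ((R - s - t) / (R / 2 - s)))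

lemma cutoff_nonneg (s R t : ℝ) : 0 ≤ cutoff s R t := le_max_left _ _

lemma cutoff_le_one (s R t : ℝ) : cutoff s R t ≤ 1 :=
  max_le zero_le_one (min_le_left _ _)

lemma cutoff_eq_one {s R t : ℝ} (hs : s < R / 2) (ht : t ≤ R / 2) : cutoff s R t = 1 := by
  have : 1 ≤ (R - s - t) / (R / 2 - s) := by rw [le_div_iff₀] <;> linarith
  simp [cutoff, this]

lemma lt_of_cutoff_ne_zero {s R t : ℝ} (hs : s < R / 2) (ht : cutoff s R t ≠ 0) :
    t < R - s := by
  by_contra! h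
  refine ht (max_eq_left ((min_le_right _ _).trans ?_))
  exact div_nonpos_of_nonpos_of_nonneg (by linarith) (by linarith)

lemma sq_cutoff_sub_le {s R : ℝ} (hs : 0 < s) (hR : 4 * s ≤ R) (t u : ℝ) :
    (cutoff s R t - cutoff s R u) ^ 2 ≤ (4 / R) ^ 2 * (t - u) ^ 2 := by
  have hR0 : 0 < R := by linarith
  have hd : 0 < R / 2 - s := by linarith
  have h1 : |cutoff s R t - cutoff s R u| ≤
      |(R - s - t) / (R / 2 - s) - (R - s - u) / (R / 2 - s)| := by
    unfold cutoff
    rw [max_comm 0, max_comm 0]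
    refine (abs_max_sub_max_le_abs _ _ _).trans ?_
    refine (abs_min_sub_min_le_max _ _ _ _).trans ?_
    simp
  rw [← mul_pow, sq_le_sq]
  refine h1.trans ?_
  rw [← sub_div, abs_div, abs_mul, abs_of_pos hd, abs_of_pos (div_pos four_pos hR0),
    show R - s - t - (R - s - u) = -(t - u) by ring, abs_neg, div_eq_mul_inv, mul_comm]
  gcongr
  rw [inv_eq_one_div, div_le_div_iff₀ hd hR0]
  linarith

theorem harmonic_with_r_sq_log_r_growth_is_constant
    {X : Type*} [Countable X] [Infinite X]
    (m : X → ℝ) (hm : ∀ x, 0 < m x)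
    (b : X → X → ℝ) (hb_symm : ∀ x y, b x y = b y x)
    (hb_nonneg : ∀ x y, 0 ≤ b x y) (hb_diag : ∀ x, b x x = 0)
    (hb_sum : ∀ x, Summable fun y => b x y)
    (hconn : ∀ x y : X, Relation.ReflTransGen (fun u v : X => 0 < b u v) x y)
    (ρ : X → X → ℝ)
    (hnonneg : ∀ x y, 0 ≤ ρ x y) (hrefl : ∀ x, ρ x x = 0)
    (hsymm : ∀ x y, ρ x y = ρ y x)
    (htriangle : ∀ x y z, ρ x z ≤ ρ x y + ρ y z)
    -- ρ is intrinsic: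
    (hintr : ∀ x, ∑' y, ENNReal.ofReal (b x y * (ρ x y) ^ 2) ≤ ENNReal.ofReal (m x))
    -- (D): the degree is bounded on balls:
    (hD : ∀ (x : X) (r : ℝ), ∃ K : ℝ, ∀ y, ρ x y ≤ r → Deg m b y ≤ K)
    -- (J): finite jump size:
    (hJ : ∃ s : ℝ, ∀ x y, 0 < b x y → ρ x y ≤ s)
    (p : ℝ) (hp : 1 < p) (x : X)
    (f : X → ℝ)
    (hfF : ∀ z, Summable fun y => b z y * (f y) ^ 2)
    (hharm : ∀ z, lap m b f z = 0)
    -- limsup_{r→∞} (1/(r² log r)) ∑_{y ∈ B_r(x)} |f y|^p m(y) < ∞ :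
    (hgrowth : ∃ C : ℝ, ∀ᶠ r : ℝ in Filter.atTop,
      (∑' y : ({z | ρ x z ≤ r} : Set X), ENNReal.ofReal (|f y| ^ p * m y))
        ≤ ENNReal.ofReal (C * (r ^ 2 * Real.log r))) :
    ∃ a : ℝ, ∀ z, f z = a := by
  obtain ⟨s₀, hs₀⟩ := hJ
  obtain ⟨C₀, hC₀⟩ := hgrowth
  obtain ⟨r₀, hr₀⟩ := Filter.eventually_atTop.mp hC₀
  set s := max s₀ 1
  have hs : 0 < s := lt_max_of_lt_right one_pos
  have hjump (y z : X) (h : b y z ≠ 0) : ρ y z ≤ s :=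
    (hs₀ y z (lt_of_le_of_ne (hb_nonneg y z) (Ne.symm h))).trans (le_max_left _ _)
  obtain ⟨n₀, hn₀⟩ := pow_unbounded_of_one_lt (max r₀ (8 * s)) (one_lt_two (α := ℝ))
  have hpow (n : ℕ) (hn : n₀ ≤ n) : r₀ ≤ 2 ^ n ∧ 8 * s ≤ (2 : ℝ) ^ n ∧ 1 ≤ (2 : ℝ) ^ n := by
    have h1 : (2 : ℝ) ^ n₀ ≤ 2 ^ n := pow_le_pow_right₀ one_le_two hn
    exact ⟨(le_max_left _ _).trans (hn₀.le.trans h1),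
      (le_max_right _ _).trans (hn₀.le.trans h1), one_le_pow₀ one_le_two⟩
  have hp1 : 0 < p - 1 := by linarith
  set c := min 1 (p - 1)
  have hc : 0 < c := lt_min one_pos hp1
  set g : X → ℝ := fun y ↦ signPow (p - 1) (f y)
  set h : X → ℝ := fun y ↦ |f y| ^ p
  have hh (y : X) : 0 ≤ h y := by positivity
  have hharm' (y : X) : ∑' z, b y z * (f y - f z) = 0 :=
    (mul_eq_zero.mp (hharm y)).resolve_left (one_div_pos.mpr (hm y)).ne'
  have hpt (y z : X) := signPow_pointwise hp (f y) (f z)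
  have hfg (y z : X) : ((f y - f z) * (g y + g z)) ^ 2 ≤
      8 / c * ((f y - f z) * (g y - g z)) * (h y + h z) := by
    have := (hpt y z).1
    rw [← mul_le_mul_iff_right₀ hc]
    refine this.trans_eq ?_
    field_simp
    rfl
  set B : ℕ → Set X := fun n ↦ {z | ρ x z ≤ 2 ^ n}
  have hI (n : ℕ) (y : X) : 0 ≤ (B n).indicator h y := Set.indicator_nonneg (fun y _ ↦ hh y) y
  have hgrow (n : ℕ) (hn : n₀ ≤ n) : (Summable fun y ↦ (B n).indicator h y * m y) ∧
      ∑' y, (B n).indicator h y * m y ≤ |C₀| * ((2 ^ n) ^ 2 * (n * Real.log 2)) := by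
    obtain ⟨h1, -, h3⟩ := hpow n hn
    refine summable_and_tsum_le_of_tsum_ofReal_le
      (fun y ↦ mul_nonneg (hI n y) (hm y).le) (by positivity) ?_
    have h4 := hr₀ _ h1
    rw [Real.log_pow] at h4
    calc _ = ∑' y : (B n), ENNReal.ofReal (|f y| ^ p * m y) := by
          rw [tsum_subtype (B n) fun y ↦ ENNReal.ofReal (|f y| ^ p * m y)]
          refine tsum_congr fun y ↦ ?_
          by_cases hy : y ∈ B n <;> simp [hy, h]
      _ ≤ _ := h4
      _ ≤ _ := by
        gcongr
        exact le_abs_self _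
  have hsb (n : ℕ) (hn : n₀ ≤ n) :
      Summable fun z : X × X ↦ (B n).indicator h z.1 * b z.1 z.2 := by
    refine (summable_mul_kernel_and_tsum_le hb_nonneg (hI n) hb_sum (fun y ↦ le_rfl) ?_).1
    obtain ⟨K, hK⟩ := hD x (2 ^ n)
    refine Summable.of_nonneg_of_le
      (fun y ↦ mul_nonneg (hI n y) (tsum_nonneg fun z ↦ hb_nonneg y z)) (fun y ↦ ?_)
      ((hgrow n hn).1.mul_left K)
    by_cases hy : y ∈ B n
    · have h1 := hK y hy
      rw [Deg, one_div, inv_mul_le_iff₀ (hm y)] at h1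
      nlinarith [mul_le_mul_of_nonneg_left h1 (hI n y)]
    · simp [hy]
  have hintr' (y : X) := summable_and_tsum_le_of_tsum_ofReal_le
    (fun z ↦ mul_nonneg (hb_nonneg y z) (sq_nonneg (ρ y z))) (hm y).le (hintr y)
  set k : ℕ → X → X → ℝ := fun n y z ↦ (4 / 2 ^ n) ^ 2 * (b y z * ρ y z ^ 2)
  have hsk (n : ℕ) (hn : n₀ ≤ n) :
      (Summable fun z : X × X ↦ (B n).indicator h z.1 * k n z.1 z.2) ∧
      ∑' z : X × X, (B n).indicator h z.1 * k n z.1 z.2 ≤ 16 * |C₀| * Real.log 2 * n := by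
    obtain ⟨h1, h2⟩ := summable_mul_kernel_and_tsum_le
      (fun y z ↦ mul_nonneg (hb_nonneg y z) (sq_nonneg (ρ y z))) (hI n)
      (fun y ↦ (hintr' y).1) (fun y ↦ (hintr' y).2) (hgrow n hn).1
    have h3 (z : X × X) : (B n).indicator h z.1 * k n z.1 z.2 =
        (4 / 2 ^ n) ^ 2 * ((B n).indicator h z.1 * (b z.1 z.2 * ρ z.1 z.2 ^ 2)) := by
      simp only [k]; ring
    refine ⟨(h1.mul_left ((4 / 2 ^ n) ^ 2)).congr fun z ↦ (h3 z).symm, ?_⟩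
    rw [tsum_congr h3, tsum_mul_left]
    calc _ ≤ (4 / 2 ^ n : ℝ) ^ 2 * (|C₀| * ((2 ^ n) ^ 2 * (n * Real.log 2))) := by
          gcongr; exact h2.trans (hgrow n hn).2
      _ = _ := by field_simp; ring
  have hdist (y z : X) (hyz : b y z ≠ 0) : ρ x z ≤ ρ x y + s :=
    (htriangle x y z).trans (by linarith [hjump y z hyz])
  set η : ℕ → X → ℝ := fun n y ↦ cutoff s (2 ^ n) (ρ x y)
  have hcac (n : ℕ) (hn : n₀ ≤ n) := by
    have hR := (hpow n hn).2.1
    refine caccioppoli hb_symm hb_nonneg (div_nonneg (by norm_num) hc.le) hharm' hh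
      (fun y z ↦ (hpt y z).2.1) hfg (fun y z ↦ abs_mul_signPow_le hp (f y) (f z))
      (η := η n) (fun y ↦ cutoff_nonneg _ _ _) (fun y ↦ cutoff_le_one _ _ _) (B := B n)
      (fun y z hyz hy ↦ ?_) (hsb n hn) (k := k n) (fun y z ↦ ?_) (fun y z ↦ ?_) (hsk n hn).1
    · have h1 := lt_of_cutoff_ne_zero (by linarith) hy
      have h2 := hdist y z hyz
      simp only [B, Set.mem_ofPred_eq]
      constructor <;> linarith
    · simp only [k]
      rw [hb_symm y z, hsymm y z]
    · have h1 := sq_cutoff_sub_le hs (R := 2 ^ n) (by linarith) (ρ x y) (ρ x z)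
      have h2 : (ρ x y - ρ x z) ^ 2 ≤ ρ y z ^ 2 := by
        rw [sq_le_sq, abs_of_nonneg (hnonneg y z), abs_le]
        have := htriangle x y z
        have := htriangle x z y
        rw [hsymm z y] at this
        constructor <;> linarith
      calc b y z * (η n y - η n z) ^ 2
          ≤ b y z * ((4 / 2 ^ n) ^ 2 * ρ y z ^ 2) :=
            mul_le_mul_of_nonneg_left
              (h1.trans (mul_le_mul_of_nonneg_left h2 (sq_nonneg _))) (hb_nonneg y z)
        _ = k n y z := by simp only [k]; ring
  set E : X × X → ℝ := fun z ↦ b z.1 z.2 * ((f z.1 - f z.2) * (g z.1 - g z.2)) with hE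
  have hE0 (z : X × X) : 0 ≤ E z := mul_nonneg (hb_nonneg _ _) (hpt _ _).2.1
  have hEη0 (n : ℕ) (z : X × X) : 0 ≤ E z * (η n z.1 ^ 2 + η n z.2 ^ 2) :=
    mul_nonneg (hE0 z) (by positivity)
  set Q : ℕ → ℝ := fun n ↦ ∑' z, E z * (η n z.1 ^ 2 + η n z.2 ^ 2) with hQ
  have hsE (n : ℕ) (hn : n₀ ≤ n) : Summable fun z ↦ E z * (η n z.1 ^ 2 + η n z.2 ^ 2) :=
    (hcac n hn).1
  have hone (n : ℕ) (hn : n₀ ≤ n) (y : X) (hy : η n y ≠ 0) : η (n + 1) y = 1 := by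
    have hR := (hpow n hn).2.1
    have h1 := lt_of_cutoff_ne_zero (by linarith) hy
    exact cutoff_eq_one (by rw [pow_succ]; linarith) (by rw [pow_succ]; linarith)
  have hηmono (n : ℕ) (hn : n₀ ≤ n) (y : X) : η n y ≤ η (n + 1) y := by
    by_cases hy : η n y = 0
    · rw [hy]; exact cutoff_nonneg _ _ _
    · rw [hone n hn y hy]; exact cutoff_le_one _ _ _
  have hone' (n : ℕ) (hn : n₀ ≤ n) (y z : X) (hyz : b y z ≠ 0) (hy : η n y ≠ 0) :
      η (n + 1) y = η (n + 1) z := by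
    have hR := (hpow n hn).2.1
    have h1 := lt_of_cutoff_ne_zero (by linarith) hy
    have h2 := hdist y z hyz
    rw [hone n hn y hy]
    exact (cutoff_eq_one (by rw [pow_succ]; linarith) (by rw [pow_succ]; linarith)).symm
  have hQle (n : ℕ) (hn : n₀ ≤ n) (ε : ℝ) (hε : 0 < ε) :
      Q n ≤ Q (n + 1) ∧ Q (n + 1) ≤ ε * (Q (n + 1) - Q n) +
        8 / c / ε * (16 * (|C₀| + 1) * Real.log 2 * (n + 1)) := by
    have hle (z : X × X) : E z * (η n z.1 ^ 2 + η n z.2 ^ 2) ≤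
        E z * (η (n + 1) z.1 ^ 2 + η (n + 1) z.2 ^ 2) := by
      have h1 := cutoff_nonneg s (2 ^ n) (ρ x z.1)
      have h2 := cutoff_nonneg s (2 ^ n) (ρ x z.2)
      have h3 := hηmono n hn z.1
      have h4 := hηmono n hn z.2
      refine mul_le_mul_of_nonneg_left ?_ (hE0 z)
      gcongr
    refine ⟨Summable.tsum_le_tsum hle (hsE n hn) (hsE (n + 1) (by omega)), ?_⟩
    refine ((hcac (n + 1) (by omega)).2 ε hε _ (hsE n hn) hle fun z hz ↦ ?_).trans ?_
    · by_cases hb0 : b z.1 z.2 = 0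
      · simp [hE, hb0]
      have h1 : η n z.1 = 0 := by
        by_contra hcon
        exact hz (hone' n hn _ _ hb0 hcon)
      have h2 : η n z.2 = 0 := by
        by_contra hcon
        exact hz (hone' n hn _ _ (by rwa [hb_symm]) hcon).symm
      simp [h1, h2]
    · have h1 := (hsk (n + 1) (by omega)).2
      have h2 : 0 ≤ Real.log 2 := Real.log_nonneg one_le_two
      push_cast at h1
      gcongr
      refine h1.trans ?_
      gcongr
      linarith
  set V : ℝ := 8 / c * (16 * (|C₀| + 1) * Real.log 2)
  have hV : 0 < V := by
    have := Real.log_pos one_lt_two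
    positivity
  have hQ0 (n : ℕ) : 0 ≤ Q n := tsum_nonneg (hEη0 n)
  have hQzero := eq_zero_of_sq_le_mul_sub (Q := Q) (K := 4 * V) (n₀ := n₀) (by positivity)
    hQ0 (fun n hn ↦ by
      rcases (hQ0 (n + 1)).eq_or_lt with h0 | hpos
      · have := (hQle n hn 1 one_pos).1
        have : Q n = 0 := le_antisymm (by linarith) (hQ0 n)
        simp [← h0, this]
      · have h1 := (hQle n hn (2 * V * (n + 1) / Q (n + 1)) (by positivity)).2
        have h2 : 8 / c / (2 * V * (n + 1) / Q (n + 1)) *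
            (16 * (|C₀| + 1) * Real.log 2 * (n + 1)) = Q (n + 1) / 2 := by
          calc _ = V * (n + 1) / (2 * V * (n + 1) / Q (n + 1)) := by
                simp only [V]; ring
            _ = _ := by field_simp
        rw [h2] at h1
        have h3 := mul_le_mul_of_nonneg_right h1 hpos.le
        have h4 : (2 * V * (n + 1) / Q (n + 1) * (Q (n + 1) - Q n) + Q (n + 1) / 2) *
            Q (n + 1) = 2 * V * (n + 1) * (Q (n + 1) - Q n) + Q (n + 1) ^ 2 / 2 := by
          field_simp
        nlinarith)
  have hedge (y z : X) (hyz : 0 < b y z) : f y = f z := by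
    obtain ⟨n₁, hn₁⟩ := pow_unbounded_of_one_lt (2 * ρ x y) (one_lt_two (α := ℝ))
    set n := max n₀ n₁
    have hn : n₀ ≤ n := le_max_left _ _
    have hR := (hpow n hn).2.1
    have h1 : (2 : ℝ) ^ n₁ ≤ 2 ^ n := pow_le_pow_right₀ one_le_two (le_max_right _ _)
    have h2 : η n y = 1 := cutoff_eq_one (by linarith) (by linarith)
    have h3 : E (y, z) * (η n y ^ 2 + η n z ^ 2) ≤ 0 :=
      ((hsE n hn).le_tsum (y, z) fun w _ ↦ hEη0 n w).trans_eq (hQzero n hn)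
    rw [h2] at h3
    have h4 : E (y, z) = 0 := by
      nlinarith [hE0 (y, z), mul_nonneg (hE0 (y, z)) (sq_nonneg (η n z))]
    exact (hpt y z).2.2 ((mul_eq_zero.mp h4).resolve_left hyz.ne')
  refine ⟨f x, fun z ↦ ?_⟩
  induction hconn x z with
  | refl => rfl
  | tail _ hyz ih => rw [← ih, hedge _ _ hyz]

end Stmt13
end

section
/- Let b be a connected graph over (X,m) and ρ an intrinsic metric satisfying conditions (D) and (J). If ∫_{1}^{∞} r / m(B_r(x)) dr = ∞ for some x ∈ X, then every bounded subharmonic function on X is constant (this is the formulation of recurrence via absence of non-constant bounded subharmonic functions). -/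
/-!
STATEMENT 14: Recurrence criterion. Under conditions (D) and (J), if
`∫_1^∞ r / m(B_r(x)) dr = ∞` for some `x`, then every bounded subharmonic function is
constant. The volume `m(B_r(x))` and the quotient are computed in `[0,∞]`.
-/

open scoped ENNReal

namespace Stmt14

/-- The formal Laplacian (with `c ≡ 0`). -/
noncomputable def lap {X : Type*} (m : X → ℝ) (b : X → X → ℝ)
    (f : X → ℝ) (x : X) : ℝ :=
  (1 / m x) * (∑' y, b x y * (f x - f y))

/-- The weighted vertex degree `Deg(x) = (1/m x) ∑_y b x y`. -/
noncomputable def Deg {X : Type*} (m : X → ℝ) (b : X → X → ℝ) (x : X) : ℝ :=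
  (1 / m x) * ∑' y, b x y

theorem energy_le_of_lipschitz {X : Type*} {m : X → ℝ} {b ρ : X → X → ℝ}
    (hb_symm : ∀ u v, b u v = b v u) (hb_nonneg : ∀ u v, 0 ≤ b u v)
    (hsymm : ∀ u v, ρ u v = ρ v u)
    (hintr : ∀ u, ∑' v, ENNReal.ofReal (b u v * (ρ u v) ^ 2) ≤ ENNReal.ofReal (m u))
    (A : Set X) (ψ : X → ℝ) (L : ℝ) (hLip : ∀ u v, |ψ u - ψ v| ≤ L * ρ u v)
    (hA : ∀ u, u ∉ A → ψ u = 0) :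
    ∑' u, ∑' v, ENNReal.ofReal (b u v * (ψ u - ψ v) ^ 2) ≤
      ENNReal.ofReal (2 * L ^ 2) * ∑' u : A, ENNReal.ofReal (m u) := by
  classical
  let F : X → X → ℝ≥0∞ := fun u v =>
    A.indicator (fun u => ENNReal.ofReal (b u v * (ρ u v) ^ 2)) u
  have hterm : ∀ u v, ENNReal.ofReal (b u v * (ψ u - ψ v) ^ 2) ≤
      ENNReal.ofReal (L ^ 2) * (F u v + F v u) := by
    intro u v
    by_cases h : u ∈ A ∨ v ∈ A
    · have h1 : ENNReal.ofReal (b u v * (ψ u - ψ v) ^ 2) ≤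
          ENNReal.ofReal (L ^ 2) * ENNReal.ofReal (b u v * (ρ u v) ^ 2) := by
        rw [← ENNReal.ofReal_mul (sq_nonneg L)]
        apply ENNReal.ofReal_le_ofReal
        have h2 : (ψ u - ψ v) ^ 2 ≤ (L * ρ u v) ^ 2 := by
          rw [← sq_abs]
          exact pow_le_pow_left₀ (abs_nonneg _) (hLip u v) 2
        nlinarith [mul_le_mul_of_nonneg_left h2 (hb_nonneg u v)]
      refine h1.trans (mul_le_mul_right ?_ _)
      rcases h with h | h
      · simp [F, h]
      · have : F v u = ENNReal.ofReal (b u v * (ρ u v) ^ 2) := by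
          simp [F, h, hb_symm v u, hsymm v u]
        rw [this]
        exact le_add_self
    · push Not at h
      simp [hA u h.1, hA v h.2]
  have hF : ∑' u, ∑' v, F u v ≤ ∑' u : A, ENNReal.ofReal (m u) := by
    rw [tsum_subtype A (fun u => ENNReal.ofReal (m u))]
    refine ENNReal.tsum_le_tsum fun u => ?_
    by_cases h : u ∈ A
    · simpa [F, h] using hintr u
    · simp [F, h]
  calc ∑' u, ∑' v, ENNReal.ofReal (b u v * (ψ u - ψ v) ^ 2)
      ≤ ∑' u, ∑' v, ENNReal.ofReal (L ^ 2) * (F u v + F v u) :=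
        ENNReal.tsum_le_tsum fun u => ENNReal.tsum_le_tsum fun v => hterm u v
    _ = ENNReal.ofReal (L ^ 2) * (∑' u, ∑' v, F u v + ∑' u, ∑' v, F v u) := by
        simp only [ENNReal.tsum_mul_left, ENNReal.tsum_add]
    _ = ENNReal.ofReal (2 * L ^ 2) * ∑' u, ∑' v, F u v := by
        rw [ENNReal.tsum_comm (f := fun u v => F v u), ← two_mul,
          ENNReal.ofReal_mul (by norm_num : (0 : ℝ) ≤ 2), ENNReal.ofReal_ofNat]
        ring
    _ ≤ _ := mul_le_mul_right hF _

/-- A Caccioppoli inequality for non-negative bounded subharmonic functions. -/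
theorem caccioppoli {X : Type*} {b : X → X → ℝ}
    (hb_symm : ∀ u v, b u v = b v u) (hb_nonneg : ∀ u v, 0 ≤ b u v)
    {f φ : X → ℝ} {M : ℝ} (hf0 : ∀ u, 0 ≤ f u) (hfM : ∀ u, f u ≤ M)
    (hsub : ∀ u, ∑' v, b u v * (f u - f v) ≤ 0)
    (hφ0 : ∀ u, 0 ≤ φ u) (hφ1 : ∀ u, φ u ≤ 1)
    (hsum : Summable fun p : X × X => b p.1 p.2 * φ p.1) (u v : X) :
    ENNReal.ofReal (b u v * (f u * φ u - f v * φ v) ^ 2) ≤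
      ENNReal.ofReal (M ^ 2) * ∑' u, ∑' v, ENNReal.ofReal (b u v * (φ u - φ v) ^ 2) := by
  have hM : 0 ≤ M := (hf0 u).trans (hfM u)
  have hsum' : Summable fun p : X × X => b p.1 p.2 * φ p.2 := by
    have := (Equiv.prodComm X X).summable_iff.mpr hsum
    refine this.congr fun p => ?_
    simp [hb_symm p.2 p.1]
  have hdom : Summable fun p : X × X => b p.1 p.2 * φ p.1 + b p.1 p.2 * φ p.2 := hsum.add hsum'
  have hE : Summable fun p : X × X => b p.1 p.2 * (φ p.1 - φ p.2) ^ 2 := by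
    refine Summable.of_nonneg_of_le (fun p => mul_nonneg (hb_nonneg _ _) (sq_nonneg _))
      (fun p => ?_) hdom
    rw [← mul_add]
    refine mul_le_mul_of_nonneg_left ?_ (hb_nonneg _ _)
    nlinarith [hφ0 p.1, hφ0 p.2, hφ1 p.1, hφ1 p.2, mul_nonneg (hφ0 p.1) (hφ0 p.2)]
  let g : X × X → ℝ := fun p => (f p.1 * φ p.1 ^ 2) * (b p.1 p.2 * (f p.1 - f p.2))
  have hg : Summable g := by
    refine Summable.of_norm_bounded (g := fun p => M ^ 2 * (b p.1 p.2 * φ p.1)) (hsum.mul_left _)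
      fun p => ?_
    have h1 : |f p.1 - f p.2| ≤ M := by
      rw [abs_le]
      constructor <;> linarith [hf0 p.1, hf0 p.2, hfM p.1, hfM p.2]
    have h2 : φ p.1 ^ 2 ≤ φ p.1 := by nlinarith [hφ0 p.1, hφ1 p.1]
    rw [Real.norm_eq_abs, abs_mul, abs_mul (b p.1 p.2), abs_of_nonneg (hb_nonneg _ _),
      abs_of_nonneg (mul_nonneg (hf0 p.1) (sq_nonneg _))]
    calc f p.1 * φ p.1 ^ 2 * (b p.1 p.2 * |f p.1 - f p.2|)
        ≤ (M * φ p.1) * (b p.1 p.2 * M) := by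
          refine mul_le_mul (mul_le_mul (hfM _) h2 (sq_nonneg _) hM)
            (mul_le_mul_of_nonneg_left h1 (hb_nonneg _ _))
            (mul_nonneg (hb_nonneg _ _) (abs_nonneg _)) (mul_nonneg hM (hφ0 _))
      _ = M ^ 2 * (b p.1 p.2 * φ p.1) := by ring
  have hg0 : ∑' p, g p ≤ 0 := by
    rw [hg.tsum_prod]
    refine tsum_nonpos fun u => ?_
    simp only [g]
    rw [tsum_mul_left]
    exact mul_nonpos_of_nonneg_of_nonpos (mul_nonneg (hf0 u) (sq_nonneg _)) (hsub u)
  have hgs : Summable fun p : X × X => g p.swap := (Equiv.prodComm X X).summable_iff.mpr hg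
  have hgs0 : ∑' p : X × X, g p.swap = ∑' p, g p := (Equiv.prodComm X X).tsum_eq g
  have hH : Summable fun p : X × X =>
      M ^ 2 * (b p.1 p.2 * (φ p.1 - φ p.2) ^ 2) + (g p + g p.swap) :=
    (hE.mul_left _).add (hg.add hgs)
  have hle : ∀ p : X × X, b p.1 p.2 * (f p.1 * φ p.1 - f p.2 * φ p.2) ^ 2 ≤
      M ^ 2 * (b p.1 p.2 * (φ p.1 - φ p.2) ^ 2) + (g p + g p.swap) := by
    intro p
    have hid : g p + g p.swap = b p.1 p.2 * (f p.1 * φ p.1 - f p.2 * φ p.2) ^ 2 -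
        f p.1 * f p.2 * (b p.1 p.2 * (φ p.1 - φ p.2) ^ 2) := by
      simp only [g, Prod.fst_swap, Prod.snd_swap, hb_symm p.2 p.1]
      ring
    have h1 : f p.1 * f p.2 ≤ M ^ 2 := by
      rw [sq]
      exact mul_le_mul (hfM _) (hfM _) (hf0 _) hM
    have h2 := mul_le_mul_of_nonneg_right h1
      (mul_nonneg (hb_nonneg p.1 p.2) (sq_nonneg (φ p.1 - φ p.2)))
    linarith
  have hnn : ∀ p : X × X, 0 ≤ b p.1 p.2 * (f p.1 * φ p.1 - f p.2 * φ p.2) ^ 2 :=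
    fun p => mul_nonneg (hb_nonneg _ _) (sq_nonneg _)
  have hreal : b u v * (f u * φ u - f v * φ v) ^ 2 ≤
      M ^ 2 * ∑' p : X × X, b p.1 p.2 * (φ p.1 - φ p.2) ^ 2 := by
    have h1 := (hle (u, v)).trans
      (hH.le_tsum (u, v) fun p _ => (hnn p).trans (hle p))
    rw [(hE.mul_left _).tsum_add (hg.add hgs), hg.tsum_add hgs, hgs0, tsum_mul_left] at h1
    simp only at h1
    linarith
  rw [← ENNReal.tsum_prod (f := fun u v => ENNReal.ofReal (b u v * (φ u - φ v) ^ 2)),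
    ← ENNReal.ofReal_tsum_of_nonneg (fun p => mul_nonneg (hb_nonneg _ _) (sq_nonneg _)) hE,
    ← ENNReal.ofReal_mul (sq_nonneg M)]
  exact ENNReal.ofReal_le_ofReal hreal

theorem sum_sq_of_pairwise_mul_eq_zero {ι : Type*} (s : Finset ι) (g : ι → ℝ)
    (h : ∀ i ∈ s, ∀ j ∈ s, i ≠ j → g i * g j = 0) :
    (∑ i ∈ s, g i) ^ 2 = ∑ i ∈ s, g i ^ 2 := by
  rw [sq, Finset.sum_mul_sum]
  refine Finset.sum_congr rfl fun i hi => ?_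
  rw [Finset.sum_eq_single i (fun j hj hji => h i hi j hj hji.symm) (fun h => absurd hi h), sq]

/-- The cutoff on `ℝ` equal to `1` below `2 * R` and to `0` above `4 * R`. -/
noncomputable def cutoff (R t : ℝ) : ℝ := max 0 (min 1 ((4 * R - t) / (2 * R)))

theorem cutoff_nonneg (R t : ℝ) : 0 ≤ cutoff R t := le_max_left _ _

theorem cutoff_le_one (R t : ℝ) : cutoff R t ≤ 1 := max_le zero_le_one (min_le_left _ _)

theorem cutoff_eq_one {R t : ℝ} (hR : 0 < R) (ht : t ≤ 2 * R) : cutoff R t = 1 := by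
  have : 1 ≤ (4 * R - t) / (2 * R) := by
    rw [le_div_iff₀ (by positivity)]
    linarith
  rw [cutoff, min_eq_left this, max_eq_right zero_le_one]

theorem cutoff_eq_zero {R t : ℝ} (hR : 0 < R) (ht : 4 * R ≤ t) : cutoff R t = 0 := by
  have : (4 * R - t) / (2 * R) ≤ 0 :=
    div_nonpos_of_nonpos_of_nonneg (by linarith) (by positivity)
  rw [cutoff, max_eq_left ((min_le_right _ _).trans this)]

theorem abs_cutoff_sub_le {R : ℝ} (hR : 0 < R) (t t' : ℝ) :
    |cutoff R t - cutoff R t'| ≤ 1 / (2 * R) * |t - t'| := by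
  have h1 : |cutoff R t - cutoff R t'| ≤
      |(4 * R - t) / (2 * R) - (4 * R - t') / (2 * R)| := by
    unfold cutoff
    refine (abs_max_sub_max_le_max _ _ _ _).trans (max_le (by simp) ?_)
    exact (abs_min_sub_min_le_max _ _ _ _).trans (max_le (by simp) le_rfl)
  refine h1.trans (le_of_eq ?_)
  rw [show (4 * R - t) / (2 * R) - (4 * R - t') / (2 * R) = -(1 / (2 * R) * (t - t')) by ring,
    abs_neg, abs_mul, abs_of_pos (by positivity)]

/-- Edges that are short compared to the scales see at most one of two cutoffs vary. -/
theorem cutoff_sub_mul_cutoff_sub_eq_zero {R R' t t' : ℝ} (hR : 0 < R) (hRR' : 4 * R ≤ R')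
    (h : |t - t'| ≤ R) :
    (cutoff R t - cutoff R t') * (cutoff R' t - cutoff R' t') = 0 := by
  rw [abs_le] at h
  by_cases h1 : 4 * R ≤ t ∧ 4 * R ≤ t'
  · rw [cutoff_eq_zero hR h1.1, cutoff_eq_zero hR h1.2]
    ring
  · have h2 : t ≤ 2 * R' ∧ t' ≤ 2 * R' := by
      by_cases h3 : 4 * R ≤ t
      · have : t' < 4 * R := lt_of_not_ge fun h4 => h1 ⟨h3, h4⟩
        constructor <;> linarith
      · push Not at h3
        constructor <;> linarith
    rw [cutoff_eq_one (by linarith) h2.1, cutoff_eq_one (by linarith) h2.2]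
    ring

theorem tsum_pow_div_eq_top {V : ℝ → ℝ≥0∞} (hV : Monotone V)
    (h : ∫⁻ r in Set.Ioi (1 : ℝ), ENNReal.ofReal r / V r = ⊤) :
    ∑' k : ℕ, ENNReal.ofReal (16 ^ k) / V (4 ^ k) = ⊤ := by
  have hcov : Set.Ioi (1 : ℝ) ⊆ ⋃ k : ℕ, Set.Ico ((4 : ℝ) ^ k) (4 ^ (k + 1)) := by
    intro r hr
    obtain ⟨k, hk⟩ := exists_nat_pow_near (le_of_lt hr) (by norm_num : (1 : ℝ) < 4)
    exact Set.mem_iUnion.mpr ⟨k, hk⟩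
  have hpiece : ∀ k : ℕ, ∫⁻ r in Set.Ico ((4 : ℝ) ^ k) (4 ^ (k + 1)), ENNReal.ofReal r / V r ≤
      ENNReal.ofReal 16 * (ENNReal.ofReal (16 ^ k) / V (4 ^ k)) := by
    intro k
    calc ∫⁻ r in Set.Ico ((4 : ℝ) ^ k) (4 ^ (k + 1)), ENNReal.ofReal r / V r
        ≤ ∫⁻ _ in Set.Ico ((4 : ℝ) ^ k) (4 ^ (k + 1)),
            ENNReal.ofReal (4 ^ (k + 1)) / V (4 ^ k) :=
          MeasureTheory.setLIntegral_mono' measurableSet_Ico fun r hr =>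
            ENNReal.div_le_div (ENNReal.ofReal_le_ofReal hr.2.le) (hV hr.1)
      _ ≤ ENNReal.ofReal (4 ^ (k + 1)) / V (4 ^ k) * ENNReal.ofReal (4 ^ (k + 1)) := by
          rw [MeasureTheory.setLIntegral_const, Real.volume_Ico]
          gcongr
          linarith [pow_pos (by norm_num : (0 : ℝ) < 4) k]
      _ = _ := by
          rw [← mul_div_assoc, ← ENNReal.ofReal_mul (by norm_num), mul_comm, ← mul_div_assoc,
            ← ENNReal.ofReal_mul (by positivity)]
          congr 2
          rw [show (16 : ℝ) = 4 * 4 by norm_num, mul_pow]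
          ring
  have h1 : (⊤ : ℝ≥0∞) ≤ ENNReal.ofReal 16 * ∑' k : ℕ, ENNReal.ofReal (16 ^ k) / V (4 ^ k) := by
    rw [← ENNReal.tsum_mul_left, ← h]
    exact ((MeasureTheory.lintegral_mono_set hcov).trans
      (MeasureTheory.lintegral_iUnion_le _ _)).trans (ENNReal.tsum_le_tsum hpiece)
  by_contra h2
  exact ENNReal.mul_ne_top ENNReal.ofReal_ne_top h2 (top_le_iff.mp h1)

theorem ne_top_and_not_summable {V : ℝ → ℝ≥0∞} (hV : Monotone V)
    (hV0 : ∀ r, 0 ≤ r → V r ≠ 0)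
    (h : ∫⁻ r in Set.Ioi (1 : ℝ), ENNReal.ofReal r / V r = ⊤) :
    (∀ r, V r ≠ ⊤) ∧ ¬ Summable fun k : ℕ => (16 : ℝ) ^ k / (V (4 ^ k)).toReal := by
  have htop := tsum_pow_div_eq_top hV h
  have hfin : ∀ k : ℕ, ENNReal.ofReal (16 ^ k) / V (4 ^ k) ≠ ⊤ := fun k =>
    ENNReal.div_ne_top ENNReal.ofReal_ne_top (hV0 _ (by positivity))
  constructor
  · intro r hr
    obtain ⟨K, hK⟩ := pow_unbounded_of_one_lt r (by norm_num : (1 : ℝ) < 4)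
    have hzero : ∀ k ∉ Finset.range K, ENNReal.ofReal (16 ^ k) / V (4 ^ k) = 0 := by
      intro k hk
      have h1 : (4 : ℝ) ^ K ≤ 4 ^ k :=
        pow_le_pow_right₀ (by norm_num) (not_lt.mp fun h => hk (Finset.mem_range.mpr h))
      rw [top_le_iff.mp (hr.symm.le.trans (hV (hK.le.trans h1))), ENNReal.div_top]
    rw [tsum_eq_sum hzero] at htop
    exact ENNReal.sum_ne_top.mpr (fun k _ => hfin k) htop
  · intro hs
    refine hs.tsum_ofReal_ne_top ?_
    rw [← htop]
    refine tsum_congr fun k => ?_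
    rw [← ENNReal.ofReal_toReal (hfin k), ENNReal.toReal_div,
      ENNReal.toReal_ofReal (by positivity)]

theorem recurrence_criterion
    {X : Type*} [Countable X] [Infinite X]
    (m : X → ℝ) (hm : ∀ x, 0 < m x)
    (b : X → X → ℝ) (hb_symm : ∀ x y, b x y = b y x)
    (hb_nonneg : ∀ x y, 0 ≤ b x y) (hb_diag : ∀ x, b x x = 0)
    (hb_sum : ∀ x, Summable fun y => b x y)
    (hconn : ∀ x y : X, Relation.ReflTransGen (fun u v : X => 0 < b u v) x y)
    (ρ : X → X → ℝ)
    (hnonneg : ∀ x y, 0 ≤ ρ x y) (hrefl : ∀ x, ρ x x = 0)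
    (hsymm : ∀ x y, ρ x y = ρ y x)
    (htriangle : ∀ x y z, ρ x z ≤ ρ x y + ρ y z)
    -- ρ is intrinsic:
    (hintr : ∀ x, ∑' y, ENNReal.ofReal (b x y * (ρ x y) ^ 2) ≤ ENNReal.ofReal (m x))
    -- (D): the degree is bounded on balls:
    (hD : ∀ (x : X) (r : ℝ), ∃ K : ℝ, ∀ y, ρ x y ≤ r → Deg m b y ≤ K)
    -- (J): finite jump size:
    (hJ : ∃ s : ℝ, ∀ x y, 0 < b x y → ρ x y ≤ s)
    (x : X)
    (hvol : ∫⁻ r in Set.Ioi (1 : ℝ),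
      ENNReal.ofReal r /
        (∑' y : ({z | ρ x z ≤ r} : Set X), ENNReal.ofReal (m y)) = ⊤) :
    ∀ f : X → ℝ, (∃ M : ℝ, ∀ z, |f z| ≤ M) →
      (∀ z, lap m b f z ≤ 0) → ∃ a : ℝ, ∀ z, f z = a := by
  classical
  rintro f ⟨M, hM⟩ hf
  obtain ⟨s, hs⟩ := hJ
  set V : ℝ → ℝ≥0∞ := fun r => ∑' y : ({z | ρ x z ≤ r} : Set X), ENNReal.ofReal (m y) with hVdef
  have hVmono : Monotone V := fun r r' hrr' =>
    ENNReal.tsum_mono_subtype (fun y => ENNReal.ofReal (m y)) fun z (hz : ρ x z ≤ r) => hz.trans hrr'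
  have hV0 : ∀ r, 0 ≤ r → V r ≠ 0 := by
    intro r hr h0
    have h1 := ENNReal.tsum_eq_zero.mp h0 ⟨x, by simpa [hrefl x] using hr⟩
    exact absurd (hm x) (not_lt.mpr (ENNReal.ofReal_eq_zero.mp h1))
  obtain ⟨hVtop, hnsum⟩ := ne_top_and_not_summable hVmono hV0 hvol
  set w : ℕ → ℝ := fun k => 16 ^ k / (V (4 ^ k)).toReal with hwdef
  have hw : ∀ k, 0 < w k := fun k =>
    div_pos (by positivity) (ENNReal.toReal_pos (hV0 _ (by positivity)) (hVtop _))
  have hρlip : ∀ u v, |ρ x u - ρ x v| ≤ ρ u v := by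
    intro u v
    rw [abs_le]
    constructor <;> linarith [htriangle x u v, htriangle x v u, hsymm u v]
  have hsub : ∀ u, ∑' v, b u v * (f u - f v) ≤ 0 := fun u =>
    nonpos_of_mul_nonpos_right (hf u) (one_div_pos.mpr (hm u))
  have hpos4 : ∀ k : ℕ, (0 : ℝ) < 4 ^ k := fun k => by positivity
  have henergy : ∀ k : ℕ, ∑' u, ∑' v, ENNReal.ofReal (b u v *
      (cutoff (4 ^ k) (ρ x u) - cutoff (4 ^ k) (ρ x v)) ^ 2) ≤
      ENNReal.ofReal (8 / w (k + 1)) := by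
    intro k
    refine (energy_le_of_lipschitz hb_symm hb_nonneg hsymm hintr {z | ρ x z ≤ 4 ^ (k + 1)}
      (fun u => cutoff (4 ^ k) (ρ x u)) (1 / (2 * 4 ^ k)) (fun u v => ?_) (fun u hu => ?_)).trans
      (le_of_eq ?_)
    · exact (abs_cutoff_sub_le (hpos4 k) _ _).trans
        (mul_le_mul_of_nonneg_left (hρlip u v) (by positivity))
    · refine cutoff_eq_zero (hpos4 k) ?_
      have : 4 ^ (k + 1) < ρ x u := not_le.mp hu
      rw [pow_succ] at this
      linarith
    · change _ * V (4 ^ (k + 1)) = _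
      rw [← ENNReal.ofReal_toReal (hVtop (4 ^ (k + 1))), ← ENNReal.ofReal_mul (by positivity)]
      congr 1
      simp only [hwdef]
      rw [show (16 : ℝ) = 4 * 4 by norm_num, mul_pow]
      field_simp
      ring
  have hedge : ∀ u v, 0 < b u v → f u = f v := by
    intro u v huv
    by_contra hne
    obtain ⟨N, hN⟩ := pow_unbounded_of_one_lt (max s (max (ρ x u) (ρ x v)))
      (by norm_num : (1 : ℝ) < 4)
    have hNs : s ≤ 4 ^ N := (le_max_left _ _).trans hN.le
    have hNu : ρ x u ≤ 4 ^ N := ((le_max_left _ _).trans (le_max_right _ _)).trans hN.le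
    have hNv : ρ x v ≤ 4 ^ N := ((le_max_right _ _).trans (le_max_right _ _)).trans hN.le
    have hδ : 0 < b u v * (f u - f v) ^ 2 := by
      have := sub_ne_zero.mpr hne
      positivity
    have hbound : ∀ n, ∑ i ∈ Finset.range n, w (i + (N + 1)) ≤
        8 * (2 * M) ^ 2 / (b u v * (f u - f v) ^ 2) := by
      intro n
      set W := ∑ i ∈ Finset.range n, w (i + (N + 1)) with hW
      rcases Nat.eq_zero_or_pos n with hn | hn
      · rw [hW, hn, Finset.sum_range_zero]
        positivity
      have hWpos : 0 < W := Finset.sum_pos (fun i _ => hw _) ⟨0, Finset.mem_range.mpr hn⟩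
      set φ : X → ℝ := fun z =>
        ∑ i ∈ Finset.range n, w (i + (N + 1)) / W * cutoff (4 ^ (i + N)) (ρ x z) with hφ
      have hsum1 : ∑ i ∈ Finset.range n, w (i + (N + 1)) / W = 1 := by
        rw [← Finset.sum_div, div_self hWpos.ne']
      have hc : ∀ i, 0 ≤ w (i + (N + 1)) / W := fun i => (div_pos (hw _) hWpos).le
      have hφ0 : ∀ z, 0 ≤ φ z := fun z =>
        Finset.sum_nonneg fun i _ => mul_nonneg (hc i) (cutoff_nonneg _ _)
      have hφ1 : ∀ z, φ z ≤ 1 := fun z => by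
        rw [← hsum1]
        exact Finset.sum_le_sum fun i _ => mul_le_of_le_one_right (hc i) (cutoff_le_one _ _)
      have hφone : ∀ z, ρ x z ≤ 4 ^ N → φ z = 1 := by
        intro z hz
        rw [← hsum1]
        refine Finset.sum_congr rfl fun i _ => ?_
        have : (4 : ℝ) ^ N ≤ 4 ^ (i + N) := pow_le_pow_right₀ (by norm_num) (by omega)
        rw [cutoff_eq_one (hpos4 _) (by linarith [hpos4 (i + N)]), mul_one]
      have hφsupp : ∀ z, 4 ^ (n + N) < ρ x z → φ z = 0 := by
        intro z hz
        refine Finset.sum_eq_zero fun i hi => ?_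
        have h1 : (4 : ℝ) ^ (i + N + 1) ≤ 4 ^ (n + N) :=
          pow_le_pow_right₀ (by norm_num) (by have := Finset.mem_range.mp hi; omega)
        rw [pow_succ] at h1
        rw [cutoff_eq_zero (hpos4 _) (by linarith), mul_zero]
      have hsumφ : Summable fun p : X × X => b p.1 p.2 * φ p.1 := by
        obtain ⟨K, hK⟩ := hD x (4 ^ (n + N))
        refine (ENNReal.summable_toReal (f := fun p : X × X =>
          ENNReal.ofReal (b p.1 p.2 * φ p.1)) (ne_top_of_le_ne_top
            (ENNReal.mul_ne_top (ENNReal.ofReal_ne_top (r := K)) (hVtop (4 ^ (n + N)))) ?_)).congr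
          fun p => ENNReal.toReal_ofReal (mul_nonneg (hb_nonneg _ _) (hφ0 _))
        rw [ENNReal.tsum_prod (f := fun u v => ENNReal.ofReal (b u v * φ u)), hVdef]
        simp only
        rw [tsum_subtype {z | ρ x z ≤ 4 ^ (n + N)} (fun y => ENNReal.ofReal (m y)),
          ← ENNReal.tsum_mul_left]
        refine ENNReal.tsum_le_tsum fun z => ?_
        by_cases hz : ρ x z ≤ 4 ^ (n + N)
        · rw [Set.indicator_of_mem (show z ∈ {z | ρ x z ≤ 4 ^ (n + N)} from hz),
            ← ENNReal.ofReal_mul' (hm z).le,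
            ← ENNReal.ofReal_tsum_of_nonneg (fun y => mul_nonneg (hb_nonneg _ _) (hφ0 _))
              ((hb_sum z).mul_right _), tsum_mul_right]
          apply ENNReal.ofReal_le_ofReal
          have h1 := hK z hz
          rw [Deg, one_div, inv_mul_le_iff₀ (hm z)] at h1
          have h2 : 0 ≤ ∑' y, b z y := tsum_nonneg (hb_nonneg z)
          nlinarith [mul_le_of_le_one_right h2 (hφ1 z)]
        · simp [hφsupp z (not_le.mp hz)]
      have hEφ : ∑' u, ∑' v, ENNReal.ofReal (b u v * (φ u - φ v) ^ 2) ≤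
          ENNReal.ofReal (8 / W) := by
        have hterm : ∀ u v, ENNReal.ofReal (b u v * (φ u - φ v) ^ 2) =
            ∑ i ∈ Finset.range n, ENNReal.ofReal ((w (i + (N + 1)) / W) ^ 2) *
              ENNReal.ofReal (b u v *
                (cutoff (4 ^ (i + N)) (ρ x u) - cutoff (4 ^ (i + N)) (ρ x v)) ^ 2) := by
          intro u v
          rcases (hb_nonneg u v).eq_or_lt with h0 | h0
          · simp [← h0]
          have hshort : ∀ i, |ρ x u - ρ x v| ≤ 4 ^ (i + N) := fun i =>
            ((hρlip u v).trans (hs u v h0)).trans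
              (hNs.trans (pow_le_pow_right₀ (by norm_num) (by omega)))
          have horth : ∀ i j, i < j →
              (cutoff (4 ^ (i + N)) (ρ x u) - cutoff (4 ^ (i + N)) (ρ x v)) *
              (cutoff (4 ^ (j + N)) (ρ x u) - cutoff (4 ^ (j + N)) (ρ x v)) = 0 := by
            intro i j hij
            refine cutoff_sub_mul_cutoff_sub_eq_zero (hpos4 _) ?_ (hshort i)
            rw [← pow_succ']
            exact pow_le_pow_right₀ (by norm_num) (by omega)
          have hsq : (φ u - φ v) ^ 2 = ∑ i ∈ Finset.range n, (w (i + (N + 1)) / W *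
              (cutoff (4 ^ (i + N)) (ρ x u) - cutoff (4 ^ (i + N)) (ρ x v))) ^ 2 := by
            rw [← sum_sq_of_pairwise_mul_eq_zero, hφ]
            · simp only [mul_sub, Finset.sum_sub_distrib]
            · intro i _ j _ hij
              rw [mul_mul_mul_comm]
              rcases lt_or_gt_of_ne hij with h | h
              · rw [horth i j h, mul_zero]
              · rw [mul_comm (cutoff _ _ - _), horth j i h, mul_zero]
          rw [hsq, Finset.mul_sum, ENNReal.ofReal_sum_of_nonneg
            (fun i _ => mul_nonneg h0.le (sq_nonneg _))]
          refine Finset.sum_congr rfl fun i _ => ?_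
          rw [← ENNReal.ofReal_mul (sq_nonneg _)]
          congr 1
          ring
        simp only [hterm]
        calc _ = ∑ i ∈ Finset.range n, ENNReal.ofReal ((w (i + (N + 1)) / W) ^ 2) *
              ∑' u, ∑' v, ENNReal.ofReal (b u v *
                (cutoff (4 ^ (i + N)) (ρ x u) - cutoff (4 ^ (i + N)) (ρ x v)) ^ 2) := by
              simp only [← ENNReal.tsum_mul_left]
              rw [← Summable.tsum_finsetSum (fun _ _ => ENNReal.summable)]
              refine tsum_congr fun u => ?_
              rw [← Summable.tsum_finsetSum (fun _ _ => ENNReal.summable)]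
          _ ≤ ∑ i ∈ Finset.range n, ENNReal.ofReal ((w (i + (N + 1)) / W) ^ 2) *
              ENNReal.ofReal (8 / w (i + (N + 1))) :=
            Finset.sum_le_sum fun i _ => mul_le_mul_right (henergy (i + N)) _
          _ = ∑ i ∈ Finset.range n, ENNReal.ofReal (8 / W * (w (i + (N + 1)) / W)) := by
            refine Finset.sum_congr rfl fun i _ => ?_
            rw [← ENNReal.ofReal_mul (sq_nonneg _)]
            congr 1
            have := (hw (i + (N + 1))).ne'
            field_simp
          _ = ENNReal.ofReal (8 / W) := by
            rw [← ENNReal.ofReal_sum_of_nonneg (fun i _ => mul_nonneg (by positivity) (hc i)),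
              ← Finset.mul_sum, hsum1, mul_one]
      have hcacc := caccioppoli (f := fun z => f z + M) (M := 2 * M) hb_symm hb_nonneg
        (fun z => by linarith [(abs_le.mp (hM z)).1]) (fun z => by linarith [(abs_le.mp (hM z)).2])
        (fun z => by simpa using hsub z) hφ0 hφ1 hsumφ u v
      have hfinal := hcacc.trans (mul_le_mul_right hEφ _)
      rw [← ENNReal.ofReal_mul (sq_nonneg _), ENNReal.ofReal_le_ofReal_iff (by positivity),
        hφone u hNu, hφone v hNv, mul_one, mul_one, add_sub_add_right_eq_sub] at hfinal
      rw [le_div_iff₀ hδ]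
      calc W * (b u v * (f u - f v) ^ 2) ≤ W * ((2 * M) ^ 2 * (8 / W)) :=
            mul_le_mul_of_nonneg_left hfinal hWpos.le
        _ = 8 * (2 * M) ^ 2 := by field_simp
    exact hnsum ((summable_nat_add_iff (N + 1)).mp
      (summable_of_sum_range_le (fun i => (hw _).le) hbound))
  refine ⟨f x, fun z => ?_⟩
  induction hconn x z with
  | refl => rfl
  | tail _ h ih => rw [← hedge _ _ h, ih]

end Stmt14
end

section
/- Let (b,c) be a connected graph over (X,m) satisfying condition (A): for every sequence (x_n)_{n≥0} of pairwise distinct vertices with x_n ∼ x_{n+1} for all n, one has ∑_{n} m(x_n) = ∞. Then for every p ∈ [1,∞), every nonnegative subharmonic function f ∈ ℓ^p(X,m) is constant; if in addition m(X) = ∞, then there is no positive subharmonic function in ℓ^p(X,m). -/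
/-!
STATEMENT 15: Graphs with condition (A) (every infinite path has infinite measure).
For every `p ∈ [1,∞)`, every nonnegative subharmonic function in `ℓ^p(X,m)` is
constant; if moreover `m(X) = ∞`, there is no positive subharmonic function in
`ℓ^p(X,m)` (i.e. every such nonnegative function vanishes identically).
-/

namespace Stmt15

/-- The formal Laplacian `𝓛 f (x) = (1/m x) ∑_y b x y (f x - f y) + (c x / m x) f x`. -/
noncomputable def lap {X : Type*} (m : X → ℝ) (b : X → X → ℝ) (c : X → ℝ)
    (f : X → ℝ) (x : X) : ℝ :=
  (1 / m x) * (∑' y, b x y * (f x - f y)) + (c x / m x) * f x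

theorem summable_mul_sub_of_summable_mul_sq {X : Type*} {w f : X → ℝ} (hw : ∀ y, 0 ≤ w y)
    (hsum : Summable w) (hsq : Summable fun y => w y * (f y) ^ 2) (a : ℝ) :
    Summable fun y => w y * (a - f y) := by
  have hf : Summable fun y => w y * f y := by
    refine Summable.of_norm_bounded (hsum.add hsq) fun y => ?_
    rw [Real.norm_eq_abs, abs_le]
    constructor <;> nlinarith [hw y, mul_nonneg (hw y) (sq_nonneg (f y - 1)),
      mul_nonneg (hw y) (sq_nonneg (f y + 1)), mul_nonneg (hw y) (sq_nonneg (f y))]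
  simpa only [mul_sub] using (hsum.mul_right a).sub hf

/-- A maximum principle: a nonnegative subharmonic function that has a strictly smaller value at
some neighbor of `x` also has a strictly larger value at some neighbor of `x`. -/
theorem exists_lt_neighbor_of_lap_nonpos {X : Type*} {m : X → ℝ} {b : X → X → ℝ} {c f : X → ℝ}
    {x z : X} (hm : 0 < m x) (hb_nonneg : ∀ y, 0 ≤ b x y) (hb_sum : Summable fun y => b x y)
    (hc : 0 ≤ c x) (hfF : Summable fun y => b x y * (f y) ^ 2) (hfpos : 0 ≤ f x)
    (hfsub : lap m b c f x ≤ 0) (hxz : 0 < b x z) (hlt : f z < f x) :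
    ∃ y, 0 < b x y ∧ f x < f y := by
  by_contra! h
  have hnonneg : ∀ y, 0 ≤ b x y * (f x - f y) := fun y => by
    rcases (hb_nonneg y).eq_or_lt with h0 | h0
    · simp [← h0]
    · exact mul_nonneg h0.le (sub_nonneg.2 (h y h0))
  have hpos : 0 < ∑' y, b x y * (f x - f y) :=
    (summable_mul_sub_of_summable_mul_sq hb_nonneg hb_sum hfF (f x)).tsum_pos hnonneg z
      (mul_pos hxz (sub_pos.2 hlt))
  have h1 : 0 < 1 / m x * ∑' y, b x y * (f x - f y) := by positivity
  have h2 : 0 ≤ c x / m x * f x := by positivity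
  unfold lap at hfsub
  linarith

/-- A property inherited along steps of `r` with strictly increasing `f` produces an infinite
path along which `f` is strictly increasing. -/
theorem exists_strictMono_path {X : Type*} {r : X → X → Prop} {f : X → ℝ} {P : X → Prop}
    (hstep : ∀ x, P x → ∃ y, P y ∧ r x y ∧ f x < f y) {x₀ : X} (h₀ : P x₀) :
    ∃ γ : ℕ → X, γ 0 = x₀ ∧ (∀ n, r (γ n) (γ (n + 1))) ∧ StrictMono fun n => f (γ n) := by
  choose g hgP hgr hgf using hstep
  let s : ℕ → {x // P x} := fun n => Nat.rec ⟨x₀, h₀⟩ (fun _ u => ⟨g u.1 u.2, hgP u.1 u.2⟩) n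
  exact ⟨fun n => (s n).1, rfl, fun n => hgr _ (s n).2,
    strictMono_nat_of_lt_succ fun n => hgf _ (s n).2⟩

theorem no_Lp_subharmonic_under_condition_A
    {X : Type*} [Countable X] [Infinite X]
    (m : X → ℝ) (hm : ∀ x, 0 < m x)
    (b : X → X → ℝ) (hb_symm : ∀ x y, b x y = b y x)
    (hb_nonneg : ∀ x y, 0 ≤ b x y) (hb_diag : ∀ x, b x x = 0)
    (hb_sum : ∀ x, Summable fun y => b x y)
    (c : X → ℝ) (hc : ∀ x, 0 ≤ c x)
    (hconn : ∀ x y : X, Relation.ReflTransGen (fun u v : X => 0 < b u v) x y)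
    -- (A): every infinite path has infinite measure
    (hA : ∀ γ : ℕ → X, Function.Injective γ →
      (∀ n, 0 < b (γ n) (γ (n + 1))) → ¬ Summable (fun n => m (γ n)))
    (p : ℝ) (hp : 1 ≤ p)
    (f : X → ℝ)
    (hfF : ∀ x, Summable fun y => b x y * (f y) ^ 2)
    (hfpos : ∀ x, 0 ≤ f x)
    (hfsub : ∀ x, lap m b c f x ≤ 0)
    (hflp : Summable fun x => (f x) ^ p * m x) :
    (∃ a : ℝ, ∀ x, f x = a) ∧
    (¬ Summable (fun x => m x) → ∀ x, f x = 0) := by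
  have hconst : ∀ x y, 0 < b x y → f x = f y := by
    suffices H : ∀ x y, 0 < b x y → ¬ f x < f y from fun x y hxy =>
      le_antisymm (not_lt.1 (H y x (hb_symm x y ▸ hxy))) (not_lt.1 (H x y hxy))
    intro x y hxy hlt
    obtain ⟨γ, hγ0, hγb, hγf⟩ := exists_strictMono_path (r := fun u v => 0 < b u v) (f := f)
      (P := fun v => ∃ u, 0 < b v u ∧ f u < f v) (x₀ := y)
      (fun v ⟨u, hvu, huv⟩ => by
        obtain ⟨w, hvw, hw⟩ := exists_lt_neighbor_of_lap_nonpos (hm v) (hb_nonneg v) (hb_sum v)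
          (hc v) (hfF v) (hfpos v) (hfsub v) hvu huv
        exact ⟨w, ⟨v, hb_symm v w ▸ hvw, hw⟩, hvw, hw⟩)
      ⟨x, hb_symm x y ▸ hxy, hlt⟩
    have hinj : Function.Injective γ := fun i j hij => hγf.injective (congrArg f hij)
    have hy : 0 < f y := (hfpos x).trans_lt hlt
    have hyp : 0 < f y ^ p := Real.rpow_pos_of_pos hy p
    refine hA γ hinj hγb ((summable_mul_left_iff hyp.ne').1 ?_)
    refine Summable.of_nonneg_of_le (fun n => mul_nonneg hyp.le (hm _).le) (fun n => ?_)
      (hflp.comp_injective hinj)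
    have hle : f y ≤ f (γ n) := hγ0 ▸ hγf.monotone (Nat.zero_le n)
    exact mul_le_mul_of_nonneg_right (Real.rpow_le_rpow hy.le hle (by linarith)) (hm _).le
  have hall : ∀ x y, f x = f y := fun x y => by
    induction hconn x y with
    | refl => rfl
    | tail _ h ih => exact ih.trans (hconst _ _ h)
  refine ⟨⟨f (Classical.arbitrary X), fun x => hall _ _⟩, fun hmX x => ?_⟩
  by_contra hx
  have hxp : 0 < f x ^ p := Real.rpow_pos_of_pos ((hfpos x).lt_of_ne' hx) p
  refine hmX ((summable_mul_left_iff hxp.ne').1 (hflp.congr fun y => ?_))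
  rw [hall x y]

end Stmt15
end

section
/- Let b be a locally finite connected graph over (X,m) and ρ an intrinsic metric with finite balls (B) and finite jump size (J). Suppose for some x ∈ X one has m(B_r(x)) → ∞ as r → ∞ and ∫_{r₀}^{∞} r / log(m(B_r(x))) dr = ∞ for every sufficiently large r₀ (large enough that log m(B_r(x)) > 0 for r ≥ r₀). Then the graph is stochastically complete; equivalently, for every λ < 0, every bounded function u : X → ℝ satisfying 𝓛u = λu is identically zero. -/
/-!
STATEMENT 16: Grigor'yan's criterion for stochastic completeness of graphs.
Under (B) and (J), if `m(B_r(x)) → ∞` and `∫_{r₀}^∞ r / log m(B_r(x)) dr = ∞`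
for every sufficiently large `r₀` (i.e. for every `r₀` such that
`log m(B_r(x)) > 0` for all `r ≥ r₀`), then the graph is stochastically complete:
for every `λ < 0` every bounded solution `u` of `𝓛u = λu` vanishes identically.
-/

open scoped ENNReal

namespace Stmt16

/-- The formal Laplacian (with `c ≡ 0`). -/
noncomputable def lap {X : Type*} (m : X → ℝ) (b : X → X → ℝ)
    (u : X → ℝ) (x : X) : ℝ :=
  (1 / m x) * (∑' y, b x y * (u x - u y))

/-- The volume of the ball `B_r(x)`. -/
noncomputable def volBall {X : Type*} (m : X → ℝ) (ρ : X → X → ℝ) (x : X) (r : ℝ) : ℝ :=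
  ∑' y : ({z | ρ x z ≤ r} : Set X), m y

section Calculus

open Filter Topology

theorem hasDerivAt_max_zero_sq (x : ℝ) :
    HasDerivAt (fun y : ℝ => (max y 0) ^ 2) (2 * max x 0) x := by
  rcases lt_trichotomy x 0 with hx | rfl | hx
  · rw [max_eq_right hx.le, mul_zero]
    refine (hasDerivAt_const x (0 : ℝ)).congr_of_eventuallyEq ?_
    filter_upwards [gt_mem_nhds hx] with y hy
    simp [max_eq_right hy.le]
  · simp only [max_self, mul_zero]
    rw [hasDerivAt_iff_isLittleO_nhds_zero]
    have hO : (fun h : ℝ => (max (0 + h) 0) ^ 2 - (max (0 : ℝ) 0) ^ 2 - h • (0 : ℝ))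
        =O[𝓝 0] fun h : ℝ => h ^ 2 := by
      refine Asymptotics.IsBigO.of_bound 1 (Eventually.of_forall fun h => ?_)
      rcases le_total h 0 with hh | hh
      · simp [max_eq_right hh, sq_nonneg]
      · simp [max_eq_left hh]
    exact hO.trans_isLittleO (Asymptotics.isLittleO_pow_id one_lt_two)
  · rw [max_eq_left hx.le]
    refine ((hasDerivAt_pow 2 x).congr_deriv (by simp)).congr_of_eventuallyEq ?_
    filter_upwards [lt_mem_nhds hx] with y hy
    simp [max_eq_left hy.le]

/-- The Gaussian profile `exp (-d² / (4σ))`. -/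
noncomputable def gauss (σ d : ℝ) : ℝ := Real.exp (-d ^ 2 / (4 * σ))

/-- The Gaussian profile, shifted down so that it vanishes for `|d| ≥ L`. -/
noncomputable def cutoff (L σ d : ℝ) : ℝ := max (gauss σ d - gauss σ L) 0

theorem gauss_pos (σ d : ℝ) : 0 < gauss σ d := Real.exp_pos _

theorem gauss_le_one {σ : ℝ} (hσ : 0 < σ) (d : ℝ) : gauss σ d ≤ 1 := by
  rw [gauss, Real.exp_le_one_iff, neg_div]
  have : 0 ≤ d ^ 2 / (4 * σ) := by positivity
  linarith

theorem gauss_anti {σ d d' : ℝ} (hσ : 0 < σ) (hd : 0 ≤ d) (h : d ≤ d') :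
    gauss σ d' ≤ gauss σ d := by
  rw [gauss, gauss, Real.exp_le_exp]
  gcongr

theorem cutoff_nonneg (L σ d : ℝ) : 0 ≤ cutoff L σ d := le_max_right _ _

theorem cutoff_le_one {σ : ℝ} (hσ : 0 < σ) (L d : ℝ) : cutoff L σ d ≤ 1 :=
  max_le (by linarith [gauss_le_one hσ d, gauss_pos σ L]) zero_le_one

theorem cutoff_eq_zero {L σ d : ℝ} (hσ : 0 < σ) (hL : 0 ≤ L) (h : L ≤ d) :
    cutoff L σ d = 0 :=
  max_eq_right (by linarith [gauss_anti hσ hL h])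

theorem cutoff_zero {σ : ℝ} (hσ : 0 < σ) (L : ℝ) : cutoff L σ 0 = 1 - gauss σ L := by
  have h0 : gauss σ 0 = 1 := by simp [gauss]
  rw [cutoff, h0, max_eq_left (by linarith [gauss_le_one hσ L])]

theorem abs_cutoff_sub_le (L σ d d' : ℝ) :
    |cutoff L σ d' - cutoff L σ d| ≤ |gauss σ d' - gauss σ d| := by
  refine (abs_max_sub_max_le_abs _ _ _).trans_eq ?_
  congr 1
  ring

theorem gauss_sub_sq_le {σ h ε d d' : ℝ} (hσ : 0 < σ) (hd : 0 ≤ d) (hd' : 0 ≤ d')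
    (hh : |d' - d| ≤ h) (hε : h ^ 2 ≤ 2 * ε * σ ^ 2) (hsmall : h * (2 * d + h) ≤ σ) :
    (gauss σ d' - gauss σ d) ^ 2
      ≤ (d' - d) ^ 2 * (gauss σ d ^ 2 * d ^ 2 / (2 * σ ^ 2) + ε) := by
  have h0 : 0 ≤ h := (abs_nonneg _).trans hh
  set y : ℝ := (d ^ 2 - d' ^ 2) / (4 * σ) with hy
  have hfac : gauss σ d' = gauss σ d * Real.exp y := by
    rw [gauss, gauss, ← Real.exp_add]
    congr 1
    rw [hy]; field_simp; ring
  have hdd : d' + d ≤ 2 * d + h := by linarith [(abs_le.1 hh).2]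
  have hyabs : |y| = |d' - d| * (d' + d) / (4 * σ) := by
    rw [hy, abs_div, abs_of_pos (by positivity : 0 < 4 * σ),
      show d ^ 2 - d' ^ 2 = -((d' - d) * (d' + d)) by ring, abs_neg, abs_mul,
      abs_of_nonneg (by positivity : 0 ≤ d' + d)]
  have hy4 : |y| ≤ 1 / 4 := by
    rw [hyabs, div_le_div_iff₀ (by positivity) (by norm_num)]
    have : |d' - d| * (d' + d) ≤ h * (2 * d + h) := by gcongr
    linarith
  have hexp : |Real.exp y - 1| ≤ 5 / 4 * |y| := by
    have h1 := Real.abs_exp_sub_one_sub_id_le (x := y) (by linarith)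
    have h2 : |Real.exp y - 1| ≤ |Real.exp y - 1 - y| + |y| := by
      simpa using abs_add_le (Real.exp y - 1 - y) y
    have h3 : y ^ 2 ≤ 1 / 4 * |y| := by
      rw [← sq_abs, sq]; gcongr
    linarith
  have hexp2 : (Real.exp y - 1) ^ 2 ≤ 25 / 16 * y ^ 2 := by
    rw [← sq_abs, ← sq_abs y]
    calc |Real.exp y - 1| ^ 2 ≤ (5 / 4 * |y|) ^ 2 := by gcongr
      _ = 25 / 16 * |y| ^ 2 := by ring
  have hy2 : y ^ 2 ≤ (d' - d) ^ 2 * (2 * d + h) ^ 2 / (16 * σ ^ 2) := by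
    rw [← sq_abs y, hyabs, div_pow, mul_pow, sq_abs, mul_pow]
    norm_num
    gcongr
  have hquad : 25 / 16 * (2 * d + h) ^ 2 ≤ 8 * d ^ 2 + 8 * h ^ 2 := by
    nlinarith [sq_nonneg (d - 25 / 14 * h), sq_nonneg h]
  have hg1 : gauss σ d ^ 2 ≤ 1 := pow_le_one₀ (gauss_pos σ d).le (gauss_le_one hσ d)
  have hmain : 25 / 16 * y ^ 2
      ≤ (d' - d) ^ 2 * (d ^ 2 / (2 * σ ^ 2) + h ^ 2 / (2 * σ ^ 2)) := by
    calc 25 / 16 * y ^ 2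
        ≤ 25 / 16 * ((d' - d) ^ 2 * (2 * d + h) ^ 2 / (16 * σ ^ 2)) := by gcongr
      _ = (d' - d) ^ 2 * (25 / 16 * (2 * d + h) ^ 2) / (16 * σ ^ 2) := by ring
      _ ≤ (d' - d) ^ 2 * (8 * d ^ 2 + 8 * h ^ 2) / (16 * σ ^ 2) := by gcongr
      _ = _ := by field_simp; ring
  have hε' : h ^ 2 / (2 * σ ^ 2) ≤ ε := by
    rw [div_le_iff₀ (by positivity)]; linarith
  calc (gauss σ d' - gauss σ d) ^ 2 = gauss σ d ^ 2 * (Real.exp y - 1) ^ 2 := by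
        rw [hfac]; ring
    _ ≤ gauss σ d ^ 2 * ((d' - d) ^ 2 * (d ^ 2 / (2 * σ ^ 2) + h ^ 2 / (2 * σ ^ 2))) := by
        gcongr; exact hexp2.trans hmain
    _ = (d' - d) ^ 2 * (gauss σ d ^ 2 * d ^ 2 / (2 * σ ^ 2)
          + gauss σ d ^ 2 * (h ^ 2 / (2 * σ ^ 2))) := by ring
    _ ≤ _ := by
        gcongr
        calc gauss σ d ^ 2 * (h ^ 2 / (2 * σ ^ 2)) ≤ 1 * (h ^ 2 / (2 * σ ^ 2)) := by gcongr
          _ ≤ ε := by simpa using hε'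

/-- A bound for the squared slope of `cutoff L σ` at `d` on scales at most `1`. -/
noncomputable def slopeBound (L ε σ d : ℝ) : ℝ :=
  if d ≤ L + 1 then gauss σ d ^ 2 * d ^ 2 / (2 * σ ^ 2) + ε else 0

theorem slopeBound_nonneg {L ε : ℝ} (hε : 0 ≤ ε) (σ d : ℝ) : 0 ≤ slopeBound L ε σ d := by
  unfold slopeBound
  split_ifs <;> positivity

theorem cutoff_sub_sq_le {L σ h ε d d' : ℝ} (hL : 0 ≤ L) (hσ : 0 < σ) (hd : 0 ≤ d)
    (hd' : 0 ≤ d') (hh : |d' - d| ≤ h) (h1 : h ≤ 1) (hε : h ^ 2 ≤ 2 * ε * σ ^ 2)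
    (hsmall : h * (2 * L + 3) ≤ σ) :
    (cutoff L σ d' - cutoff L σ d) ^ 2 ≤ (d' - d) ^ 2 * slopeBound L ε σ d := by
  have h0 : 0 ≤ h := (abs_nonneg _).trans hh
  unfold slopeBound
  split_ifs with hdL
  · refine le_trans (sq_le_sq.2 (abs_cutoff_sub_le L σ d d')) ?_
    refine gauss_sub_sq_le hσ hd hd' hh hε (le_trans ?_ hsmall)
    exact mul_le_mul_of_nonneg_left (by linarith) h0
  · have : L ≤ d' := by linarith [(abs_le.1 hh).1]
    rw [cutoff_eq_zero hσ hL this, cutoff_eq_zero hσ hL (by linarith : L ≤ d)]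
    simp

theorem hasDerivAt_gauss {τ t : ℝ} (ht : t < 2 * τ) (d : ℝ) :
    HasDerivAt (fun t => gauss (2 * τ - t) d)
      (-(gauss (2 * τ - t) d * d ^ 2 / (4 * (2 * τ - t) ^ 2))) t := by
  have hne : 4 * (2 * τ - t) ≠ 0 := by linarith
  have h1 : HasDerivAt (fun t : ℝ => 4 * (2 * τ - t)) (4 * (-1)) t :=
    ((hasDerivAt_id t).const_sub (2 * τ)).const_mul 4
  have h2 := ((hasDerivAt_const t (-d ^ 2)).div h1 hne).exp
  refine h2.congr_deriv ?_
  have : 2 * τ - t ≠ 0 := by linarith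
  simp only [gauss, Pi.div_apply]
  field_simp
  ring

/-- The time derivative of `(cutoff L (2τ - t) d)²`, as a function of `σ = 2τ - t`. -/
noncomputable def cutoffSqDeriv (L σ d : ℝ) : ℝ :=
  2 * cutoff L σ d * ((gauss σ L * L ^ 2 - gauss σ d * d ^ 2) / (4 * σ ^ 2))

theorem hasDerivAt_cutoff_sq {τ t : ℝ} (ht : t < 2 * τ) (L d : ℝ) :
    HasDerivAt (fun t => cutoff L (2 * τ - t) d ^ 2) (cutoffSqDeriv L (2 * τ - t) d) t := by
  have h1 := (hasDerivAt_gauss ht d).sub (hasDerivAt_gauss ht L)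
  refine ((hasDerivAt_max_zero_sq _).comp t h1).congr_deriv ?_
  simp only [cutoffSqDeriv, cutoff, Pi.sub_apply]
  ring

theorem slopeBound_add_cutoffSqDeriv_le {L ε σ d : ℝ} (hL : 3 ≤ L) (hσ : 0 < σ) (hd : 0 ≤ d) :
    slopeBound L ε σ d + cutoffSqDeriv L σ d
      ≤ if d ≤ L + 1 then gauss σ L * L ^ 2 / σ ^ 2 + ε else 0 := by
  unfold slopeBound
  split_ifs with h
  · rcases le_total L d with hLd | hdL
    · rw [cutoffSqDeriv, cutoff_eq_zero hσ (by linarith) hLd]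
      have he := gauss_anti hσ (by linarith) hLd
      have he1 := gauss_le_one hσ L
      have hp := gauss_pos σ L
      have hp' := gauss_pos σ d
      have : gauss σ d ^ 2 * d ^ 2 ≤ gauss σ L * (2 * L ^ 2) := by
        have a1 : gauss σ d ^ 2 ≤ gauss σ L := by nlinarith
        have a2 : d ^ 2 ≤ 2 * L ^ 2 := by nlinarith
        gcongr
      have h2 : gauss σ d ^ 2 * d ^ 2 / (2 * σ ^ 2) ≤ gauss σ L * (2 * L ^ 2) / (2 * σ ^ 2) := by
        gcongr
      have h3 : gauss σ L * (2 * L ^ 2) / (2 * σ ^ 2) = gauss σ L * L ^ 2 / σ ^ 2 := by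
        field_simp
      linarith
    · have he := gauss_anti hσ hd hdL
      have he1 := gauss_le_one hσ d
      have hp := gauss_pos σ L
      have hp' := gauss_pos σ d
      rw [cutoffSqDeriv, cutoff, max_eq_left (by linarith)]
      set η := gauss σ d
      set e := gauss σ L
      have hd2 : d ^ 2 ≤ L ^ 2 := by gcongr
      have key : 2 * η ^ 2 * d ^ 2 + 2 * (η - e) * (e * L ^ 2 - η * d ^ 2) ≤ 4 * (e * L ^ 2) := by
        have a1 : η * e * d ^ 2 ≤ 1 * e * L ^ 2 := by gcongr
        have a2 : η * e * L ^ 2 ≤ 1 * e * L ^ 2 := by gcongr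
        have a3 : 0 ≤ e ^ 2 * L ^ 2 := by positivity
        nlinarith
      have h4 : η ^ 2 * d ^ 2 / (2 * σ ^ 2) + ε
          + 2 * (η - e) * ((e * L ^ 2 - η * d ^ 2) / (4 * σ ^ 2))
          = (2 * η ^ 2 * d ^ 2 + 2 * (η - e) * (e * L ^ 2 - η * d ^ 2)) / (4 * σ ^ 2) + ε := by
        field_simp; ring
      have h5 : e * L ^ 2 / σ ^ 2 = 4 * (e * L ^ 2) / (4 * σ ^ 2) := by field_simp
      rw [h4, h5]
      gcongr
  · rw [cutoffSqDeriv, cutoff_eq_zero hσ (by linarith) (by linarith)]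
    simp

end Calculus

section Network

variable {V E : Type*} {𝒱 : Finset V} {ℰ : Finset E} {src tgt : E → V} {κ : E → ℝ}
  {μ r v : V → ℝ} {c ℓ₀ Rmax h : ℝ}

/-- A finite network with edges `ℰ`, conductances `κ`, vertex masses `μ` and a radius function `r`
which is intrinsic and has jumps at most `h`, together with a function `v` that satisfies, weakly,
`Δv ≥ c` on the part of `{v > ℓ₀}` of radius less than `Rmax`. -/
structure IsNetworkSubsolution (𝒱 : Finset V) (ℰ : Finset E) (src tgt : E → V) (κ : E → ℝ)
    (μ r v : V → ℝ) (c ℓ₀ Rmax h : ℝ) : Prop where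
  cond_nonneg : ∀ e ∈ ℰ, 0 ≤ κ e
  mass_nonneg : ∀ p ∈ 𝒱, 0 ≤ μ p
  mesh : ∀ e ∈ ℰ, |r (tgt e) - r (src e)| ≤ h
  intrinsic : ∀ f : V → ℝ, (∀ p, 0 ≤ f p) →
    ∑ e ∈ ℰ, κ e * (r (tgt e) - r (src e)) ^ 2 * (f (src e) + f (tgt e)) ≤ ∑ p ∈ 𝒱, μ p * f p
  subsolution : ∀ g : V → ℝ, (∀ p, 0 ≤ g p) → (∀ p, g p ≠ 0 → ℓ₀ < v p ∧ r p < Rmax) →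
    c * ∑ p ∈ 𝒱, μ p * g p
      ≤ -∑ e ∈ ℰ, κ e * ((v (tgt e) - v (src e)) * (g (tgt e) - g (src e)))

/-- The energy of `v` above the level `ℓ` in the ball of radius `R`. -/
noncomputable def levelEnergy (𝒱 : Finset V) (μ r v : V → ℝ) (ℓ R : ℝ) : ℝ :=
  ∑ p ∈ 𝒱, μ p * (if r p ≤ R then max (v p - ℓ) 0 ^ 2 else 0)

theorem truncated_edge_energy_le (a b P Q : ℝ) :
    -((b - a) * (max b 0 * Q ^ 2 - max a 0 * P ^ 2))
      ≤ (max a 0 ^ 2 + max b 0 ^ 2) / 2 * (Q - P) ^ 2 := by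
  have h1 : (max b 0 - max a 0) * (max b 0 * Q ^ 2 - max a 0 * P ^ 2)
      ≤ (b - a) * (max b 0 * Q ^ 2 - max a 0 * P ^ 2) := by
    rcases le_total a 0 with ha | ha <;> rcases le_total b 0 with hb | hb
    · simp [max_eq_right ha, max_eq_right hb]
    · rw [max_eq_right ha, max_eq_left hb]
      nlinarith [mul_nonneg (neg_nonneg.2 ha) (mul_nonneg hb (sq_nonneg Q))]
    · rw [max_eq_left ha, max_eq_right hb]
      nlinarith [mul_nonneg (neg_nonneg.2 hb) (mul_nonneg ha (sq_nonneg P))]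
    · rw [max_eq_left ha, max_eq_left hb]
  nlinarith [sq_nonneg (max b 0 * Q - max a 0 * P),
    mul_nonneg (sq_nonneg (max b 0 - max a 0)) (sq_nonneg (Q - P))]

/-- The weighted energy whose growth in time is controlled. -/
noncomputable def weightedEnergy (𝒱 : Finset V) (μ r v : V → ℝ) (c ℓ R L τ t : ℝ) : ℝ :=
  ∑ p ∈ 𝒱, μ p * (max (v p - ℓ - c * (τ - t)) 0 ^ 2 * cutoff L (2 * τ - t) (max (r p - R) 0) ^ 2)

theorem hasDerivAt_weightedEnergy (𝒱 : Finset V) (μ r v : V → ℝ) (c ℓ R L : ℝ) {τ t : ℝ}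
    (ht : t < 2 * τ) :
    HasDerivAt (weightedEnergy 𝒱 μ r v c ℓ R L τ)
      (2 * (c * ∑ p ∈ 𝒱, μ p * (max (v p - ℓ - c * (τ - t)) 0 *
          cutoff L (2 * τ - t) (max (r p - R) 0) ^ 2))
        + ∑ p ∈ 𝒱, μ p * (max (v p - ℓ - c * (τ - t)) 0 ^ 2 *
          cutoffSqDeriv L (2 * τ - t) (max (r p - R) 0))) t := by
  have hterm : ∀ p ∈ 𝒱, HasDerivAt (fun t => μ p * (max (v p - ℓ - c * (τ - t)) 0 ^ 2 *
      cutoff L (2 * τ - t) (max (r p - R) 0) ^ 2))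
      (μ p * (2 * max (v p - ℓ - c * (τ - t)) 0 * c * cutoff L (2 * τ - t) (max (r p - R) 0) ^ 2
        + max (v p - ℓ - c * (τ - t)) 0 ^ 2 *
          cutoffSqDeriv L (2 * τ - t) (max (r p - R) 0))) t := by
    intro p _
    have h1 : HasDerivAt (fun t : ℝ => v p - ℓ - c * (τ - t)) c t :=
      ((((hasDerivAt_id t).const_sub τ).const_mul c).const_sub (v p - ℓ)).congr_deriv (by ring)
    have h2 := (hasDerivAt_max_zero_sq _).comp t h1
    exact (h2.mul (hasDerivAt_cutoff_sq ht L (max (r p - R) 0))).const_mul (μ p)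
  refine (HasDerivAt.fun_sum hterm).congr_deriv ?_
  rw [Finset.mul_sum, Finset.mul_sum, ← Finset.sum_add_distrib]
  refine Finset.sum_congr rfl fun p _ => ?_
  ring

theorem gauss_mul_sq_div_le {L τ σ : ℝ} (hτ : 0 < τ) (h1 : τ ≤ σ) (h2 : σ ≤ 2 * τ) :
    gauss σ L * L ^ 2 / σ ^ 2 ≤ Real.exp (-(L ^ 2 / (8 * τ))) * (L ^ 2 / τ ^ 2) := by
  have hσ : 0 < σ := hτ.trans_le h1
  have hg : gauss σ L ≤ Real.exp (-(L ^ 2 / (8 * τ))) := by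
    rw [gauss, Real.exp_le_exp, neg_div, neg_le_neg_iff]
    apply div_le_div_of_nonneg_left (by positivity) (by positivity) (by linarith)
  rw [mul_div_assoc]
  gcongr

theorem IsNetworkSubsolution.deriv_bound
    (H : IsNetworkSubsolution 𝒱 ℰ src tgt κ μ r v c ℓ₀ Rmax h)
    {ℓ R L τ t ε K M : ℝ} (hc : 0 ≤ c) (hℓ : ℓ₀ ≤ ℓ) (hL : 3 ≤ L) (hRmax : R + L ≤ Rmax)
    (hτ : 0 < τ) (ht0 : 0 ≤ t) (htτ : t ≤ τ) (hε0 : 0 ≤ ε) (h1 : h ≤ 1)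
    (hε : h ^ 2 ≤ 2 * ε * τ ^ 2) (hsmall : h * (2 * L + 3) ≤ τ) (hK : ∀ p ∈ 𝒱, v p - ℓ₀ ≤ K)
    (hK0 : 0 ≤ K) (hM : ∑ p ∈ 𝒱, μ p * (if r p ≤ R + (L + 1) then 1 else 0) ≤ M) :
    2 * (c * ∑ p ∈ 𝒱, μ p * (max (v p - ℓ - c * (τ - t)) 0 *
          cutoff L (2 * τ - t) (max (r p - R) 0) ^ 2))
        + ∑ p ∈ 𝒱, μ p * (max (v p - ℓ - c * (τ - t)) 0 ^ 2 *
          cutoffSqDeriv L (2 * τ - t) (max (r p - R) 0))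
      ≤ K ^ 2 * M * (Real.exp (-(L ^ 2 / (8 * τ))) * (L ^ 2 / τ ^ 2) + ε) := by
  set σ := 2 * τ - t with hσdef
  have hτσ : τ ≤ σ := by linarith
  have hσ : 0 < σ := hτ.trans_le hτσ
  set w : V → ℝ := fun p => max (v p - ℓ - c * (τ - t)) 0 with hw
  set d : V → ℝ := fun p => max (r p - R) 0 with hd
  set A : V → ℝ := fun p => slopeBound L ε σ (d p) with hA
  set B := Real.exp (-(L ^ 2 / (8 * τ))) * (L ^ 2 / τ ^ 2) with hB
  have hct : 0 ≤ c * (τ - t) := mul_nonneg hc (by linarith)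
  have hd0 : ∀ p, 0 ≤ d p := fun p => le_max_right _ _
  have hw0 : ∀ p, 0 ≤ w p := fun p => le_max_right _ _
  have hA0 : ∀ p, 0 ≤ A p := fun p => slopeBound_nonneg hε0 _ _
  have hsub := H.subsolution (fun p => w p * cutoff L σ (d p) ^ 2)
    (fun p => mul_nonneg (hw0 p) (sq_nonneg _)) (fun p hp => by
      have hwp : w p ≠ 0 := left_ne_zero_of_mul hp
      have hcp : cutoff L σ (d p) ≠ 0 := by
        have := right_ne_zero_of_mul hp
        exact fun h => this (by simp [h])
      constructor
      · by_contra! hv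
        exact hwp (max_eq_right (by linarith))
      · by_contra! hr
        refine hcp (cutoff_eq_zero hσ (by linarith) (le_trans ?_ (le_max_left _ _)))
        linarith)
  have hedge : ∀ e ∈ ℰ, -(κ e * ((v (tgt e) - v (src e)) *
      (w (tgt e) * cutoff L σ (d (tgt e)) ^ 2 - w (src e) * cutoff L σ (d (src e)) ^ 2)))
      ≤ 1 / 2 * (κ e * (r (tgt e) - r (src e)) ^ 2 *
        (w (src e) ^ 2 * A (src e) + w (tgt e) ^ 2 * A (tgt e))) := by
    intro e he
    have hκ := H.cond_nonneg e he
    set p := src e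
    set q := tgt e
    have hdpq : |d q - d p| ≤ |r q - r p| := by
      refine (abs_max_sub_max_le_abs _ _ _).trans_eq ?_
      congr 1
      ring
    have hdpq' : |d p - d q| ≤ |r q - r p| := by rwa [abs_sub_comm]
    have hεσ : h ^ 2 ≤ 2 * ε * σ ^ 2 := hε.trans (by gcongr)
    have hmesh := H.mesh e he
    have key : ∀ p q : V, |d q - d p| ≤ |r q - r p| → |r q - r p| ≤ h →
        (cutoff L σ (d q) - cutoff L σ (d p)) ^ 2 ≤ (r q - r p) ^ 2 * A p := by
      intro p q h2 h3
      refine (cutoff_sub_sq_le (by linarith) hσ (hd0 p) (hd0 q) (h2.trans h3) h1 hεσ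
        (hsmall.trans hτσ)).trans ?_
      exact mul_le_mul_of_nonneg_right (sq_le_sq.2 h2) (hA0 p)
    have kp := key p q hdpq hmesh
    have kq := key q p (by rwa [abs_sub_comm (r p)]) (by rwa [abs_sub_comm])
    have htr := truncated_edge_energy_le (v p - ℓ - c * (τ - t)) (v q - ℓ - c * (τ - t))
      (cutoff L σ (d p)) (cutoff L σ (d q))
    rw [sub_sub_sub_cancel_right, sub_sub_sub_cancel_right] at htr
    have h5 : (w p ^ 2 + w q ^ 2) / 2 * (cutoff L σ (d q) - cutoff L σ (d p)) ^ 2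
        ≤ 1 / 2 * ((r q - r p) ^ 2 * (w p ^ 2 * A p + w q ^ 2 * A q)) := by
      nlinarith [mul_le_mul_of_nonneg_left kp (sq_nonneg (w p)),
        mul_le_mul_of_nonneg_left kq (sq_nonneg (w q))]
    have h6 := mul_le_mul_of_nonneg_left (htr.trans h5) hκ
    linarith
  have hsum := Finset.sum_le_sum hedge
  rw [Finset.sum_neg_distrib, ← Finset.mul_sum] at hsum
  have hint := H.intrinsic (fun p => w p ^ 2 * A p) fun p => mul_nonneg (sq_nonneg _) (hA0 p)
  have hB0 : 0 ≤ B := by positivity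
  have hpt : ∀ p ∈ 𝒱, μ p * (w p ^ 2 * A p) + μ p * (w p ^ 2 * cutoffSqDeriv L σ (d p))
      ≤ K ^ 2 * (B + ε) * (μ p * (if r p ≤ R + (L + 1) then 1 else 0)) := by
    intro p hp
    have hμ := H.mass_nonneg p hp
    have hwK : w p ≤ K := max_le (by linarith [hK p hp]) hK0
    have hsl := slopeBound_add_cutoffSqDeriv_le (ε := ε) hL hσ (hd0 p)
    have hiff : d p ≤ L + 1 ↔ r p ≤ R + (L + 1) := by
      simp only [hd, max_le_iff]
      constructor
      · intro h; linarith [h.1]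
      · intro h; constructor <;> linarith
    have hgs := gauss_mul_sq_div_le (L := L) hτ hτσ (by linarith : σ ≤ 2 * τ)
    simp only [hiff] at hsl
    have hsl2 : A p + cutoffSqDeriv L σ (d p)
        ≤ (B + ε) * (if r p ≤ R + (L + 1) then 1 else 0) := by
      refine hsl.trans ?_
      split_ifs
      · linarith
      · simp
    have hrhs : 0 ≤ (B + ε) * (if r p ≤ R + (L + 1) then (1 : ℝ) else 0) := by
      split_ifs <;> simp [add_nonneg hB0 hε0]
    calc μ p * (w p ^ 2 * A p) + μ p * (w p ^ 2 * cutoffSqDeriv L σ (d p))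
        = μ p * (w p ^ 2 * (A p + cutoffSqDeriv L σ (d p))) := by ring
      _ ≤ μ p * (K ^ 2 * ((B + ε) * (if r p ≤ R + (L + 1) then 1 else 0))) := by
          refine mul_le_mul_of_nonneg_left ?_ hμ
          calc w p ^ 2 * (A p + cutoffSqDeriv L σ (d p))
              ≤ w p ^ 2 * ((B + ε) * (if r p ≤ R + (L + 1) then 1 else 0)) := by gcongr
            _ ≤ _ := by gcongr
      _ = _ := by ring
  have hfin := Finset.sum_le_sum hpt
  rw [Finset.sum_add_distrib, ← Finset.mul_sum] at hfin
  have hM' : K ^ 2 * (B + ε) * ∑ p ∈ 𝒱, μ p * (if r p ≤ R + (L + 1) then (1 : ℝ) else 0)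
      ≤ K ^ 2 * (B + ε) * M := by gcongr
  linarith

theorem IsNetworkSubsolution.levelEnergy_le
    (H : IsNetworkSubsolution 𝒱 ℰ src tgt κ μ r v c ℓ₀ Rmax h)
    {ℓ R L τ K M : ℝ} (hc : 0 ≤ c) (hℓ : ℓ₀ ≤ ℓ) (hL : 3 ≤ L) (hRmax : R + L ≤ Rmax)
    (hτ : 0 < τ) (hτ1 : τ ≤ 1) (h1 : h ≤ 1)
    (hε : h ^ 2 ≤ 2 * Real.exp (-(L ^ 2 / (16 * τ))) * τ ^ 2) (hsmall : h * (2 * L + 3) ≤ τ)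
    (hK : ∀ p ∈ 𝒱, v p - ℓ₀ ≤ K)
    (hK0 : 0 ≤ K) (hM : ∑ p ∈ 𝒱, μ p * (if r p ≤ R + (L + 1) then 1 else 0) ≤ M) :
    levelEnergy 𝒱 μ r v ℓ R ≤ levelEnergy 𝒱 μ r v (ℓ + c * τ) (R + (L + 1))
      + 19 * K ^ 2 * M * Real.exp (-(L ^ 2 / (16 * τ))) := by
  set ε := Real.exp (-(L ^ 2 / (16 * τ))) with hεdef
  have hε0 : 0 < ε := Real.exp_pos _
  have hM0 : 0 ≤ M := le_trans (Finset.sum_nonneg fun p hp =>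
    mul_nonneg (H.mass_nonneg p hp) (by split_ifs <;> simp)) hM
  have hder : ∀ t ∈ Set.Icc 0 τ, HasDerivAt (weightedEnergy 𝒱 μ r v c ℓ R L τ) _ t := fun t ht =>
    hasDerivAt_weightedEnergy 𝒱 μ r v c ℓ R L (by linarith [ht.2])
  set B := Real.exp (-(L ^ 2 / (8 * τ))) * (L ^ 2 / τ ^ 2) with hB
  have hgrow := (convex_Icc 0 τ).image_sub_le_mul_sub_of_deriv_le
    (fun t ht => (hder t ht).continuousAt.continuousWithinAt)
    (fun t ht => (hder t (interior_subset ht)).differentiableAt.differentiableWithinAt)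
    (C := K ^ 2 * M * (B + ε))
    (fun t ht => by
      have ht' := interior_subset ht
      rw [(hder t ht').deriv]
      exact H.deriv_bound hc hℓ hL hRmax hτ ht'.1 ht'.2 hε0.le h1 hε hsmall hK hK0 hM)
    0 ⟨le_rfl, hτ.le⟩ τ ⟨hτ.le, le_rfl⟩ hτ.le
  have hstart : weightedEnergy 𝒱 μ r v c ℓ R L τ 0
      ≤ levelEnergy 𝒱 μ r v (ℓ + c * τ) (R + (L + 1)) := by
    refine Finset.sum_le_sum fun p hp => mul_le_mul_of_nonneg_left ?_ (H.mass_nonneg p hp)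
    have h2τ : 0 < 2 * τ - 0 := by linarith
    split_ifs with hr
    · rw [show v p - ℓ - c * (τ - 0) = v p - (ℓ + c * τ) by ring]
      refine mul_le_of_le_one_right (sq_nonneg _) ?_
      exact pow_le_one₀ (cutoff_nonneg _ _ _) (cutoff_le_one h2τ _ _)
    · rw [cutoff_eq_zero h2τ (by linarith)
        (le_trans (by linarith) (le_max_left (r p - R) 0))]
      simp
  have hgauss : gauss τ L ≤ ε := by
    rw [gauss, hεdef, Real.exp_le_exp, neg_div, neg_le_neg_iff]
    apply div_le_div_of_nonneg_left (by positivity) (by positivity) (by linarith)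
  have hend : levelEnergy 𝒱 μ r v ℓ R
      ≤ weightedEnergy 𝒱 μ r v c ℓ R L τ τ + 2 * ε * K ^ 2 * M := by
    have hpt : ∀ p ∈ 𝒱, μ p * (if r p ≤ R then max (v p - ℓ) 0 ^ 2 else 0)
        ≤ μ p * (max (v p - ℓ - c * (τ - τ)) 0 ^ 2 *
            cutoff L (2 * τ - τ) (max (r p - R) 0) ^ 2)
          + 2 * ε * K ^ 2 * (μ p * (if r p ≤ R + (L + 1) then 1 else 0)) := by
      intro p hp
      have hμ := H.mass_nonneg p hp
      rw [show v p - ℓ - c * (τ - τ) = v p - ℓ by ring, show 2 * τ - τ = τ by ring]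
      have hwK : max (v p - ℓ) 0 ≤ K := max_le (by linarith [hK p hp]) hK0
      have hw0 : 0 ≤ max (v p - ℓ) 0 := le_max_right _ _
      set w := max (v p - ℓ) 0
      by_cases hr : r p ≤ R
      · rw [if_pos hr, if_pos (by linarith), max_eq_right (by linarith : r p - R ≤ 0),
          cutoff_zero hτ]
        have hg0 := gauss_pos τ L
        have : w ^ 2 ≤ w ^ 2 * (1 - gauss τ L) ^ 2 + 2 * ε * K ^ 2 := by
          have a1 : w ^ 2 * (2 * gauss τ L) ≤ K ^ 2 * (2 * ε) := by gcongr
          nlinarith [mul_nonneg (sq_nonneg w) (sq_nonneg (gauss τ L))]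
        nlinarith [mul_le_mul_of_nonneg_left this hμ]
      · rw [if_neg hr, mul_zero]
        have : (0 : ℝ) ≤ if r p ≤ R + (L + 1) then 1 else 0 := by split_ifs <;> simp
        positivity
    have hs := Finset.sum_le_sum hpt
    rw [Finset.sum_add_distrib, ← Finset.mul_sum] at hs
    have : 2 * ε * K ^ 2 * ∑ p ∈ 𝒱, μ p * (if r p ≤ R + (L + 1) then (1 : ℝ) else 0)
        ≤ 2 * ε * K ^ 2 * M := by gcongr
    exact hs.trans (by unfold weightedEnergy; linarith)
  have hBτ : B * τ ≤ 16 * ε := by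
    have hz : L ^ 2 / τ = 16 * (L ^ 2 / (16 * τ)) := by field_simp
    have hexp : L ^ 2 / (16 * τ) ≤ Real.exp (L ^ 2 / (16 * τ)) := by
      linarith [Real.add_one_le_exp (L ^ 2 / (16 * τ))]
    have h8 : Real.exp (-(L ^ 2 / (8 * τ))) = ε * ε := by
      rw [hεdef, ← Real.exp_add]; congr 1; field_simp; ring
    have hinv : ε * Real.exp (L ^ 2 / (16 * τ)) = 1 := by
      rw [hεdef, ← Real.exp_add]; simp
    calc B * τ = ε * ε * (L ^ 2 / τ) := by rw [hB, h8]; field_simp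
      _ = 16 * (ε * (ε * (L ^ 2 / (16 * τ)))) := by rw [hz]; ring
      _ ≤ 16 * (ε * (ε * Real.exp (L ^ 2 / (16 * τ)))) := by gcongr
      _ = 16 * ε := by rw [hinv, mul_one]
  have hετ : ε * τ ≤ ε := mul_le_of_le_one_right hε0.le hτ1
  have hKM : 0 ≤ K ^ 2 * M := by positivity
  have := mul_le_mul_of_nonneg_left (add_le_add hBτ hετ) hKM
  nlinarith

theorem IsNetworkSubsolution.levelEnergy_iterate
    (H : IsNetworkSubsolution 𝒱 ℰ src tgt κ μ r v c ℓ₀ Rmax h)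
    {K : ℝ} {k₀ n : ℕ} {τ M δ : ℕ → ℝ} (hc : 0 ≤ c) (hk₀ : 2 ≤ k₀)
    (hRmax : 2 ^ (k₀ + n) ≤ Rmax) (hτ : ∀ k, k₀ ≤ k → 0 < τ k) (hτ1 : ∀ k, τ k ≤ 1) (h1 : h ≤ 1)
    (hε : ∀ i < n, h ^ 2 ≤
      2 * Real.exp (-((2 ^ (k₀ + i) - 1) ^ 2 / (16 * τ (k₀ + i)))) * τ (k₀ + i) ^ 2)
    (hsmall : ∀ i < n, h * (2 * (2 ^ (k₀ + i) - 1) + 3) ≤ τ (k₀ + i))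
    (hK : ∀ p ∈ 𝒱, v p - ℓ₀ ≤ K) (hK0 : 0 ≤ K)
    (hM : ∀ k, ∑ p ∈ 𝒱, μ p * (if r p ≤ 2 ^ (k + 1) then 1 else 0) ≤ M k)
    (hδ : ∀ k, k₀ ≤ k → M k * Real.exp (-((2 ^ k - 1) ^ 2 / (16 * τ k))) ≤ δ k) :
    ∀ j ≤ n, levelEnergy 𝒱 μ r v ℓ₀ (2 ^ k₀)
      ≤ levelEnergy 𝒱 μ r v (ℓ₀ + c * ∑ i ∈ Finset.range j, τ (k₀ + i)) (2 ^ (k₀ + j))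
        + 19 * K ^ 2 * ∑ i ∈ Finset.range j, δ (k₀ + i) := by
  intro j
  induction j with
  | zero => intro _; simp
  | succ j ih =>
    intro hj
    have hsum0 : 0 ≤ c * ∑ i ∈ Finset.range j, τ (k₀ + i) :=
      mul_nonneg hc (Finset.sum_nonneg fun i _ => (hτ _ (by omega)).le)
    have h4 : (4 : ℝ) ≤ 2 ^ (k₀ + j) := by
      calc (4 : ℝ) = 2 ^ 2 := by norm_num
        _ ≤ 2 ^ (k₀ + j) := pow_le_pow_right₀ (by norm_num) (by omega)
    have hpow : (2 : ℝ) ^ (k₀ + j) + (2 ^ (k₀ + j) - 1 + 1) = 2 ^ (k₀ + j + 1) := by ring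
    have hmono : (2 : ℝ) ^ (k₀ + j + 1) ≤ 2 ^ (k₀ + n) :=
      pow_le_pow_right₀ (by norm_num) (by omega)
    have hstep := H.levelEnergy_le (ℓ := ℓ₀ + c * ∑ i ∈ Finset.range j, τ (k₀ + i))
      (R := 2 ^ (k₀ + j)) (L := 2 ^ (k₀ + j) - 1) (τ := τ (k₀ + j)) (K := K) (M := M (k₀ + j))
      hc (by linarith) (by linarith) (by linarith) (hτ _ (by omega)) (hτ1 _) h1 (hε j (by omega))
      (hsmall j (by omega)) hK hK0 (by rw [hpow]; exact hM _)
    rw [hpow] at hstep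
    have hd := mul_le_mul_of_nonneg_left (hδ (k₀ + j) (by omega))
      (by positivity : 0 ≤ 19 * K ^ 2)
    have := ih (by omega)
    rw [Finset.sum_range_succ, Finset.sum_range_succ, mul_add, ← add_assoc ℓ₀, mul_add,
      ← add_assoc k₀]
    linarith

end Network

section Subdivision

variable {X : Type*}

/-- The `i`-th point of the chain that subdivides the pair `(x, y)` into `n + 1` links. -/
def chainPoint (n : ℕ) (x y : X) : ℕ → X ⊕ (X × X × ℕ)
  | 0 => Sum.inl x
  | i + 1 => if i = n then Sum.inl y else Sum.inr (x, y, i)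

/-- The masses of the subdivided graph. -/
noncomputable def chainMass (m : X → ℝ) (b : X → X → ℝ) (r : X → ℝ) (n : ℕ) :
    X ⊕ (X × X × ℕ) → ℝ :=
  Sum.elim m fun q => b q.1 q.2.1 * (r q.1 - r q.2.1) ^ 2 / (n + 1)

/-- The extension of `u` to the subdivided graph that satisfies `Δu = c` at the interior points of
the chains; for `c = 0` it is the affine interpolation. -/
noncomputable def chainExtend (r : X → ℝ) (c : ℝ) (n : ℕ) (u : X → ℝ) : X ⊕ (X × X × ℕ) → ℝ :=
  Sum.elim u fun q => u q.1 + ((q.2.2 : ℝ) + 1) / (n + 1) * (u q.2.1 - u q.1)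
    - c * (r q.1 - r q.2.1) ^ 2 / (n + 1) ^ 2 * (((q.2.2 : ℝ) + 1) * (n - q.2.2))

theorem chainPoint_zero (n : ℕ) (x y : X) : chainPoint n x y 0 = Sum.inl x := rfl

theorem chainPoint_last (n : ℕ) (x y : X) : chainPoint n x y (n + 1) = Sum.inl y := by
  simp [chainPoint]

theorem chainPoint_interior {n i : ℕ} (h : i < n) (x y : X) :
    chainPoint n x y (i + 1) = Sum.inr (x, y, i) := by
  simp [chainPoint, h.ne]

theorem chainExtend_chainPoint (r : X → ℝ) (c : ℝ) (u : X → ℝ) {n i : ℕ} (hi : i ≤ n + 1)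
    (x y : X) :
    chainExtend r c n u (chainPoint n x y i) = u x + (i : ℝ) / (n + 1) * (u y - u x)
      - c * (r x - r y) ^ 2 / (n + 1) ^ 2 * (i * (n + 1 - i)) := by
  rcases i with _ | i
  · simp [chainPoint_zero, chainExtend]
  · rcases (Nat.lt_succ_iff.1 hi).eq_or_lt with rfl | h
    · have : (i : ℝ) + 1 ≠ 0 := by positivity
      rw [chainPoint_last]
      simp [chainExtend, div_self this]
    · rw [chainPoint_interior h]
      simp [chainExtend]

theorem chainExtend_link (r : X → ℝ) (c : ℝ) (u : X → ℝ) {n i : ℕ} (hi : i < n + 1)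
    (x y : X) :
    chainExtend r c n u (chainPoint n x y (i + 1)) - chainExtend r c n u (chainPoint n x y i)
      = (u y - u x) / (n + 1)
        + c * (r x - r y) ^ 2 / (n + 1) ^ 2 * (2 * i + 1 - (n + 1)) := by
  rw [chainExtend_chainPoint r c u hi, chainExtend_chainPoint r c u hi.le]
  push_cast
  ring

theorem sum_range_links (F : ℕ → ℝ) (n : ℕ) :
    ∑ i ∈ Finset.range (n + 1), (F i + F (i + 1))
      = F 0 + F (n + 1) + 2 * ∑ i ∈ Finset.range n, F (i + 1) := by
  rw [Finset.sum_add_distrib, Finset.sum_range_succ', Finset.sum_range_succ]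
  ring

theorem sum_range_weighted_links (F : ℕ → ℝ) (a : ℝ) (n : ℕ) :
    ∑ i ∈ Finset.range (n + 1), (2 * i + 1 - a) * (F (i + 1) - F i)
      = (2 * n + 1 - a) * F (n + 1) - (1 - a) * F 0 - 2 * ∑ i ∈ Finset.range n, F (i + 1) := by
  induction n with
  | zero => simp; ring
  | succ n ih =>
    rw [Finset.sum_range_succ, ih, Finset.sum_range_succ _ n]
    push_cast
    ring

theorem sum_symm_mul_add (S : Finset X) {a : X → X → ℝ} (ha : ∀ x y, a x y = a y x) (f : X → ℝ) :
    ∑ x ∈ S, ∑ y ∈ S, a x y * (f x + f y) = 2 * ∑ x ∈ S, f x * ∑ y ∈ S, a x y := by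
  have h1 : ∑ x ∈ S, ∑ y ∈ S, a x y * f y = ∑ x ∈ S, ∑ y ∈ S, a x y * f x := by
    rw [Finset.sum_comm]
    exact Finset.sum_congr rfl fun x _ => Finset.sum_congr rfl fun y _ => by rw [ha]
  have h2 : ∑ x ∈ S, ∑ y ∈ S, a x y * f x = ∑ x ∈ S, f x * ∑ y ∈ S, a x y :=
    Finset.sum_congr rfl fun x _ => by
      rw [Finset.mul_sum]
      exact Finset.sum_congr rfl fun y _ => mul_comm _ _
  simp only [mul_add, Finset.sum_add_distrib]
  rw [h1, h2]
  ring

theorem sum_symm_mul_sub_mul_sub (S : Finset X) {b : X → X → ℝ} (hb : ∀ x y, b x y = b y x)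
    (u g : X → ℝ) :
    ∑ x ∈ S, ∑ y ∈ S, b x y * ((u y - u x) * (g y - g x))
      = -(2 * ∑ x ∈ S, g x * ∑ y ∈ S, b x y * (u y - u x)) := by
  have h1 : ∑ x ∈ S, ∑ y ∈ S, b x y * ((u y - u x) * g y)
      = -∑ x ∈ S, g x * ∑ y ∈ S, b x y * (u y - u x) := by
    rw [Finset.sum_comm, ← Finset.sum_neg_distrib]
    refine Finset.sum_congr rfl fun x _ => ?_
    rw [Finset.mul_sum, ← Finset.sum_neg_distrib]
    exact Finset.sum_congr rfl fun y _ => by rw [hb]; ring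
  have h2 : ∑ x ∈ S, ∑ y ∈ S, b x y * ((u y - u x) * g x)
      = ∑ x ∈ S, g x * ∑ y ∈ S, b x y * (u y - u x) :=
    Finset.sum_congr rfl fun x _ => by
      rw [Finset.mul_sum]
      exact Finset.sum_congr rfl fun y _ => by ring
  simp only [mul_sub, Finset.sum_sub_distrib] at *
  linarith

/-- The vertices of the subdivision of a finite graph on `S`. -/
def chainVerts (S : Finset X) (n : ℕ) : Finset (X ⊕ (X × X × ℕ)) :=
  S.disjSum (S ×ˢ S ×ˢ Finset.range n)

theorem sum_chainVerts (S : Finset X) (n : ℕ) (f : X ⊕ (X × X × ℕ) → ℝ) :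
    ∑ p ∈ chainVerts S n, f p = ∑ x ∈ S, f (Sum.inl x)
      + ∑ x ∈ S, ∑ y ∈ S, ∑ i ∈ Finset.range n, f (chainPoint n x y (i + 1)) := by
  rw [chainVerts, Finset.sum_disjSum, Finset.sum_product]
  congr 1
  refine Finset.sum_congr rfl fun x _ => ?_
  rw [Finset.sum_product]
  refine Finset.sum_congr rfl fun y _ => Finset.sum_congr rfl fun i hi => ?_
  rw [chainPoint_interior (Finset.mem_range.1 hi)]

theorem chainMass_interior (m : X → ℝ) (b : X → X → ℝ) (r : X → ℝ) {n i : ℕ} (h : i < n)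
    (x y : X) :
    chainMass m b r n (chainPoint n x y (i + 1)) = b x y * (r x - r y) ^ 2 / (n + 1) := by
  rw [chainPoint_interior h]
  rfl

theorem sum_chainVerts_chainMass (m : X → ℝ) (b : X → X → ℝ) (r : X → ℝ) (S : Finset X) (n : ℕ)
    (f : X ⊕ (X × X × ℕ) → ℝ) :
    ∑ p ∈ chainVerts S n, chainMass m b r n p * f p = ∑ x ∈ S, m x * f (Sum.inl x)
      + ∑ x ∈ S, ∑ y ∈ S, b x y * (r x - r y) ^ 2 / (n + 1) *
        ∑ i ∈ Finset.range n, f (chainPoint n x y (i + 1)) := by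
  rw [sum_chainVerts]
  congr 1
  refine Finset.sum_congr rfl fun x _ => Finset.sum_congr rfl fun y _ => ?_
  rw [Finset.mul_sum]
  exact Finset.sum_congr rfl fun i hi => by rw [chainMass_interior m b r (Finset.mem_range.1 hi)]

theorem chainMass_nonneg {m : X → ℝ} {b : X → X → ℝ} (hm : ∀ x, 0 ≤ m x) (hb : ∀ x y, 0 ≤ b x y)
    (r : X → ℝ) (n : ℕ) (p : X ⊕ (X × X × ℕ)) : 0 ≤ chainMass m b r n p := by
  rcases p with x | q
  · exact hm x
  · exact div_nonneg (mul_nonneg (hb _ _) (sq_nonneg _)) (by positivity)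

theorem chainExtend_le (r : X → ℝ) {c K : ℝ} (hc : 0 ≤ c) {u : X → ℝ} {S : Finset X} {n : ℕ}
    (hu : ∀ x ∈ S, u x ≤ K) : ∀ p ∈ chainVerts S n, chainExtend r c n u p ≤ K := by
  intro p hp
  rcases p with x | ⟨x, y, i⟩
  · exact hu x (by simpa [chainVerts] using hp)
  · simp only [chainVerts, Finset.inr_mem_disjSum, Finset.mem_product, Finset.mem_range] at hp
    obtain ⟨hx, hy, hi⟩ := hp
    simp only [chainExtend, Sum.elim_inr]
    have hi' : (i : ℝ) + 1 ≤ n := by exact_mod_cast hi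
    have h1 : 0 ≤ c * (r x - r y) ^ 2 / ((n : ℝ) + 1) ^ 2 * (((i : ℝ) + 1) * (n - i)) := by
      have : 0 ≤ (n : ℝ) - i := by linarith
      positivity
    have ht0 : 0 ≤ ((i : ℝ) + 1) / (n + 1) := by positivity
    have ht1 : ((i : ℝ) + 1) / (n + 1) ≤ 1 := by
      rw [div_le_one (by positivity)]; linarith
    nlinarith [mul_le_mul_of_nonneg_left (hu y hy) ht0,
      mul_le_mul_of_nonneg_left (hu x hx) (sub_nonneg.2 ht1)]

theorem min_le_chainExtend_zero (r : X → ℝ) {n i : ℕ} (hi : i ≤ n + 1) (x y : X) :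
    min (r x) (r y) ≤ chainExtend r 0 n r (chainPoint n x y i) := by
  rw [chainExtend_chainPoint r 0 r hi]
  have hi' : (i : ℝ) ≤ n + 1 := by exact_mod_cast hi
  have ht0 : 0 ≤ (i : ℝ) / (n + 1) := by positivity
  have ht1 : (i : ℝ) / (n + 1) ≤ 1 := by
    rw [div_le_one (by positivity)]; linarith
  simp only [zero_mul, zero_div, sub_zero]
  nlinarith [mul_le_mul_of_nonneg_left (min_le_right (r x) (r y)) ht0,
    mul_le_mul_of_nonneg_left (min_le_left (r x) (r y)) (sub_nonneg.2 ht1)]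

theorem sum_chainMass_ball_le {m : X → ℝ} {b : X → X → ℝ} {r : X → ℝ} {S : Finset X}
    (hb_symm : ∀ x y, b x y = b y x) (hb : ∀ x y, 0 ≤ b x y)
    (hintr : ∀ x ∈ S, ∑ y ∈ S, b x y * (r x - r y) ^ 2 ≤ m x) (n : ℕ) (R : ℝ) :
    ∑ p ∈ chainVerts S n, chainMass m b r n p * (if chainExtend r 0 n r p ≤ R then 1 else 0)
      ≤ 3 * ∑ x ∈ S, m x * (if r x ≤ R then 1 else 0) := by
  rw [sum_chainVerts_chainMass]
  set f : X → ℝ := fun x => if r x ≤ R then 1 else 0 with hf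
  have hf0 : ∀ x, 0 ≤ f x := fun x => by simp only [hf]; split_ifs <;> simp
  have hint : ∑ x ∈ S, ∑ y ∈ S, b x y * (r x - r y) ^ 2 / (n + 1) *
        ∑ i ∈ Finset.range n,
          (if chainExtend r 0 n r (chainPoint n x y (i + 1)) ≤ R then (1 : ℝ) else 0)
      ≤ ∑ x ∈ S, ∑ y ∈ S, b x y * (r x - r y) ^ 2 * (f x + f y) := by
    refine Finset.sum_le_sum fun x _ => Finset.sum_le_sum fun y _ => ?_
    have hbd : 0 ≤ b x y * (r x - r y) ^ 2 := mul_nonneg (hb x y) (sq_nonneg _)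
    have hs : ∑ i ∈ Finset.range n,
          (if chainExtend r 0 n r (chainPoint n x y (i + 1)) ≤ R then (1 : ℝ) else 0)
        ≤ (n + 1) * (f x + f y) := by
      calc _ ≤ ∑ i ∈ Finset.range n, (f x + f y) := by
            refine Finset.sum_le_sum fun i hi => ?_
            split_ifs with h
            · have := (min_le_chainExtend_zero r
                (by have := Finset.mem_range.1 hi; omega) x y).trans h
              rcases min_le_iff.1 this with h | h
              · linarith [hf0 y, show f x = 1 from if_pos h]
              · linarith [hf0 x, show f y = 1 from if_pos h]
            · exact add_nonneg (hf0 x) (hf0 y)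
        _ = n * (f x + f y) := by simp [mul_add]
        _ ≤ _ := by
          have := add_nonneg (hf0 x) (hf0 y)
          gcongr
          linarith
    calc _ ≤ b x y * (r x - r y) ^ 2 / (n + 1) * ((n + 1) * (f x + f y)) := by gcongr
      _ = _ := by field_simp
  rw [sum_symm_mul_add S (fun x y => by rw [hb_symm]; ring) f] at hint
  have h2 : ∑ x ∈ S, f x * ∑ y ∈ S, b x y * (r x - r y) ^ 2 ≤ ∑ x ∈ S, m x * f x :=
    Finset.sum_le_sum fun x hx => by
      rw [mul_comm (m x)]
      exact mul_le_mul_of_nonneg_left (hintr x hx) (hf0 x)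
  have h3 : ∑ x ∈ S, m x * (if chainExtend r 0 n r (Sum.inl x) ≤ R then (1 : ℝ) else 0)
      = ∑ x ∈ S, m x * f x := rfl
  linarith

theorem isNetworkSubsolution_subdivision {m : X → ℝ} {b : X → X → ℝ} {r u : X → ℝ}
    {S : Finset X} {c ℓ₀ Rmax D h : ℝ} {n : ℕ} (hc : 0 ≤ c)
    (hm : ∀ x, 0 ≤ m x) (hb_symm : ∀ x y, b x y = b y x) (hb : ∀ x y, 0 ≤ b x y)
    (hintr : ∀ x ∈ S, ∑ y ∈ S, b x y * (r x - r y) ^ 2 ≤ m x)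
    (hD : ∀ x ∈ S, ∀ y ∈ S, |r y - r x| ≤ D) (hh : D ≤ h * (n + 1))
    (hu : ∀ x ∈ S, ℓ₀ < u x → r x < Rmax → 2 * c * m x ≤ ∑ y ∈ S, b x y * (u y - u x)) :
    IsNetworkSubsolution (chainVerts S n) (S ×ˢ S ×ˢ Finset.range (n + 1))
      (fun e => chainPoint n e.1 e.2.1 e.2.2) (fun e => chainPoint n e.1 e.2.1 (e.2.2 + 1))
      (fun e => (n + 1) * b e.1 e.2.1 / 2) (chainMass m b r n) (chainExtend r 0 n r)
      (chainExtend r c n u) c ℓ₀ Rmax h where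
  cond_nonneg e _ := by
    have := hb e.1 e.2.1
    positivity
  mass_nonneg p _ := chainMass_nonneg hm hb r n p
  mesh e he := by
    simp only [Finset.mem_product, Finset.mem_range] at he
    rw [chainExtend_link r 0 r he.2.2]
    have hn : 0 < (n : ℝ) + 1 := by positivity
    simp only [zero_mul, zero_div, add_zero]
    rw [abs_div, abs_of_pos hn, div_le_iff₀ hn]
    exact (hD _ he.1 _ he.2.1).trans hh
  intrinsic f hf := by
    rw [sum_chainVerts_chainMass, Finset.sum_product]
    have hn : 0 < (n : ℝ) + 1 := by positivity
    have hchain : ∀ x ∈ S, ∑ e ∈ S ×ˢ Finset.range (n + 1), (n + 1) * b x e.1 / 2 *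
          (chainExtend r 0 n r (chainPoint n x e.1 (e.2 + 1))
            - chainExtend r 0 n r (chainPoint n x e.1 e.2)) ^ 2 *
          (f (chainPoint n x e.1 e.2) + f (chainPoint n x e.1 (e.2 + 1)))
        ≤ ∑ y ∈ S, (1 / 2 * (b x y * (r x - r y) ^ 2 * (f (Sum.inl x) + f (Sum.inl y)))
          + b x y * (r x - r y) ^ 2 / (n + 1) *
            ∑ i ∈ Finset.range n, f (chainPoint n x y (i + 1))) := by
      intro x _
      rw [Finset.sum_product]
      refine Finset.sum_le_sum fun y _ => ?_
      have heq : ∀ i ∈ Finset.range (n + 1), (n + 1) * b x y / 2 *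
          (chainExtend r 0 n r (chainPoint n x y (i + 1))
            - chainExtend r 0 n r (chainPoint n x y i)) ^ 2 *
          (f (chainPoint n x y i) + f (chainPoint n x y (i + 1)))
          = b x y * (r x - r y) ^ 2 / (2 * (n + 1)) *
            (f (chainPoint n x y i) + f (chainPoint n x y (i + 1))) := by
        intro i hi
        rw [chainExtend_link r 0 r (Finset.mem_range.1 hi)]
        field_simp
        ring
      rw [Finset.sum_congr rfl heq, ← Finset.mul_sum,
        sum_range_links (fun i => f (chainPoint n x y i)), chainPoint_zero, chainPoint_last]
      have hbd : 0 ≤ b x y * (r x - r y) ^ 2 := mul_nonneg (hb x y) (sq_nonneg _)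
      have h1 : b x y * (r x - r y) ^ 2 / (2 * (n + 1)) ≤ 1 / 2 * (b x y * (r x - r y) ^ 2) := by
        rw [div_le_iff₀ (by positivity)]
        nlinarith [mul_nonneg hbd (Nat.cast_nonneg (α := ℝ) n)]
      have h2 := mul_le_mul_of_nonneg_right h1 (add_nonneg (hf (Sum.inl x)) (hf (Sum.inl y)))
      have h3 : b x y * (r x - r y) ^ 2 / (2 * (n + 1)) * (2 *
          ∑ i ∈ Finset.range n, f (chainPoint n x y (i + 1)))
          = b x y * (r x - r y) ^ 2 / (n + 1) *
            ∑ i ∈ Finset.range n, f (chainPoint n x y (i + 1)) := by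
        field_simp
      rw [mul_add, h3]
      linarith
    refine (Finset.sum_le_sum hchain).trans ?_
    simp only [Finset.sum_add_distrib, ← Finset.mul_sum]
    rw [sum_symm_mul_add S (fun x y => by rw [hb_symm]; ring) fun x => f (Sum.inl x)]
    have h2 : ∑ x ∈ S, f (Sum.inl x) * ∑ y ∈ S, b x y * (r x - r y) ^ 2
        ≤ ∑ x ∈ S, m x * f (Sum.inl x) :=
      Finset.sum_le_sum fun x hx => by
        rw [mul_comm (m x)]
        exact mul_le_mul_of_nonneg_left (hintr x hx) (hf _)
    linarith
  subsolution g hg hsupp := by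
    rw [sum_chainVerts_chainMass, Finset.sum_product]
    have hn : 0 < (n : ℝ) + 1 := by positivity
    have hchain : ∀ x ∈ S, ∑ e ∈ S ×ˢ Finset.range (n + 1), (n + 1) * b x e.1 / 2 *
          ((chainExtend r c n u (chainPoint n x e.1 (e.2 + 1))
            - chainExtend r c n u (chainPoint n x e.1 e.2)) *
          (g (chainPoint n x e.1 (e.2 + 1)) - g (chainPoint n x e.1 e.2)))
        ≤ ∑ y ∈ S, (1 / 2 * (b x y * ((u y - u x) * (g (Sum.inl y) - g (Sum.inl x))))
          + c / 2 * (b x y * (r x - r y) ^ 2 * (g (Sum.inl x) + g (Sum.inl y)))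
          - c * (b x y * (r x - r y) ^ 2 / (n + 1) *
            ∑ i ∈ Finset.range n, g (chainPoint n x y (i + 1)))) := by
      intro x _
      rw [Finset.sum_product]
      refine Finset.sum_le_sum fun y _ => ?_
      have heq : ∀ i ∈ Finset.range (n + 1), (n + 1) * b x y / 2 *
          ((chainExtend r c n u (chainPoint n x y (i + 1))
            - chainExtend r c n u (chainPoint n x y i)) *
          (g (chainPoint n x y (i + 1)) - g (chainPoint n x y i)))
          = 1 / 2 * (b x y * (u y - u x)) *
              (g (chainPoint n x y (i + 1)) - g (chainPoint n x y i))
            + c * (b x y * (r x - r y) ^ 2) / (2 * (n + 1)) *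
              ((2 * i + 1 - ((n : ℝ) + 1)) *
                (g (chainPoint n x y (i + 1)) - g (chainPoint n x y i))) := by
        intro i hi
        rw [chainExtend_link r c u (Finset.mem_range.1 hi)]
        field_simp
      rw [Finset.sum_congr rfl heq, Finset.sum_add_distrib, ← Finset.mul_sum, ← Finset.mul_sum,
        Finset.sum_range_sub (fun i => g (chainPoint n x y i)),
        sum_range_weighted_links (fun i => g (chainPoint n x y i)), chainPoint_zero,
        chainPoint_last]
      have hbd : 0 ≤ c * (b x y * (r x - r y) ^ 2) :=
        mul_nonneg hc (mul_nonneg (hb x y) (sq_nonneg _))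
      have hgg : 0 ≤ g (Sum.inl x) + g (Sum.inl y) := add_nonneg (hg _) (hg _)
      have h1 : c * (b x y * (r x - r y) ^ 2) / (2 * (n + 1)) * n
          ≤ c / 2 * (b x y * (r x - r y) ^ 2) := by
        rw [div_mul_eq_mul_div, div_le_iff₀ (by positivity)]
        nlinarith
      have h2 := mul_le_mul_of_nonneg_right h1 hgg
      have h3 : c * (b x y * (r x - r y) ^ 2) / (2 * (n + 1)) * (2 *
          ∑ i ∈ Finset.range n, g (chainPoint n x y (i + 1)))
          = c * (b x y * (r x - r y) ^ 2 / (n + 1) *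
            ∑ i ∈ Finset.range n, g (chainPoint n x y (i + 1))) := by
        field_simp
      rw [mul_sub (c * _ / _), h3]
      linarith
    have hsum := Finset.sum_le_sum hchain
    simp only [Finset.sum_add_distrib, Finset.sum_sub_distrib, ← Finset.mul_sum] at hsum
    rw [sum_symm_mul_add S (fun x y => by rw [hb_symm]; ring) fun x => g (Sum.inl x),
      sum_symm_mul_sub_mul_sub S hb_symm u fun x => g (Sum.inl x)] at hsum
    have h2 : ∑ x ∈ S, g (Sum.inl x) * ∑ y ∈ S, b x y * (r x - r y) ^ 2
        ≤ ∑ x ∈ S, m x * g (Sum.inl x) :=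
      Finset.sum_le_sum fun x hx => by
        rw [mul_comm (m x)]
        exact mul_le_mul_of_nonneg_left (hintr x hx) (hg _)
    have h3 : 2 * c * ∑ x ∈ S, m x * g (Sum.inl x)
        ≤ ∑ x ∈ S, g (Sum.inl x) * ∑ y ∈ S, b x y * (u y - u x) := by
      rw [Finset.mul_sum]
      refine Finset.sum_le_sum fun x hx => ?_
      by_cases hgx : g (Sum.inl x) = 0
      · simp [hgx]
      · obtain ⟨h4, h5⟩ := hsupp _ hgx
        have := mul_le_mul_of_nonneg_left (hu x hx h4 h5) (hg (Sum.inl x))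
        linarith
    have h4 := mul_le_mul_of_nonneg_left h2 hc
    linarith

end Subdivision

section VolumeGrowth

open Filter Topology MeasureTheory

theorem exists_le_sum_min_of_lintegral_eq_top {f : ℝ → ℝ} {k₀ : ℕ} (hk₀ : 1 ≤ k₀)
    (hmono : ∀ r s, 2 ^ k₀ ≤ r → r ≤ s → f r ≤ f s) (hpos : ∀ r, 2 ^ k₀ ≤ r → 0 < f r)
    (hint : ∫⁻ r in Set.Ioi (2 ^ (k₀ + 1)), ENNReal.ofReal (r / f r) = ⊤) (B : ℝ) :
    ∃ n : ℕ, B ≤ ∑ i ∈ Finset.range n,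
      min 1 ((2 ^ (k₀ + i) - 1) ^ 2 / (32 * f (2 ^ (k₀ + i + 1)))) := by
  by_contra! hB
  set a : ℕ → ℝ := fun i => (2 ^ (k₀ + i) - 1) ^ 2 / (32 * f (2 ^ (k₀ + i + 1))) with ha
  have hfpos : ∀ i, 0 < f (2 ^ (k₀ + i + 1)) := fun i =>
    hpos _ (pow_le_pow_right₀ (by norm_num) (by omega))
  have ha0 : ∀ i, 0 ≤ a i := fun i => by
    have := hfpos i
    positivity
  have hτ : Summable fun i => min 1 (a i) :=
    summable_of_sum_range_le (fun i => le_min zero_le_one (ha0 i)) fun n => (hB n).le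
  have hev : (fun i => min 1 (a i)) =ᶠ[cofinite] a := by
    rw [Nat.cofinite_eq_atTop]
    filter_upwards [hτ.tendsto_atTop_zero.eventually (gt_mem_nhds zero_lt_one)] with i hi
    exact min_eq_right (by_contra fun h => by
      rw [min_eq_left (not_le.1 h).le] at hi
      exact lt_irrefl _ hi)
  have hsum : Summable fun i => 1024 * a i := ((summable_congr_cofinite hev).1 hτ).mul_left _
  refine hsum.tsum_ofReal_ne_top ?_
  rw [eq_top_iff, ← hint]
  have hcover : Set.Ioi ((2 : ℝ) ^ (k₀ + 1))
      ⊆ ⋃ i : ℕ, Set.Ico ((2 : ℝ) ^ (k₀ + i + 1)) (2 ^ (k₀ + i + 2)) := by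
    intro r hr
    have h1 : (1 : ℝ) ≤ r := (one_le_pow₀ (by norm_num : (1 : ℝ) ≤ 2)).trans (le_of_lt hr)
    obtain ⟨n, hn1, hn2⟩ := exists_nat_pow_near h1 (by norm_num : (1 : ℝ) < 2)
    have : k₀ + 1 < n + 1 := (pow_lt_pow_iff_right₀ (by norm_num)).1 (lt_trans hr hn2)
    obtain ⟨i, rfl⟩ : ∃ i, n = k₀ + i + 1 := ⟨n - k₀ - 1, by omega⟩
    exact Set.mem_iUnion.2 ⟨i, hn1, hn2⟩
  refine (lintegral_mono_set hcover).trans ((lintegral_iUnion_le _ _).trans ?_)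
  refine ENNReal.tsum_le_tsum fun i => ?_
  have hf := hfpos i
  calc ∫⁻ r in Set.Ico ((2 : ℝ) ^ (k₀ + i + 1)) (2 ^ (k₀ + i + 2)), ENNReal.ofReal (r / f r)
      ≤ ∫⁻ _ in Set.Ico ((2 : ℝ) ^ (k₀ + i + 1)) (2 ^ (k₀ + i + 2)),
          ENNReal.ofReal (2 ^ (k₀ + i + 2) / f (2 ^ (k₀ + i + 1))) := by
        refine setLIntegral_mono' measurableSet_Ico fun r hr => ENNReal.ofReal_le_ofReal ?_
        have := hmono _ r (pow_le_pow_right₀ (by norm_num) (by omega)) hr.1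
        have := hr.2
        gcongr
    _ = ENNReal.ofReal (2 ^ (k₀ + i + 2) / f (2 ^ (k₀ + i + 1)) *
          (2 ^ (k₀ + i + 2) - 2 ^ (k₀ + i + 1))) := by
        rw [setLIntegral_const, Real.volume_Ico, ← ENNReal.ofReal_mul (by positivity)]
    _ ≤ ENNReal.ofReal (1024 * a i) := by
        refine ENNReal.ofReal_le_ofReal ?_
        have hq : (2 : ℝ) ≤ 2 ^ (k₀ + i) := by
          calc (2 : ℝ) = 2 ^ 1 := by norm_num
            _ ≤ 2 ^ (k₀ + i) := pow_le_pow_right₀ (by norm_num) (by omega)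
        simp only [ha]
        rw [pow_add 2 (k₀ + i) 2]
        have he : (2 : ℝ) ^ (k₀ + i + 1) = 2 * 2 ^ (k₀ + i) := by ring
        generalize f (2 ^ (k₀ + i + 1)) = F at hf ⊢
        rw [he]
        generalize (2 : ℝ) ^ (k₀ + i) = q at hq ⊢
        have e1 : q * 2 ^ 2 / F * (q * 2 ^ 2 - 2 * q) = 8 * q ^ 2 / F := by ring
        have e2 : 1024 * ((q - 1) ^ 2 / (32 * F)) = 32 * (q - 1) ^ 2 / F := by
          field_simp; ring
        rw [e1, e2]
        exact div_le_div_of_nonneg_right (by nlinarith) hf.le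

theorem tsum_sublevel_eq_sum {X : Type*} {m r : X → ℝ} (hfin : ∀ R, {y | r y ≤ R}.Finite) (R : ℝ) :
    ∑' y : ({y | r y ≤ R} : Set X), m y = ∑ x ∈ (hfin R).toFinset, m x := by
  rw [← Finset.tsum_subtype', Set.Finite.coe_toFinset]

theorem sum_le_tsum_ball {X : Type*} {m r : X → ℝ} (hm : ∀ x, 0 ≤ m x)
    (hfin : ∀ R, {y | r y ≤ R}.Finite) (S : Finset X) (R : ℝ) :
    ∑ x ∈ S, m x * (if r x ≤ R then 1 else 0) ≤ ∑' y : ({y | r y ≤ R} : Set X), m y := by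
  rw [tsum_sublevel_eq_sum hfin]
  simp only [mul_ite, mul_one, mul_zero]
  rw [← Finset.sum_filter]
  exact Finset.sum_le_sum_of_subset_of_nonneg (fun x hx => by simpa using (Finset.mem_filter.1 hx).2)
    fun x _ _ => hm x

theorem monotone_tsum_ball {X : Type*} {m r : X → ℝ} (hm : ∀ x, 0 ≤ m x)
    (hfin : ∀ R, {y | r y ≤ R}.Finite) :
    Monotone fun R => ∑' y : ({y | r y ≤ R} : Set X), m y := by
  intro R R' h
  simp only [tsum_sublevel_eq_sum hfin]
  refine Finset.sum_le_sum_of_subset_of_nonneg (fun x hx => ?_) fun x _ _ => hm x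
  exact (hfin R').mem_toFinset.2 (le_trans ((hfin R).mem_toFinset.1 hx) h)

theorem mul_exp_neg_le {V L τ q : ℝ} (hV : 1 < V) (hq : 2 ≤ q) (hL : L = q - 1) (hτ : 0 < τ)
    (hτ1 : τ ≤ 1) (hτV : τ ≤ L ^ 2 / (32 * Real.log V)) :
    3 * V * Real.exp (-(L ^ 2 / (16 * τ))) ≤ 384 * q⁻¹ := by
  have hlog := Real.log_pos hV
  have hL0 : 0 < L := by linarith
  set x := L ^ 2 / (32 * τ) with hx
  have hx1 : Real.log V ≤ x := by
    rw [le_div_iff₀ (by positivity)] at hτV ⊢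
    linarith
  have hx2 : q / 128 ≤ x := by
    rw [hx, le_div_iff₀ (by positivity)]
    have : q / 128 * (32 * τ) ≤ q / 128 * (32 * 1) := by gcongr
    subst hL
    nlinarith
  have hexp : Real.exp (-(L ^ 2 / (16 * τ))) = Real.exp (-x) * Real.exp (-x) := by
    rw [← Real.exp_add, hx]; congr 1; field_simp; ring
  have h1 : V * Real.exp (-x) ≤ 1 := by
    rw [Real.exp_neg, ← div_eq_mul_inv, div_le_one (Real.exp_pos _)]
    exact (Real.log_le_iff_le_exp (by linarith)).1 hx1
  have h2 : Real.exp (-x) ≤ 128 * q⁻¹ := by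
    rw [Real.exp_neg]
    calc (Real.exp x)⁻¹ ≤ (q / 128)⁻¹ := by
          gcongr
          linarith [Real.add_one_le_exp x]
      _ = 128 * q⁻¹ := by rw [inv_div]; ring
  rw [hexp]
  calc 3 * V * (Real.exp (-x) * Real.exp (-x)) = 3 * (V * Real.exp (-x)) * Real.exp (-x) := by ring
    _ ≤ 3 * 1 * (128 * q⁻¹) := by gcongr
    _ = _ := by ring

theorem sum_geometric_tail_le (k₀ n : ℕ) :
    ∑ i ∈ Finset.range n, 384 * ((2 : ℝ) ^ (k₀ + i))⁻¹ ≤ 768 * ((2 : ℝ) ^ k₀)⁻¹ := by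
  have h : ∀ n : ℕ, ∑ i ∈ Finset.range n, 384 * ((2 : ℝ) ^ (k₀ + i))⁻¹
      = 768 * ((2 : ℝ) ^ k₀)⁻¹ - 768 * ((2 : ℝ) ^ (k₀ + n))⁻¹ := by
    intro n
    induction n with
    | zero => simp
    | succ n ih =>
      rw [Finset.sum_range_succ, ih, ← add_assoc, pow_succ, mul_inv]
      ring
  rw [h]
  have : (0 : ℝ) ≤ 768 * (2 ^ (k₀ + n))⁻¹ := by positivity
  linarith

/-- If `Δu ≥ 2c` on `{u > ℓ₀}` for a function `u` that is bounded above, then Grigor'yan's volume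
growth condition for the balls of an intrinsic radius function forces `u ≤ ℓ₀`. -/
theorem le_of_volume_growth {X : Type*} {m : X → ℝ} {b : X → X → ℝ} {r u : X → ℝ} {s c ℓ₀ K : ℝ}
    (hm : ∀ x, 0 < m x) (hb_symm : ∀ x y, b x y = b y x) (hb : ∀ x y, 0 ≤ b x y)
    (hr : ∀ x, 0 ≤ r x) (hfin : ∀ R, {y | r y ≤ R}.Finite)
    (hintr : ∀ (S : Finset X) x, ∑ y ∈ S, b x y * (r x - r y) ^ 2 ≤ m x)
    (hs : ∀ x y, 0 < b x y → r y ≤ r x + s) (hc : 0 < c)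
    (hu : ∀ x, ℓ₀ < u x → 2 * c * m x ≤ ∑' y, b x y * (u y - u x)) (hK : ∀ x, u x ≤ ℓ₀ + K)
    (hV : Tendsto (fun R => ∑' y : ({y | r y ≤ R} : Set X), m y) atTop atTop)
    (hvol : ∀ r₀ : ℝ,
      (∀ R, r₀ ≤ R → 0 < Real.log (∑' y : ({y | r y ≤ R} : Set X), m y)) →
      ∫⁻ R in Set.Ioi r₀,
        ENNReal.ofReal (R / Real.log (∑' y : ({y | r y ≤ R} : Set X), m y)) = ⊤)
    (z : X) : u z ≤ ℓ₀ := by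
  by_contra! hz
  have hm0 : ∀ x, 0 ≤ m x := fun x => (hm x).le
  have hK0 : 0 ≤ K := by linarith [hK z]
  have hmono := monotone_tsum_ball hm0 hfin
  have hball := sum_le_tsum_ball hm0 hfin
  set V : ℝ → ℝ := fun R => ∑' y : ({y | r y ≤ R} : Set X), m y with hVdef
  have hpow : Tendsto (fun k : ℕ => (2 : ℝ) ^ k) atTop atTop :=
    tendsto_pow_atTop_atTop_of_one_lt (by norm_num)
  have hsmall : Tendsto (fun k : ℕ => 19 * K ^ 2 * (768 * ((2 : ℝ) ^ k)⁻¹)) atTop (𝓝 0) := by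
    have := (hpow.inv_tendsto_atTop.const_mul 768).const_mul (19 * K ^ 2)
    simpa using this
  have hE : 0 < m z * (u z - ℓ₀) ^ 2 := mul_pos (hm z) (pow_pos (by linarith) 2)
  obtain ⟨k₀, hk₀, hV1, hrz, herr⟩ : ∃ k₀ : ℕ, 2 ≤ k₀ ∧ 1 < V (2 ^ k₀) ∧ r z ≤ 2 ^ k₀ ∧
      19 * K ^ 2 * (768 * ((2 : ℝ) ^ k₀)⁻¹) < m z * (u z - ℓ₀) ^ 2 :=
    ((eventually_ge_atTop 2).and (((hV.comp hpow).eventually_gt_atTop 1).and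
      ((hpow.eventually_ge_atTop (r z)).and (hsmall.eventually (gt_mem_nhds hE))))).exists
  have hV1' : ∀ R, 2 ^ k₀ ≤ R → 1 < V R := fun R hR => hV1.trans_le (hmono hR)
  have hlog : ∀ R, 2 ^ k₀ ≤ R → 0 < Real.log (V R) := fun R hR => Real.log_pos (hV1' R hR)
  obtain ⟨n, hn⟩ := exists_le_sum_min_of_lintegral_eq_top (f := fun R => Real.log (V R))
    (by omega : 1 ≤ k₀)
    (fun R R' h h' => Real.log_le_log (by linarith [hV1' R h]) (hmono h')) hlog
    (hvol _ fun R hR => hlog R ((pow_le_pow_right₀ (by norm_num) (by omega)).trans hR)) (K / c)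
  set τ : ℕ → ℝ := fun k => min 1 ((2 ^ k - 1) ^ 2 / (32 * Real.log (V (2 ^ (k + 1))))) with hτdef
  have h4 : ∀ k, k₀ ≤ k → (4 : ℝ) ≤ 2 ^ k := fun k hk => by
    calc (4 : ℝ) = 2 ^ 2 := by norm_num
      _ ≤ 2 ^ k := pow_le_pow_right₀ (by norm_num) (by omega)
  have hpow_le : ∀ k, k₀ ≤ k → (2 : ℝ) ^ k₀ ≤ 2 ^ (k + 1) := fun k hk =>
    pow_le_pow_right₀ (by norm_num) (by omega)
  have hτ : ∀ k, k₀ ≤ k → 0 < τ k := fun k hk => by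
    have h1 := hlog _ (hpow_le k hk)
    have h2 : (0 : ℝ) < 2 ^ k - 1 := by linarith [h4 k hk]
    exact lt_min one_pos (by positivity)
  set Rmax : ℝ := 2 ^ (k₀ + n) with hRmax
  set D := Rmax + |s| with hD
  set S : Finset X := (hfin D).toFinset with hS
  have hmemS : ∀ y, y ∈ S ↔ r y ≤ D := fun y => by simp [hS]
  have hD0 : 0 ≤ D := by positivity
  obtain ⟨h, hh0, hh1, hhε, hhτ⟩ : ∃ h : ℝ, 0 < h ∧ h ≤ 1 ∧
      (∀ i < n, h ^ 2 ≤
        2 * Real.exp (-((2 ^ (k₀ + i) - 1) ^ 2 / (16 * τ (k₀ + i)))) * τ (k₀ + i) ^ 2) ∧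
      ∀ i < n, h * (2 * (2 ^ (k₀ + i) - 1) + 3) ≤ τ (k₀ + i) := by
    have e1 : ∀ᶠ h : ℝ in 𝓝[>] 0, ∀ i ∈ Set.Iio n, h ^ 2 ≤
        2 * Real.exp (-((2 ^ (k₀ + i) - 1) ^ 2 / (16 * τ (k₀ + i)))) * τ (k₀ + i) ^ 2 := by
      rw [eventually_all_finite (Set.finite_Iio n)]
      intro i _
      have hpos : 0 < 2 * Real.exp (-((2 ^ (k₀ + i) - 1) ^ 2 / (16 * τ (k₀ + i)))) *
          τ (k₀ + i) ^ 2 := by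
        have := hτ (k₀ + i) (by omega)
        positivity
      have ht : Tendsto (fun h : ℝ => h ^ 2) (𝓝[>] 0) (𝓝 0) :=
        tendsto_nhdsWithin_of_tendsto_nhds ((continuous_pow 2).tendsto' 0 0 (by simp))
      exact ht.eventually (ge_mem_nhds hpos)
    have e2 : ∀ᶠ h : ℝ in 𝓝[>] 0, ∀ i ∈ Set.Iio n,
        h * (2 * (2 ^ (k₀ + i) - 1) + 3) ≤ τ (k₀ + i) := by
      rw [eventually_all_finite (Set.finite_Iio n)]
      intro i _
      have ht : Tendsto (fun h : ℝ => h * (2 * (2 ^ (k₀ + i) - 1) + 3)) (𝓝[>] 0) (𝓝 0) :=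
        tendsto_nhdsWithin_of_tendsto_nhds ((continuous_mul_const _).tendsto' 0 0 (by simp))
      exact ht.eventually (ge_mem_nhds (hτ (k₀ + i) (by omega)))
    have e3 : ∀ᶠ h : ℝ in 𝓝[>] 0, h ≤ 1 :=
      tendsto_nhdsWithin_of_tendsto_nhds tendsto_id |>.eventually (ge_mem_nhds one_pos)
    obtain ⟨h, ⟨⟨hpos, h3⟩, h1⟩, h2⟩ := (((eventually_mem_nhdsWithin.and e3).and e1).and e2).exists
    exact ⟨h, hpos, h3, h1, h2⟩
  obtain ⟨N, hN⟩ := exists_nat_ge (D / h)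
  have hnet := isNetworkSubsolution_subdivision (m := m) (b := b) (r := r) (u := u) (S := S)
    (c := c) (ℓ₀ := ℓ₀) (Rmax := Rmax) (D := D) (h := h) (n := N) hc.le hm0 hb_symm hb
    (fun x _ => hintr S x)
    (fun x hx y hy => by
      rw [abs_sub_le_iff]
      constructor <;> linarith [hr x, hr y, (hmemS x).1 hx, (hmemS y).1 hy])
    (by
      rw [div_le_iff₀ hh0] at hN
      linarith)
    (fun x _ hux hrx => by
      have hts : ∑' y, b x y * (u y - u x) = ∑ y ∈ S, b x y * (u y - u x) := by
        refine tsum_eq_sum fun y hy => ?_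
        have hby : b x y = 0 := by
          by_contra hne
          refine hy ((hmemS y).2 ?_)
          linarith [hs x y ((hb x y).lt_of_ne (Ne.symm hne)), le_abs_self s]
        rw [hby, zero_mul]
      rw [← hts]
      exact hu x hux)
  have hvK : ∀ p ∈ chainVerts S N, chainExtend r c N u p ≤ ℓ₀ + K :=
    chainExtend_le r hc.le fun x _ => hK x
  have hiter := hnet.levelEnergy_iterate (K := K) (k₀ := k₀) (n := n) (τ := τ)
    (M := fun k => 3 * V (2 ^ (k + 1))) (δ := fun k => 384 * ((2 : ℝ) ^ k)⁻¹) hc.le hk₀ le_rfl hτ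
    (fun k => min_le_left _ _) hh1 hhε hhτ (fun p hp => by linarith [hvK p hp]) hK0
    (fun k => (sum_chainMass_ball_le hb_symm hb (fun x _ => hintr S x) N _).trans
      (mul_le_mul_of_nonneg_left (hball S _) (by norm_num)))
    (fun k hk => mul_exp_neg_le (hV1' _ (hpow_le k hk)) (by linarith [h4 k hk]) rfl (hτ k hk)
      (min_le_left _ _) (min_le_right _ _))
    n le_rfl
  have hzero : levelEnergy (chainVerts S N) (chainMass m b r N) (chainExtend r 0 N r)
      (chainExtend r c N u) (ℓ₀ + c * ∑ i ∈ Finset.range n, τ (k₀ + i)) (2 ^ (k₀ + n)) = 0 := by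
    refine Finset.sum_eq_zero fun p hp => ?_
    have hle : K ≤ c * ∑ i ∈ Finset.range n, τ (k₀ + i) := by
      rw [div_le_iff₀ hc] at hn
      linarith
    rw [max_eq_right (by linarith [hvK p hp])]
    simp
  have hstart : m z * (u z - ℓ₀) ^ 2 ≤ levelEnergy (chainVerts S N) (chainMass m b r N)
      (chainExtend r 0 N r) (chainExtend r c N u) ℓ₀ (2 ^ k₀) := by
    have hzS : z ∈ S := (hmemS z).2 (hrz.trans (by
      have : (2 : ℝ) ^ k₀ ≤ Rmax := pow_le_pow_right₀ (by norm_num) (by omega)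
      linarith [abs_nonneg s]))
    have hsingle := Finset.single_le_sum (f := fun p => chainMass m b r N p *
        (if chainExtend r 0 N r p ≤ 2 ^ k₀ then max (chainExtend r c N u p - ℓ₀) 0 ^ 2 else 0))
      (s := chainVerts S N)
      (fun p _ => mul_nonneg (chainMass_nonneg hm0 hb r N p) (by split_ifs <;> positivity))
      (show Sum.inl z ∈ chainVerts S N by simpa [chainVerts] using hzS)
    refine le_trans (le_of_eq ?_) hsingle
    simp [chainMass, chainExtend, hrz, max_eq_left (by linarith : 0 ≤ u z - ℓ₀)]
  have hgeom := mul_le_mul_of_nonneg_left (sum_geometric_tail_le k₀ n)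
    (by positivity : 0 ≤ 19 * K ^ 2)
  linarith

end VolumeGrowth

theorem stochastic_completeness_of_volume_growth
    {X : Type*} [Countable X] [Infinite X]
    (m : X → ℝ) (hm : ∀ x, 0 < m x)
    (b : X → X → ℝ) (hb_symm : ∀ x y, b x y = b y x)
    (hb_nonneg : ∀ x y, 0 ≤ b x y) (hb_diag : ∀ x, b x x = 0)
    (hb_sum : ∀ x, Summable fun y => b x y)
    (hloc : ∀ x : X, {y | 0 < b x y}.Finite)
    (hconn : ∀ x y : X, Relation.ReflTransGen (fun u v : X => 0 < b u v) x y)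
    (ρ : X → X → ℝ)
    (hnonneg : ∀ x y, 0 ≤ ρ x y) (hrefl : ∀ x, ρ x x = 0)
    (hsymm : ∀ x y, ρ x y = ρ y x)
    (htriangle : ∀ x y z, ρ x z ≤ ρ x y + ρ y z)
    -- ρ is intrinsic:
    (hintr : ∀ x, ∑' y, ENNReal.ofReal (b x y * (ρ x y) ^ 2) ≤ ENNReal.ofReal (m x))
    -- (B): all distance balls are finite:
    (hB : ∀ (x : X) (r : ℝ), {y | ρ x y ≤ r}.Finite)
    -- (J): finite jump size:
    (hJ : ∃ s : ℝ, ∀ x y, 0 < b x y → ρ x y ≤ s)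
    (x : X)
    (hballs : Filter.Tendsto (fun r : ℝ => volBall m ρ x r) Filter.atTop Filter.atTop)
    (hvol : ∀ r₀ : ℝ, (∀ r, r₀ ≤ r → 0 < Real.log (volBall m ρ x r)) →
      ∫⁻ r in Set.Ioi r₀, ENNReal.ofReal (r / Real.log (volBall m ρ x r)) = ⊤) :
    ∀ lam : ℝ, lam < 0 →
      ∀ u : X → ℝ, (∃ M : ℝ, ∀ z, |u z| ≤ M) →
        (∀ z, lap m b u z = lam * u z) → ∀ z, u z = 0 := by
  intro lam hlam
  have hintr' : ∀ (S : Finset X) y, ∑ z ∈ S, b y z * (ρ x y - ρ x z) ^ 2 ≤ m y := by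
    intro S y
    have h1 : ∑ z ∈ S, b y z * ρ y z ^ 2 ≤ m y := by
      rw [← ENNReal.ofReal_le_ofReal_iff (hm y).le, ENNReal.ofReal_sum_of_nonneg
        fun z _ => mul_nonneg (hb_nonneg y z) (sq_nonneg _)]
      exact (ENNReal.sum_le_tsum S).trans (hintr y)
    refine (Finset.sum_le_sum fun z _ => ?_).trans h1
    refine mul_le_mul_of_nonneg_left (sq_le_sq' ?_ ?_) (hb_nonneg y z)
    · linarith [htriangle x y z]
    · linarith [htriangle x z y, hsymm y z]
  obtain ⟨s, hs⟩ := hJ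
  have key : ∀ u : X → ℝ, (∃ M : ℝ, ∀ z, |u z| ≤ M) →
      (∀ z, lap m b u z = lam * u z) → ∀ z, u z ≤ 0 := by
    rintro u ⟨M, hM⟩ hlap z
    by_contra! hz
    have := le_of_volume_growth (m := m) (b := b) (r := ρ x) (u := u) (s := s)
      (c := -lam * u z / 4) (ℓ₀ := u z / 2) (K := M) hm hb_symm hb_nonneg (hnonneg x) (hB x)
      hintr' (fun y w h => by linarith [htriangle x y w, hs y w h])
      (by have := mul_pos (neg_pos.2 hlam) hz; linarith)
      (fun y hy => by
        have h1 : ∑' w, b y w * (u w - u y) = -lam * u y * m y := by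
          have h2 : ∑' w, b y w * (u y - u w) = lam * u y * m y := by
            rw [← hlap y, lap]
            field_simp [(hm y).ne']
          rw [show (fun w => b y w * (u w - u y)) = fun w => -(b y w * (u y - u w)) by
            funext w; ring, tsum_neg, h2]
          ring
        rw [h1]
        have h3 := mul_le_mul_of_nonneg_right
          (mul_le_mul_of_nonneg_left hy.le (neg_pos.2 hlam).le) (hm y).le
        linarith)
      (fun y => by linarith [le_abs_self (u y), hM y]) hballs hvol z
    linarith
  intro u hu hlap z
  refine le_antisymm (key u hu hlap z) ?_
  have hneg := key (fun z => -u z) (by simpa using hu) (fun z => by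
    have := hlap z
    simp only [lap] at this ⊢
    rw [show (fun y => b z y * (-u z - -u y)) = fun y => -(b z y * (u z - u y)) by
      funext y; ring, tsum_neg, mul_neg, this]
    ring) z
  linarith

end Stmt16
end

section
/- Let b be a graph over (X,m) and ρ an intrinsic metric. Define the isoperimetric constant α = inf{Area(∂W)/m(W) : W ⊆ X finite and nonempty}, where ∂W = {(x,y) ∈ W × (X∖W) : x ∼ y} and Area(∂W) = ∑_{(x,y)∈∂W} b(x,y) ρ(x,y). Then for every finitely supported f : X → ℝ, the Cheeger inequality (1/2) ∑_{x,y∈X} b(x,y)(f(x)−f(y))² ≥ (α²/2) ∑_{x∈X} f(x)² m(x) holds; i.e. the bottom of the spectrum of the associated Laplacian, λ₀(L) = inf over nonzero finitely supported f of 𝒬(f)/‖f‖₂², satisfies λ₀(L) ≥ α²/2. -/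
/-!
STATEMENT 17: Cheeger inequality with intrinsic metrics. With
`α = inf { Area(∂W)/m(W) : W ⊆ X finite nonempty }`, where
`Area(∂W) = ∑_{(x,y) ∈ ∂W} b(x,y) ρ(x,y)`, one has for every finitely supported `f`
`(1/2) ∑_{x,y} b(x,y)(f x - f y)² ≥ (α²/2) ∑_x f(x)² m(x)`; in particular the bottom
of the spectrum (the infimum of the Rayleigh quotients over nonzero finitely
supported functions) is at least `α²/2`.
-/

namespace Stmt17

/-- The boundary area `Area(∂W) = ∑_{(x,y) ∈ ∂W} b(x,y) ρ(x,y)`, where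
`∂W = {(x,y) ∈ W × (X∖W) : x ∼ y}`. -/
noncomputable def area {X : Type*} (b : X → X → ℝ) (ρ : X → X → ℝ) (W : Finset X) : ℝ :=
  ∑ x ∈ W, ∑' y,
    Set.indicator {y | y ∉ W ∧ 0 < b x y} (fun y => b x y * ρ x y) y

/-- The isoperimetric constant `α`. -/
noncomputable def cheeger {X : Type*} (m : X → ℝ) (b : X → X → ℝ)
    (ρ : X → X → ℝ) : ℝ :=
  sInf {t : ℝ | ∃ W : Finset X, W.Nonempty ∧ t = area b ρ W / ∑ x ∈ W, m x}

section Auxiliary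

variable {X : Type*}

lemma area_nonneg {b ρ : X → X → ℝ} (hb : ∀ x y, 0 ≤ b x y) (hρ : ∀ x y, 0 ≤ ρ x y)
    (W : Finset X) : 0 ≤ area b ρ W :=
  Finset.sum_nonneg fun x _ => tsum_nonneg fun y =>
    Set.indicator_nonneg (fun y _ => mul_nonneg (hb x y) (hρ x y)) y

lemma cheeger_nonneg {m : X → ℝ} {b ρ : X → X → ℝ} (hm : ∀ x, 0 < m x)
    (hb : ∀ x y, 0 ≤ b x y) (hρ : ∀ x y, 0 ≤ ρ x y) : 0 ≤ cheeger m b ρ := by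
  refine Real.sInf_nonneg ?_
  rintro t ⟨W, -, rfl⟩
  exact div_nonneg (area_nonneg hb hρ W) (Finset.sum_nonneg fun x _ => (hm x).le)

lemma cheeger_mul_le_area {m : X → ℝ} {b ρ : X → X → ℝ} (hm : ∀ x, 0 < m x)
    (hb : ∀ x y, 0 ≤ b x y) (hρ : ∀ x y, 0 ≤ ρ x y) {W : Finset X} (hW : W.Nonempty) :
    cheeger m b ρ * ∑ x ∈ W, m x ≤ area b ρ W := by
  rw [← le_div_iff₀ (Finset.sum_pos (fun x _ => hm x) hW)]
  refine csInf_le ⟨0, ?_⟩ ⟨W, hW, rfl⟩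
  rintro t ⟨W, -, rfl⟩
  exact div_nonneg (area_nonneg hb hρ W) (Finset.sum_nonneg fun x _ => (hm x).le)

lemma summable_mul_posPart_sub {g k : X → ℝ} (hg : ∀ x, 0 ≤ g x) (hk : ∀ y, 0 ≤ k y)
    (hks : Summable k) (x : X) : Summable fun y => k y * max (g x - g y) 0 := by
  refine Summable.of_nonneg_of_le (fun y => mul_nonneg (hk y) (le_max_right _ _))
    (fun y => ?_) (hks.mul_right (g x))
  exact mul_le_mul_of_nonneg_left (max_le (by linarith [hg y]) (hg x)) (hk y)

/-- The co-area inequality for a nonnegative function with support `W`, proved by peeling off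
the lowest level of the function. -/
lemma cheeger_mul_sum_le {m : X → ℝ} {b ρ : X → X → ℝ} (hm : ∀ x, 0 < m x)
    (hb : ∀ x y, 0 ≤ b x y) (hρ : ∀ x y, 0 ≤ ρ x y)
    (hs : ∀ x, Summable fun y => b x y * ρ x y) (W : Finset X) (g : X → ℝ)
    (hpos : ∀ x ∈ W, 0 < g x) (hzero : ∀ x ∉ W, g x = 0) :
    cheeger m b ρ * ∑ x ∈ W, g x * m x ≤
      ∑ x ∈ W, ∑' y, b x y * ρ x y * max (g x - g y) 0 := by
  classical
  induction W using Finset.strongInduction generalizing g with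
  | H W ih =>
  rcases W.eq_empty_or_nonempty with rfl | hW
  · simp
  obtain ⟨x₀, hx₀, hmin⟩ := W.exists_min_image g hW
  set c := g x₀ with hc
  have hcpos : 0 < c := hpos x₀ hx₀
  set W' := W.filter fun x => c < g x with hW'
  set g' : X → ℝ := fun x => if x ∈ W then g x - c else 0 with hg'
  have hg'0 : ∀ x, 0 ≤ g' x := fun x => by
    by_cases hx : x ∈ W
    · simpa [hg', hx] using hmin x hx
    · simp [hg', hx]
  have hzero' : ∀ x ∉ W', g' x = 0 := fun x hx => by
    by_cases hxW : x ∈ W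
    · have : g x ≤ c := by simpa [hW', hxW] using hx
      have := hmin x hxW
      simp only [hg', hxW, if_true]
      linarith
    · simp [hg', hxW]
  have hsub : W' ⊆ W := Finset.filter_subset _ _
  have hrec := ih W' (Finset.filter_ssubset.2 ⟨x₀, hx₀, lt_irrefl _⟩) g'
    (fun x hx => by
      obtain ⟨h1, h2⟩ := Finset.mem_filter.1 hx
      simp only [hg', h1, if_true]
      linarith) hzero'
  rw [Finset.sum_subset hsub fun x _ hx => by simp [hzero' x hx],
    Finset.sum_subset hsub fun x _ hx => by
      simp only [hzero' x hx, zero_sub, max_eq_right (neg_nonpos.2 (hg'0 _)), mul_zero,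
        tsum_zero]] at hrec
  have hmass : ∑ x ∈ W, g x * m x = c * ∑ x ∈ W, m x + ∑ x ∈ W, g' x * m x := by
    rw [Finset.mul_sum, ← Finset.sum_add_distrib]
    refine Finset.sum_congr rfl fun x hx => ?_
    simp only [hg', hx, if_true]
    ring
  have hkey : ∑ x ∈ W, ∑' y, b x y * ρ x y * max (g x - g y) 0 =
      c * area b ρ W + ∑ x ∈ W, ∑' y, b x y * ρ x y * max (g' x - g' y) 0 := by
    rw [area, Finset.mul_sum, ← Finset.sum_add_distrib]
    refine Finset.sum_congr rfl fun x hx => ?_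
    rw [← tsum_mul_left, ← Summable.tsum_add (((hs x).indicator _).mul_left c)
      (summable_mul_posPart_sub hg'0 (fun y => mul_nonneg (hb x y) (hρ x y)) (hs x) x)]
    refine tsum_congr fun y => ?_
    by_cases hy : y ∈ W
    · simp [hg', hx, hy]
    · have h1 := hmin x hx
      rcases (hb x y).eq_or_lt with h0 | h0
      · simp [← h0]
      · simp only [hg', hx, hy, hzero y hy, if_true, if_false, sub_zero, Set.indicator,
          Set.mem_ofPred_eq, not_false_eq_true, h0, and_self]
        rw [max_eq_left (by linarith), max_eq_left (by linarith)]
        ring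
  rw [hmass, hkey, mul_add]
  have := mul_le_mul_of_nonneg_left (cheeger_mul_le_area hm hb hρ hW) hcpos.le
  linarith

/-- A nonnegative kernel on `X × X` which vanishes when the first argument lies outside a finite
set is summable as soon as its rows are. -/
lemma hasSum_prod_of_finite_rows {k : X → X → ℝ} (S : Finset X) (hk : ∀ x y, 0 ≤ k x y)
    (hks : ∀ x, Summable (k x)) (hzero : ∀ x ∉ S, ∀ y, k x y = 0) :
    HasSum (fun p : X × X => k p.1 p.2) (∑ x ∈ S, ∑' y, k x y) := by
  have hrow : ∀ x ∉ S, ∑' y, k x y = 0 := fun x hx => by simp [hzero x hx]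
  have hsum : Summable fun p : X × X => k p.1 p.2 :=
    (summable_prod_of_nonneg fun p => hk p.1 p.2).2
      ⟨hks, summable_of_ne_finset_zero (s := S) fun x hx => hrow x hx⟩
  have hfin : ∑' x, ∑' y, k x y = ∑ x ∈ S, ∑' y, k x y := tsum_eq_sum hrow
  rw [← hfin, ← hsum.tsum_prod]
  exact hsum.hasSum

lemma summable_and_tsum_le_of_ofReal {u : X → ℝ} {a : ℝ} (hu : ∀ y, 0 ≤ u y) (ha : 0 ≤ a)
    (h : ∑' y, ENNReal.ofReal (u y) ≤ ENNReal.ofReal a) : Summable u ∧ ∑' y, u y ≤ a := by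
  have hs : Summable u := by
    have := ENNReal.summable_toReal (ne_top_of_le_ne_top ENNReal.ofReal_ne_top h)
    simpa [ENNReal.toReal_ofReal, hu] using this
  refine ⟨hs, ?_⟩
  rwa [← ENNReal.ofReal_tsum_of_nonneg hu hs, ENNReal.ofReal_le_ofReal_iff ha] at h

lemma cheeger_sq_mul_le_energy {m : X → ℝ} {b ρ : X → X → ℝ} (hm : ∀ x, 0 < m x)
    (hb_symm : ∀ x y, b x y = b y x) (hb : ∀ x y, 0 ≤ b x y)
    (hb_sum : ∀ x, Summable fun y => b x y) (hρ : ∀ x y, 0 ≤ ρ x y)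
    (hsymm : ∀ x y, ρ x y = ρ y x)
    (hintr : ∀ x, ∑' y, ENNReal.ofReal (b x y * (ρ x y) ^ 2) ≤ ENNReal.ofReal (m x))
    (f : X → ℝ) (hf : (Function.support f).Finite) :
    (cheeger m b ρ) ^ 2 / 2 * ∑' x, (f x) ^ 2 * m x ≤
      (1 / 2) * ∑' p : X × X, b p.1 p.2 * (f p.1 - f p.2) ^ 2 := by
  set α := cheeger m b ρ
  have hα : 0 ≤ α := cheeger_nonneg hm hb hρ
  have hq : ∀ x y, 0 ≤ b x y * ρ x y ^ 2 := fun x y => mul_nonneg (hb x y) (sq_nonneg _)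
  have hw : ∀ x y, 0 ≤ b x y * ρ x y := fun x y => mul_nonneg (hb x y) (hρ x y)
  have hintr' := fun x => summable_and_tsum_le_of_ofReal (hq x) (hm x).le (hintr x)
  have hw_sum : ∀ x, Summable fun y => b x y * ρ x y := fun x =>
    Summable.of_nonneg_of_le (hw x)
      (fun y => by nlinarith [mul_nonneg (hb x y) (sq_nonneg (ρ x y - 1)), hb x y, hq x y])
      ((hb_sum x).add (hintr' x).1)
  set S := hf.toFinset
  have hS : ∀ x ∉ S, f x = 0 := fun x hx => by simpa [S] using hx
  have hSpos : ∀ x ∈ S, 0 < f x ^ 2 := fun x hx => by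
    have : f x ≠ 0 := by simpa [S] using hx
    positivity
  have hN : ∑' x, f x ^ 2 * m x = ∑ x ∈ S, f x ^ 2 * m x :=
    tsum_eq_sum fun x hx => by simp [hS x hx]
  have hcoarea := cheeger_mul_sum_le hm hb hρ hw_sum S (fun x => f x ^ 2) hSpos
    (fun x hx => by simp [hS x hx])
  have hU := hasSum_prod_of_finite_rows S
    (k := fun x y => b x y * ρ x y * max (f x ^ 2 - f y ^ 2) 0)
    (fun x y => mul_nonneg (hw x y) (le_max_right _ _))
    (fun x => summable_mul_posPart_sub (fun z => sq_nonneg (f z)) (hw x) (hw_sum x) x)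
    (fun x hx y => by simp [hS x hx, sq_nonneg])
  have hV := hasSum_prod_of_finite_rows S (k := fun x y => f x ^ 2 * (b x y * ρ x y ^ 2))
    (fun x y => mul_nonneg (sq_nonneg _) (hq x y)) (fun x => (hintr' x).1.mul_left _)
    (fun x hx y => by simp [hS x hx])
  have hB := hasSum_prod_of_finite_rows S (k := fun x y => f x ^ 2 * b x y)
    (fun x y => mul_nonneg (sq_nonneg _) (hb x y)) (fun x => (hb_sum x).mul_left _)
    (fun x hx y => by simp [hS x hx])
  have hswap : ∀ {u : X × X → ℝ} {a : ℝ}, HasSum u a → HasSum (fun p : X × X => u p.swap) a :=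
    fun h => (Equiv.prodComm X X).hasSum_iff.2 h
  have hE : Summable fun p : X × X => b p.1 p.2 * (f p.1 - f p.2) ^ 2 := by
    refine Summable.of_nonneg_of_le (fun p => mul_nonneg (hb _ _) (sq_nonneg _)) (fun p => ?_)
      ((hB.add (hswap hB)).mul_left 2).summable
    simp only [Prod.fst_swap, Prod.snd_swap, hb_symm p.2 p.1]
    nlinarith [mul_nonneg (hb p.1 p.2) (sq_nonneg (f p.1 + f p.2))]
  have hVle : ∑ x ∈ S, ∑' y, f x ^ 2 * (b x y * ρ x y ^ 2) ≤ ∑ x ∈ S, f x ^ 2 * m x :=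
    Finset.sum_le_sum fun x _ => by
      rw [tsum_mul_left]
      exact mul_le_mul_of_nonneg_left (hintr' x).2 (sq_nonneg _)
  have hmain := hasSum_le (fun p => ?_) ((hU.add (hswap hU)).mul_left α)
    (hE.hasSum.add ((hV.add (hswap hV)).mul_left (α ^ 2 / 2)))
  · rw [hN]
    have h1 := mul_le_mul_of_nonneg_left hcoarea hα
    have h2 := mul_le_mul_of_nonneg_left hVle (sq_nonneg α)
    linarith
  · simp only [Prod.fst_swap, Prod.snd_swap, hb_symm p.2 p.1, hsymm p.2 p.1]
    generalize f p.1 = s, f p.2 = t, hβ : b p.1 p.2 = β, hr : ρ p.1 p.2 = r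
    have hβ0 : 0 ≤ β := hβ ▸ hb _ _
    have habs : α * r * (max (s ^ 2 - t ^ 2) 0 + max (t ^ 2 - s ^ 2) 0) ≤
        (s - t) ^ 2 + α ^ 2 / 2 * (r ^ 2 * (s ^ 2 + t ^ 2)) := by
      have h0 := mul_nonneg (sq_nonneg (α * r)) (sq_nonneg (s - t))
      rcases le_total (t ^ 2) (s ^ 2) with h | h
      · rw [max_eq_left (by linarith), max_eq_right (by linarith)]
        nlinarith [sq_nonneg ((s - t) - α * r * (s + t) / 2)]
      · rw [max_eq_right (by linarith), max_eq_left (by linarith)]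
        nlinarith [sq_nonneg ((s - t) + α * r * (s + t) / 2)]
    have := mul_le_mul_of_nonneg_left habs hβ0
    linarith

end Auxiliary

theorem cheeger_inequality
    {X : Type*} [Countable X] [Infinite X]
    (m : X → ℝ) (hm : ∀ x, 0 < m x)
    (b : X → X → ℝ) (hb_symm : ∀ x y, b x y = b y x)
    (hb_nonneg : ∀ x y, 0 ≤ b x y) (hb_diag : ∀ x, b x x = 0)
    (hb_sum : ∀ x, Summable fun y => b x y)
    (ρ : X → X → ℝ)
    (hnonneg : ∀ x y, 0 ≤ ρ x y) (hrefl : ∀ x, ρ x x = 0)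
    (hsymm : ∀ x y, ρ x y = ρ y x)
    (htriangle : ∀ x y z, ρ x z ≤ ρ x y + ρ y z)
    -- ρ is intrinsic:
    (hintr : ∀ x, ∑' y, ENNReal.ofReal (b x y * (ρ x y) ^ 2) ≤ ENNReal.ofReal (m x)) :
    (∀ f : X → ℝ, (Function.support f).Finite →
      (cheeger m b ρ) ^ 2 / 2 * ∑' x, (f x) ^ 2 * m x ≤
        (1 / 2) * ∑' p : X × X, b p.1 p.2 * (f p.1 - f p.2) ^ 2) ∧
    (cheeger m b ρ) ^ 2 / 2 ≤
      sInf {t : ℝ | ∃ f : X → ℝ, (Function.support f).Finite ∧ f ≠ 0 ∧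
        t = ((1 / 2) * ∑' p : X × X, b p.1 p.2 * (f p.1 - f p.2) ^ 2) /
            (∑' x, (f x) ^ 2 * m x)} := by
  have key := cheeger_sq_mul_le_energy hm hb_symm hb_nonneg hb_sum hnonneg hsymm hintr
  refine ⟨key, le_csInf ?_ ?_⟩
  · classical
    obtain ⟨x⟩ := (inferInstance : Nonempty X)
    exact ⟨_, Pi.single x 1, (Set.finite_singleton x).subset Pi.support_single_subset,
      by simp, rfl⟩
  · rintro t ⟨f, hf, hf0, rfl⟩
    obtain ⟨x, hx⟩ := Function.ne_iff.1 hf0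
    have hx' : f x ≠ 0 := hx
    have hsum : Summable fun x => f x ^ 2 * m x :=
      summable_of_ne_finset_zero (s := hf.toFinset) fun y hy => by
        have : f y = 0 := by simpa using hy
        simp [this]
    rw [le_div_iff₀ (hsum.tsum_pos (fun y => mul_nonneg (sq_nonneg _) (hm y).le) x
      (mul_pos (by positivity) (hm x)))]
    exact key f hf

end Stmt17
end
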